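/- arXiv:1502.05832 — 2 statements merged into one kernel-verified Lean document; each statement's English description precedes it below -/
import Mathlib

section
/- Let N ≥ 1, let Ψ : {0,1}^N → ℝ, let p_i⁰ ∈ (0,1) for i = 1,…,N, and let G : (0,1)^N → ℝ be the mean-field Kullback–Leibler objective G(q) = Σ_{x ∈ {0,1}^N} Ψ(x) Π_j q_j^{x_j}(1−q_j)^{1−x_j} + Σ_i [ (1−q_i)log((1−q_i)/(1−p_i⁰)) + q_i·log(q_i/p_i⁰) ]. Then G is real analytic on (0,1)^N and satisfies the Kurdyka–Łojasiewicz property at every critical point q̄ ∈ (0,1)^N: there exist θ ∈ [1/2, 1), η > 0 and a neighborhood U of q̄ such that for all q ∈ U with G(q̄) < G(q) < G(q̄) + η, one has (1−θ)·(G(q) − G(q̄))^{−θ}·‖∇G(q)‖ ≥ 1. -/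
namespace LocalUniformization

open Filter Topology Function
open scoped ContDiff

section Analytic

variable {E : Type*} [NormedAddCommGroup E] [NormedSpace ℝ E]

theorem analyticAt_integral_comp {f : E → ℝ} (hf : AnalyticAt ℝ f 0) {L : ℝ → E →L[ℝ] E}
    (hL : Continuous L) (hb : ∀ s ∈ Set.Icc (0 : ℝ) 1, ‖L s‖ ≤ 1) :
    AnalyticAt ℝ (fun x => ∫ s in (0 : ℝ)..1, f (L s x)) 0 := by
  obtain ⟨p, r, hp⟩ := hf
  obtain ⟨r', hr0, hr⟩ := ENNReal.lt_iff_exists_nnreal_btwn.1 hp.r_pos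
  have hr0' : 0 < r' := by exact_mod_cast hr0
  have hcont : ∀ n, Continuous fun s => (p n).compContinuousLinearMap (fun _ => L s) := fun n =>
    (ContinuousMultilinearMap.compContinuousLinearMapLRight (p n)).cont.comp
      (continuous_pi fun _ => hL)
  have hbd : ∀ n, ∀ s ∈ Set.Icc (0 : ℝ) 1,
      ‖(p n).compContinuousLinearMap (fun _ => L s)‖ ≤ ‖p n‖ := fun n s hs =>
    (ContinuousMultilinearMap.norm_compContinuousLinearMap_le _ _).trans
      (mul_le_of_le_one_right (norm_nonneg _)
        (Finset.prod_le_one (fun _ _ => norm_nonneg _) fun _ _ => hb s hs))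
  have hsub : ∀ s, s ∈ Set.uIoc (0 : ℝ) 1 → s ∈ Set.Icc (0 : ℝ) 1 := fun s hs => by
    rw [Set.uIoc_of_le zero_le_one] at hs
    exact ⟨hs.1.le, hs.2⟩
  let q : FormalMultilinearSeries ℝ E ℝ := fun n =>
    ∫ s in (0 : ℝ)..1, (p n).compContinuousLinearMap (fun _ => L s)
  have hq : ∀ n, ‖q n‖ ≤ ‖p n‖ := fun n => by
    simpa using intervalIntegral.norm_integral_le_of_norm_le_const
      (a := (0 : ℝ)) (b := 1) (fun s hs => hbd n s (hsub s hs))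
  have hlt : (r' : ENNReal) < p.radius := hr.trans_le hp.r_le
  refine ⟨q, r', ?_, by exact_mod_cast hr0', ?_⟩
  · obtain ⟨C, -, hC⟩ := p.norm_mul_pow_le_of_lt_radius hlt
    exact q.le_radius_of_bound C fun n =>
      (mul_le_mul_of_nonneg_right (hq n) (by positivity)).trans (hC n)
  · intro y hy
    have hy' : ‖y‖ < r' := by simpa [Metric.eball_coe] using hy
    have happ : ∀ n, q n (fun _ => y) = ∫ s in (0 : ℝ)..1, p n (fun _ => L s y) := fun n => by
      have hi : IntervalIntegrable
          (fun s => (p n).compContinuousLinearMap (fun _ => L s)) MeasureTheory.volume 0 1 :=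
        (hcont n).intervalIntegrable _ _
      simp only [q, intervalIntegral.integral_of_le zero_le_one]
      rw [ContinuousMultilinearMap.integral_apply hi.1]
      rfl
    simp only [happ, zero_add]
    refine intervalIntegral.hasSum_integral_of_dominated_convergence
      (fun n _ => ‖p n‖ * (r' : ℝ) ^ n) ?_ ?_ ?_ ?_ ?_
    · intro n
      have : Continuous fun s => p n (fun _ => L s y) :=
        (p n).cont.comp (continuous_pi fun _ => hL.clm_apply continuous_const)
      exact this.aestronglyMeasurable
    · intro n
      refine .of_forall fun s hs => ((p n).le_opNorm _).trans ?_
      refine mul_le_mul_of_nonneg_left ?_ (norm_nonneg _)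
      simp only [Finset.prod_const, Finset.card_univ, Fintype.card_fin]
      refine pow_le_pow_left₀ (norm_nonneg _) ?_ n
      exact ((L s).le_of_opNorm_le (hb s (hsub s hs)) y).trans (by simpa using hy'.le)
    · exact .of_forall fun s _ => p.summable_norm_mul_pow hlt
    · exact intervalIntegrable_const
    · refine .of_forall fun s hs => ?_
      have : L s y ∈ Metric.eball (0 : E) r := by
        refine Metric.eball_subset_eball hr.le ?_
        have h1 := ((L s).le_of_opNorm_le (hb s (hsub s hs)) y)
        rw [one_mul] at h1
        simpa [Metric.eball_coe] using h1.trans_lt hy'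
      simpa using hp.hasSum this

theorem exists_ball_analyticOnNhd {f : E → ℝ} {x : E} (hf : AnalyticAt ℝ f x) :
    ∃ r > 0, AnalyticOnNhd ℝ f (Metric.ball x r) := by
  obtain ⟨r, hr, h⟩ := Metric.eventually_nhds_iff_ball.1 hf.eventually_analyticAt
  exact ⟨r, hr, fun y hy => h y hy⟩

theorem eventually_eq_zero_or_of_mul {f g : E → ℝ} {x : E} (hf : AnalyticAt ℝ f x)
    (hg : AnalyticAt ℝ g x) (h : ∀ᶠ y in 𝓝 x, f y * g y = 0) :
    (∀ᶠ y in 𝓝 x, f y = 0) ∨ ∀ᶠ y in 𝓝 x, g y = 0 := by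
  obtain ⟨r, hr, hfr⟩ := exists_ball_analyticOnNhd hf
  obtain ⟨s, hs, hgs⟩ := exists_ball_analyticOnNhd hg
  obtain ⟨t, ht, hfg⟩ := Metric.eventually_nhds_iff_ball.1 h
  set ρ := min r (min s t)
  have hρ : 0 < ρ := lt_min hr (lt_min hs ht)
  have hfr := hfr.mono (Metric.ball_subset_ball (min_le_left _ _) : Metric.ball x ρ ⊆ _)
  have hgs := hgs.mono (Metric.ball_subset_ball ((min_le_right _ _).trans (min_le_left _ _)) :
    Metric.ball x ρ ⊆ _)
  have hball : Metric.ball x ρ ∈ 𝓝 x := Metric.ball_mem_nhds _ hρ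
  by_cases hz : ∀ y ∈ Metric.ball x ρ, f y = 0
  · exact .inl (eventually_of_mem hball hz)
  · push Not at hz
    obtain ⟨y, hy, hfy⟩ := hz
    have hg0 : g =ᶠ[𝓝 y] 0 := by
      filter_upwards [(hfr y hy).continuousAt.eventually_ne hfy,
        Metric.isOpen_ball.mem_nhds hy] with z hz hzb
      exact (mul_eq_zero.1 (hfg z (Metric.ball_subset_ball
        ((min_le_right _ _).trans (min_le_right _ _)) hzb))).resolve_left hz
    exact .inr (eventually_of_mem hball fun z hz =>
      hgs.eqOn_zero_of_preconnected_of_eventuallyEq_zero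
        (convex_ball x ρ).isPreconnected hy hg0 hz)

theorem exists_line_not_eventually_eq_zero {f : E → ℝ} (hf : AnalyticAt ℝ f 0)
    (h : ¬ ∀ᶠ x in 𝓝 0, f x = 0) (h0 : f 0 = 0) :
    ∃ v : E, v ≠ 0 ∧ ¬ ∀ᶠ s : ℝ in 𝓝 0, f (s • v) = 0 := by
  obtain ⟨r, hr, hfr⟩ := exists_ball_analyticOnNhd hf
  have : ∃ v ∈ Metric.ball (0 : E) r, f v ≠ 0 := by
    by_contra! hc
    exact h (eventually_of_mem (Metric.ball_mem_nhds _ hr) hc)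
  obtain ⟨v, hv, hfv⟩ := this
  refine ⟨v, fun hv0 => hfv (hv0 ▸ h0), fun hz => hfv ?_⟩
  let l : ℝ →L[ℝ] E := (ContinuousLinearMap.id ℝ ℝ).smulRight v
  have hl : ∀ s, l s = s • v := fun s => by simp [l]
  have hU : Convex ℝ (l ⁻¹' Metric.ball (0 : E) r) :=
    (convex_ball _ _).linear_preimage l.toLinearMap
  have han : AnalyticOnNhd ℝ (fun s => f (l s)) (l ⁻¹' Metric.ball (0 : E) r) := fun s hs =>
    (hfr (l s) hs).comp (l.analyticAt s)
  have := han.eqOn_zero_of_preconnected_of_eventuallyEq_zero hU.isPreconnected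
    (z₀ := 0) (by simpa using hr) (by filter_upwards [hz] with s hs; simpa [hl] using hs)
    (show (1 : ℝ) ∈ _ by simpa [hl] using hv)
  simpa [hl] using this

end Analytic

section Division

variable {τ : Type*}

theorem analyticAt_coord [Fintype τ] {x : τ → ℝ} (k : τ) : AnalyticAt ℝ (fun x : τ → ℝ => x k) x :=
  (ContinuousLinearMap.proj (R := ℝ) (φ := fun _ : τ => ℝ) k).analyticAt x

theorem not_eventually_coord_eq_zero (k : τ) : ¬ ∀ᶠ x in 𝓝 (0 : τ → ℝ), x k = 0 := by
  intro h
  have hc : Tendsto (fun s : ℝ => (fun _ : τ => s)) (𝓝 0) (𝓝 0) :=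
    (continuous_pi fun _ => continuous_id).tendsto' _ _ rfl
  have h2 := (hc.eventually h)
  obtain ⟨r, hr, h3⟩ := Metric.eventually_nhds_iff_ball.1 h2
  have := h3 (r / 2) (by simp [abs_of_pos hr, hr])
  simp at this
  exact hr.ne' this

variable [Fintype τ] [DecidableEq τ]

theorem analyticAt_update {F : (τ → ℝ) → ℝ} {x : τ → ℝ} (k : τ) (hF : AnalyticAt ℝ F x) :
    AnalyticAt ℝ (fun y => update y k (F y)) x := by
  rw [analyticAt_pi_iff]
  intro j
  by_cases h : j = k
  · subst h; simpa using hF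
  · simpa [update_of_ne h] using analyticAt_coord j

theorem exists_eventually_eq_add_mul (k : τ) {f : (τ → ℝ) → ℝ} (hf : AnalyticAt ℝ f 0) :
    ∃ g, AnalyticAt ℝ g 0 ∧ ∀ᶠ x in 𝓝 0, f x = f (update x k 0) + x k * g x := by
  let P : (τ → ℝ) →L[ℝ] (τ → ℝ) :=
    (ContinuousLinearMap.proj (R := ℝ) (φ := fun _ : τ => ℝ) k).smulRight (Pi.single k (1 : ℝ))
  let L : ℝ → (τ → ℝ) →L[ℝ] (τ → ℝ) := fun s => ContinuousLinearMap.id ℝ _ + (s - 1) • P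
  have hLx : ∀ s x, L s x = update x k (s * x k) := by
    intro s x
    ext j
    by_cases h : j = k
    · subst h; simp [L, P]; ring
    · simp [L, P, h]
  have hL : Continuous L := by fun_prop
  have hb : ∀ s ∈ Set.Icc (0 : ℝ) 1, ‖L s‖ ≤ 1 := by
    intro s hs
    refine ContinuousLinearMap.opNorm_le_bound _ zero_le_one fun x => ?_
    rw [one_mul, hLx, pi_norm_le_iff_of_nonneg (norm_nonneg _)]
    intro j
    by_cases h : j = k
    · subst h
      simp only [update_self, norm_mul]
      have : ‖s‖ ≤ 1 := by rw [Real.norm_of_nonneg hs.1]; exact hs.2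
      exact (mul_le_of_le_one_left (norm_nonneg _) this).trans (norm_le_pi_norm x j)
    · simpa [h] using norm_le_pi_norm x j
  have hdf : AnalyticAt ℝ (fun x => fderiv ℝ f x (Pi.single k 1)) 0 :=
    ((ContinuousLinearMap.apply ℝ ℝ (Pi.single k (1 : ℝ) : τ → ℝ)).analyticAt _).comp hf.fderiv
  refine ⟨_, analyticAt_integral_comp hdf hL hb, ?_⟩
  obtain ⟨r, hr, hfr⟩ := exists_ball_analyticOnNhd hf
  filter_upwards [Metric.ball_mem_nhds _ hr] with x hx
  have hmem : ∀ s ∈ Set.Icc (0 : ℝ) 1, L s x ∈ Metric.ball (0 : τ → ℝ) r := fun s hs => by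
    have := (L s).le_of_opNorm_le (hb s hs) x
    simp only [one_mul, mem_ball_zero_iff] at this hx ⊢
    exact this.trans_lt hx
  have hLd : ∀ s, HasDerivAt (fun s => L s x) (x k • Pi.single k (1 : ℝ)) s := fun s => by
    have : HasDerivAt (fun s : ℝ => x + (s - 1) • P x) ((1 : ℝ) • P x) s :=
      (((hasDerivAt_id s).sub_const 1).smul_const (P x)).const_add x
    simpa [L, P] using this
  have hd : ∀ s ∈ Set.uIcc (0 : ℝ) 1, HasDerivAt (fun s => f (L s x))
      (x k * fderiv ℝ f (L s x) (Pi.single k 1)) s := by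
    intro s hs
    rw [Set.uIcc_of_le zero_le_one] at hs
    have := (hfr _ (hmem s hs)).differentiableAt.hasFDerivAt.comp_hasDerivAt s (hLd s)
    rw [map_smul, smul_eq_mul] at this
    exact this
  have hcont : ContinuousOn (fun s => x k * fderiv ℝ f (L s x) (Pi.single k 1))
      (Set.uIcc (0 : ℝ) 1) := by
    rw [Set.uIcc_of_le zero_le_one]
    intro s hs
    have h1 : ContinuousAt (fun y => fderiv ℝ f y (Pi.single k 1)) (L s x) :=
      ((hfr _ (hmem s hs)).fderiv.continuousAt).clm_apply continuousAt_const
    have h2 : ContinuousAt (fun s => L s x) s := (hLd s).continuousAt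
    exact (continuousAt_const.mul
      (ContinuousAt.comp (f := fun s => L s x) h1 h2)).continuousWithinAt
  have := intervalIntegral.integral_eq_sub_of_hasDerivAt hd hcont.intervalIntegrable
  rw [intervalIntegral.integral_const_mul] at this
  rw [this, hLx, hLx]
  simp

end Division

section NormalCrossing

variable {τ σ : Type*} [Fintype τ] [Fintype σ]

/-- Near the origin, `f` is a monomial in the coordinates times a nonvanishing analytic function. -/
def IsNormalCrossing (f : (τ → ℝ) → ℝ) : Prop :=
  ∃ (α : τ → ℕ) (u : (τ → ℝ) → ℝ), AnalyticAt ℝ u 0 ∧ u 0 ≠ 0 ∧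
    ∀ᶠ x in 𝓝 0, f x = (∏ k, x k ^ α k) * u x

theorem analyticAt_monomial (α : τ → ℕ) (x : τ → ℝ) :
    AnalyticAt ℝ (fun x : τ → ℝ => ∏ k, x k ^ α k) x :=
  Finset.analyticAt_fun_prod _ fun k _ => (analyticAt_coord k).pow _

theorem monomial_add_single [DecidableEq τ] (γ : τ → ℕ) (k : τ) (x : τ → ℝ) :
    ∏ i, x i ^ (γ + (Pi.single k 1 : τ → ℕ)) i = (∏ i, x i ^ γ i) * x k := by
  have : ∏ i, x i ^ (Pi.single k 1 : τ → ℕ) i = x k := by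
    rw [Finset.prod_eq_single k] <;> simp +contextual
  simp only [Pi.add_apply, pow_add, Finset.prod_mul_distrib, this]

theorem exists_eq_add_single [DecidableEq τ] {γ : τ → ℕ} {k : τ} (hk : γ k ≠ 0) :
    ∃ β : τ → ℕ, γ = β + (Pi.single k 1 : τ → ℕ) ∧ ∑ i, γ i = ∑ i, β i + 1 := by
  have h : γ = (γ - (Pi.single k 1 : τ → ℕ)) + (Pi.single k 1 : τ → ℕ) := by
    ext j
    simp only [Pi.add_apply, Pi.sub_apply, Pi.single_apply]
    split_ifs with hj
    · subst hj; omega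
    · omega
  refine ⟨_, h, ?_⟩
  conv_lhs => rw [h]
  simp [Finset.sum_add_distrib]

namespace IsNormalCrossing

variable {f g : (τ → ℝ) → ℝ}

theorem congr (hf : IsNormalCrossing f) (h : ∀ᶠ x in 𝓝 0, g x = f x) : IsNormalCrossing g := by
  obtain ⟨α, u, hu, hu0, hfu⟩ := hf
  exact ⟨α, u, hu, hu0, by filter_upwards [hfu, h] with x h1 h2; rw [h2, h1]⟩

theorem of_ne_zero (hf : AnalyticAt ℝ f 0) (h : f 0 ≠ 0) : IsNormalCrossing f :=
  ⟨0, f, hf, h, .of_forall fun x => by simp⟩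

theorem mul (hf : IsNormalCrossing f) (hg : IsNormalCrossing g) :
    IsNormalCrossing fun x => f x * g x := by
  obtain ⟨α, u, hu, hu0, hfu⟩ := hf
  obtain ⟨β, v, hv, hv0, hgv⟩ := hg
  refine ⟨α + β, fun x => u x * v x, hu.mul hv, mul_ne_zero hu0 hv0, ?_⟩
  filter_upwards [hfu, hgv] with x h1 h2
  simp only [h1, h2, Pi.add_apply, pow_add, Finset.prod_mul_distrib]
  ring

theorem pow (hf : IsNormalCrossing f) (n : ℕ) : IsNormalCrossing fun x => f x ^ n := by
  induction n with
  | zero => exact of_ne_zero (by simpa using analyticAt_const) (by simp)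
  | succ n ih => simpa only [pow_succ] using ih.mul hf

theorem prod {κ : Type*} {F : κ → (τ → ℝ) → ℝ} (s : Finset κ)
    (h : ∀ k ∈ s, IsNormalCrossing (F k)) :
    IsNormalCrossing fun x => ∏ k ∈ s, F k x := by
  classical
  induction s using Finset.induction_on with
  | empty => exact of_ne_zero (by simpa using analyticAt_const) (by simp)
  | insert a s ha ih =>
    simp only [Finset.prod_insert ha]
    exact (h a (by simp)).mul (ih fun k hk => h k (by simp [hk]))

theorem coord (k : τ) : IsNormalCrossing fun x : τ → ℝ => x k := by
  classical
  refine ⟨Pi.single k 1, fun _ => 1, analyticAt_const, one_ne_zero, .of_forall fun x => ?_⟩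
  rw [Finset.prod_eq_single k] <;> simp +contextual

theorem monomial (α : τ → ℕ) : IsNormalCrossing fun x : τ → ℝ => ∏ k, x k ^ α k :=
  ⟨α, fun _ => 1, analyticAt_const, one_ne_zero, by simp⟩

theorem comp (hf : IsNormalCrossing f) {π : (σ → ℝ) → τ → ℝ} (hπ : AnalyticAt ℝ π 0)
    (hπ0 : π 0 = 0) (h : ∀ k, IsNormalCrossing fun x => π x k) :
    IsNormalCrossing fun x => f (π x) := by
  obtain ⟨α, u, hu, hu0, hfu⟩ := hf
  have hu' : AnalyticAt ℝ (fun x => u (π x)) 0 := AnalyticAt.fun_comp (by rwa [hπ0]) hπ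
  have hc : Tendsto π (𝓝 0) (𝓝 0) := by simpa [hπ0] using hπ.continuousAt.tendsto
  exact ((prod Finset.univ fun k _ => (h k).pow (α k)).mul
    (of_ne_zero hu' (by rwa [hπ0]))).congr (hc.eventually hfu)

theorem not_eventually_eq_zero (hf : IsNormalCrossing f) : ¬ ∀ᶠ x in 𝓝 0, f x = 0 := by
  obtain ⟨α, u, hu, hu0, hfu⟩ := hf
  intro h
  have hc : Tendsto (fun s : ℝ => (fun _ : τ => s)) (𝓝[>] 0) (𝓝 0) :=
    ((continuous_pi fun _ => continuous_id).tendsto' _ _ rfl).mono_left nhdsWithin_le_nhds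
  have hne := hc.eventually (hfu.and (h.and (hu.continuousAt.eventually_ne hu0)))
  obtain ⟨s, ⟨h1, h2, h3⟩, hs⟩ := (hne.and self_mem_nhdsWithin).exists
  rw [h1] at h2
  have : (∏ k : τ, s ^ α k) ≠ 0 := Finset.prod_ne_zero_iff.2 fun k _ => pow_ne_zero _ (ne_of_gt hs)
  exact mul_ne_zero this h3 h2

theorem of_mul (hf : AnalyticAt ℝ f 0) (hg : AnalyticAt ℝ g 0)
    (h : IsNormalCrossing fun x => f x * g x) : IsNormalCrossing f ∧ IsNormalCrossing g := by
  classical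
  obtain ⟨α, u, hu, hu0, hfu⟩ := h
  obtain ⟨n, hn⟩ : ∃ n, n = ∑ k, α k := ⟨_, rfl⟩
  induction n generalizing f g α with
  | zero =>
    have hα : ∀ k, α k = 0 := by simpa using hn.symm
    have h0 : f 0 * g 0 ≠ 0 := by
      have := hfu.self_of_nhds
      simp only [hα, pow_zero, Finset.prod_const_one, one_mul] at this
      rwa [this]
    exact ⟨of_ne_zero hf (left_ne_zero_of_mul h0), of_ne_zero hg (right_ne_zero_of_mul h0)⟩
  | succ n ih =>
    obtain ⟨k, hk⟩ : ∃ k, α k ≠ 0 := by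
      by_contra! hc
      simp [hc] at hn
    obtain ⟨β, rfl, hβ⟩ := exists_eq_add_single hk
    have hβn : n = ∑ j, β j := by omega
    have hup : AnalyticAt ℝ (fun x : τ → ℝ => update x k 0) 0 :=
      analyticAt_update k analyticAt_const
    have hup0 : update (0 : τ → ℝ) k 0 = 0 := by simp
    have hupt : Tendsto (fun x : τ → ℝ => update x k 0) (𝓝 0) (𝓝 0) := by
      simpa using hup.continuousAt.tendsto
    have hprod : ∀ᶠ x in 𝓝 0, f (update x k 0) * g (update x k 0) = 0 := by
      filter_upwards [hupt.eventually hfu] with x hx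
      rw [hx, monomial_add_single]
      simp
    have key : ∀ {f g : (τ → ℝ) → ℝ}, AnalyticAt ℝ f 0 → AnalyticAt ℝ g 0 →
        (∀ᶠ x in 𝓝 0, f x * g x = (∏ j, x j ^ (β + (Pi.single k 1 : τ → ℕ)) j) * u x) →
        (∀ᶠ x in 𝓝 0, f (update x k 0) = 0) → IsNormalCrossing f ∧ IsNormalCrossing g := by
      intro f g hf hg hfu hf0
      obtain ⟨f', hf', hff'⟩ := exists_eventually_eq_add_mul k hf
      have hff : ∀ᶠ x in 𝓝 0, f x = x k * f' x := by
        filter_upwards [hff', hf0] with x h1 h2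
        rw [h1, h2, zero_add]
      have hz : ∀ᶠ x : τ → ℝ in 𝓝 0, x k * (f' x * g x - (∏ k, x k ^ β k) * u x) = 0 := by
        filter_upwards [hff, hfu] with x h1 h2
        rw [h1, monomial_add_single] at h2
        linear_combination h2
      have := (eventually_eq_zero_or_of_mul (analyticAt_coord k)
        ((hf'.mul hg).sub ((analyticAt_monomial β 0).mul hu)) hz).resolve_left
          (not_eventually_coord_eq_zero k)
      obtain ⟨h1, h2⟩ := ih hf' hg β (by filter_upwards [this] with x hx using sub_eq_zero.1 hx) hβn
      exact ⟨((coord k).mul h1).congr hff, h2⟩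
    rcases eventually_eq_zero_or_of_mul (AnalyticAt.fun_comp (by rwa [hup0]) hup)
      (AnalyticAt.fun_comp (by rwa [hup0]) hup) hprod with h | h
    · exact key hf hg hfu h
    · exact (key hg hf (by simpa only [mul_comm (g _)] using hfu) h).symm

theorem of_prod {κ : Type*} {F : κ → (τ → ℝ) → ℝ} {s : Finset κ}
    (hF : ∀ k ∈ s, AnalyticAt ℝ (F k) 0) (h : IsNormalCrossing fun x => ∏ k ∈ s, F k x)
    {k : κ} (hk : k ∈ s) : IsNormalCrossing (F k) := by
  classical
  rw [← Finset.insert_erase hk] at h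
  simp only [Finset.prod_insert (Finset.notMem_erase k s)] at h
  exact (of_mul (hF k hk) (Finset.analyticAt_fun_prod _ fun j hj =>
    hF j (Finset.mem_of_mem_erase hj)) h).1

end IsNormalCrossing

end NormalCrossing

section Exponents

variable {τ : Type*} [Fintype τ]

theorem eq_zero_of_pow_mul_eq {a b c : ℕ} {P Q R : ℝ → ℝ} {p q r : ℝ}
    (hP : Tendsto P (𝓝[>] 0) (𝓝 p)) (hQ : Tendsto Q (𝓝[>] 0) (𝓝 q))
    (hR : Tendsto R (𝓝[>] 0) (𝓝 r)) (hab : a < b) (hac : a < c)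
    (h : ∀ᶠ t in 𝓝[>] 0, t ^ a * P t = t ^ b * Q t + t ^ c * R t) : p = 0 := by
  have hid : Tendsto (fun t : ℝ => t) (𝓝[>] 0) (𝓝 0) := tendsto_id.mono_left nhdsWithin_le_nhds
  have hlim : Tendsto (fun t => t ^ (b - a) * Q t + t ^ (c - a) * R t) (𝓝[>] 0) (𝓝 0) := by
    have := ((hid.pow (b - a)).mul hQ).add ((hid.pow (c - a)).mul hR)
    rwa [zero_pow (by omega), zero_pow (by omega), zero_mul, zero_mul, add_zero] at this
  refine tendsto_nhds_unique hP (hlim.congr' ?_)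
  filter_upwards [h, self_mem_nhdsWithin] with t ht ht0
  have ht0 : t ≠ 0 := ne_of_gt ht0
  apply mul_left_cancel₀ (pow_ne_zero a ht0)
  rw [ht, mul_add, ← mul_assoc, ← mul_assoc, ← pow_add, ← pow_add, Nat.add_sub_cancel' hab.le,
    Nat.add_sub_cancel' hac.le]

theorem weight_eq {α β δ : τ → ℕ} {u v w : (τ → ℝ) → ℝ} (hu : ContinuousAt u 0)
    (hv : ContinuousAt v 0) (hw : ContinuousAt w 0) (hu0 : u 0 ≠ 0) (hw0 : w 0 ≠ 0)
    (h : ∀ᶠ x in 𝓝 0, (∏ k, x k ^ α k) * u x - (∏ k, x k ^ β k) * v x = (∏ k, x k ^ δ k) * w x)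
    {W : τ → ℕ} (hW : ∀ k, 0 < W k) (hlt : ∑ k, W k * α k < ∑ k, W k * β k) :
    ∑ k, W k * δ k = ∑ k, W k * α k := by
  have hc : Tendsto (fun t : ℝ => fun k => t ^ W k) (𝓝[>] 0) (𝓝 0) :=
    ((continuous_pi fun k => continuous_pow (W k)).tendsto' _ _
      (by ext k; simp [(hW k).ne'])).mono_left nhdsWithin_le_nhds
  have hm : ∀ (t : ℝ) (γ : τ → ℕ), ∏ k, (t ^ W k) ^ γ k = t ^ ∑ k, W k * γ k := fun t γ => by
    simp only [← pow_mul, Finset.prod_pow_eq_pow_sum]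
  have h' := hc.eventually h
  simp only [hm] at h'
  have hut := hu.tendsto.comp hc
  have hvt := hv.tendsto.comp hc
  have hwt := hw.tendsto.comp hc
  rcases lt_trichotomy (∑ k, W k * δ k) (∑ k, W k * α k) with hlt' | heq | hgt
  · refine absurd (eq_zero_of_pow_mul_eq hwt hut hvt.neg hlt' (hlt'.trans hlt) ?_) hw0
    filter_upwards [h'] with t ht
    simp only [comp_apply]
    linear_combination -ht
  · exact heq
  · refine absurd (eq_zero_of_pow_mul_eq hut hvt hwt hlt hgt ?_) hu0
    filter_upwards [h'] with t ht
    simp only [comp_apply]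
    linear_combination ht

theorem eq_of_lt_of_sub_eq {α β δ : τ → ℕ} {u v w : (τ → ℝ) → ℝ} (hu : ContinuousAt u 0)
    (hv : ContinuousAt v 0) (hw : ContinuousAt w 0) (hu0 : u 0 ≠ 0) (hw0 : w 0 ≠ 0)
    (h : ∀ᶠ x in 𝓝 0, (∏ k, x k ^ α k) * u x - (∏ k, x k ^ β k) * v x = (∏ k, x k ^ δ k) * w x)
    {j : τ} (hj : α j < β j) (i : τ) : δ i = α i := by
  classical
  set M := ∑ k, α k + α i + 1 with hM
  have hsum : ∀ (ε : ℕ) (γ : τ → ℕ), ∑ k, (1 + (if k = j then M else 0) +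
      if k = i then ε else 0) * γ k = ∑ k, γ k + M * γ j + ε * γ i := fun ε γ => by
    simp [add_mul, Finset.sum_add_distrib]
  have key : ∀ ε ≤ 1, ∑ k, δ k + M * δ j + ε * δ i = ∑ k, α k + M * α j + ε * α i := by
    intro ε hε
    rw [← hsum ε δ, ← hsum ε α]
    refine weight_eq hu hv hw hu0 hw0 h (fun k => by positivity) ?_
    rw [hsum, hsum]
    nlinarith [Nat.zero_le (∑ k, β k), Nat.zero_le (β i)]
  have h0 := key 0 zero_le_one
  have h1 := key 1 le_rfl
  omega

theorem le_or_le_of_sub_eq {α β : τ → ℕ} {u v c : (τ → ℝ) → ℝ} (hu : ContinuousAt u 0)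
    (hv : ContinuousAt v 0) (hu0 : u 0 ≠ 0) (hv0 : v 0 ≠ 0)
    (h : ∀ᶠ x in 𝓝 0, (∏ k, x k ^ α k) * u x - (∏ k, x k ^ β k) * v x = c x)
    (hc : (∀ᶠ x in 𝓝 0, c x = 0) ∨ IsNormalCrossing c) : α ≤ β ∨ β ≤ α := by
  by_contra! hcon
  obtain ⟨h1, h2⟩ := hcon
  simp only [Pi.le_def, not_forall, not_le] at h1 h2
  obtain ⟨j, hj⟩ := h1
  obtain ⟨k, hk⟩ := h2
  rcases hc with hc | ⟨δ, w, hw, hw0, hcw⟩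
  · have h' : ∀ᶠ x in 𝓝 0, (∏ k, x k ^ β k) * (2 * v x) - (∏ k, x k ^ α k) * u x =
        (∏ k, x k ^ α k) * u x := by
      filter_upwards [h, hc] with x h1 h2
      rw [h2] at h1
      linear_combination -2 * h1
    have := eq_of_lt_of_sub_eq (continuousAt_const.mul hv) hu hu (mul_ne_zero two_ne_zero hv0) hu0
      h' hj j
    omega
  · have e1 := eq_of_lt_of_sub_eq hu hv hw.continuousAt hu0 hw0
      (by filter_upwards [h, hcw] with x h1 h2; rw [h1, h2]) hk j
    have e2 := eq_of_lt_of_sub_eq hv hu hw.continuousAt.neg hv0 (neg_ne_zero.2 hw0) (δ := δ)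
      (by filter_upwards [h, hcw] with x h1 h2
          simp only [Pi.neg_apply]
          linear_combination -h1 - h2)
      hj j
    omega

end Exponents

section Lifts

variable {ι τ σ : Type*} [Fintype τ] [Fintype σ] {l : Ultrafilter ι}

/-- The family `y` is a lift of the family `x` through the analytic map `π`. -/
structure Lifts (l : Ultrafilter ι) (x : ι → τ → ℝ) (π : (τ → ℝ) → τ → ℝ) (y : ι → τ → ℝ) :
    Prop where
  analyticAt : AnalyticAt ℝ π 0
  map_zero : π 0 = 0
  tendsto : Tendsto y l (𝓝 0)
  eventually_eq : ∀ᶠ i in l, π (y i) = x i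

theorem Lifts.trans {x y z : ι → τ → ℝ} {π ρ : (τ → ℝ) → τ → ℝ} (h : Lifts l x π y)
    (h' : Lifts l y ρ z) : Lifts l x (fun t => π (ρ t)) z where
  analyticAt := AnalyticAt.fun_comp (by rw [h'.map_zero]; exact h.analyticAt) h'.analyticAt
  map_zero := by rw [h'.map_zero, h.map_zero]
  tendsto := h'.tendsto
  eventually_eq := by
    filter_upwards [h.eventually_eq, h'.eventually_eq] with i h1 h2
    rw [h2, h1]

theorem Lifts.tendsto_map {x y : ι → τ → ℝ} {π : (τ → ℝ) → τ → ℝ} (h : Lifts l x π y) :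
    Tendsto π (𝓝 0) (𝓝 0) := by
  simpa [h.map_zero] using h.analyticAt.continuousAt.tendsto

theorem Lifts.analyticAt_comp {x y : ι → τ → ℝ} {π : (τ → ℝ) → τ → ℝ} (h : Lifts l x π y)
    {f : (τ → ℝ) → ℝ} (hf : AnalyticAt ℝ f 0) : AnalyticAt ℝ (fun t => f (π t)) 0 :=
  AnalyticAt.fun_comp (by rwa [h.map_zero]) h.analyticAt

theorem exists_tendsto_of_eventually_abs_le {r : ι → ℝ} {C : ℝ} (h : ∀ᶠ i in l, |r i| ≤ C) :
    ∃ a, Tendsto r l (𝓝 a) := by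
  obtain ⟨a, -, ha⟩ := (isCompact_Icc (a := -C) (b := C)).ultrafilter_le_nhds (l.map r) (by
    rw [le_principal_iff]
    exact mem_map.2 (h.mono fun i hi => abs_le.1 hi))
  exact ⟨a, ha⟩

/-- Local uniformization along `l`: every nonzero analytic germ pulls back to a normal crossing
through a map lifting a given family of points converging to the origin along `l`. -/
def Uniformizable (l : Ultrafilter ι) (τ : Type*) [Fintype τ] : Prop :=
  ∀ f : (τ → ℝ) → ℝ, AnalyticAt ℝ f 0 → (¬ ∀ᶠ x in 𝓝 0, f x = 0) →
    ∀ x : ι → τ → ℝ, Tendsto x l (𝓝 0) →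
      ∃ π y, Lifts l x π y ∧ IsNormalCrossing fun t => f (π t)

theorem not_eventually_prod_eq_zero {κ : Type*} {F : κ → (τ → ℝ) → ℝ} (s : Finset κ)
    (hF : ∀ k, AnalyticAt ℝ (F k) 0) (hF0 : ∀ k, ¬ ∀ᶠ x in 𝓝 0, F k x = 0) :
    ¬ ∀ᶠ x in 𝓝 0, ∏ k ∈ s, F k x = 0 := by
  classical
  induction s using Finset.induction_on with
  | empty => simp [nhds_neBot.ne]
  | insert a s ha ih =>
    simp only [Finset.prod_insert ha]
    exact fun h => (eventually_eq_zero_or_of_mul (hF a)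
      (Finset.analyticAt_fun_prod _ fun k _ => hF k) h).elim (hF0 a) ih

theorem Uniformizable.family (hU : Uniformizable l τ) {κ : Type*} [Fintype κ]
    {F : κ → (τ → ℝ) → ℝ} (hF : ∀ k, AnalyticAt ℝ (F k) 0) {x : ι → τ → ℝ}
    (hx : Tendsto x l (𝓝 0)) : ∃ π y, Lifts l x π y ∧
      ∀ k, (∀ᶠ t in 𝓝 0, F k t = 0) ∨ IsNormalCrossing fun t => F k (π t) := by
  classical
  let F' : κ → (τ → ℝ) → ℝ := fun k => if ∀ᶠ x in 𝓝 0, F k x = 0 then fun _ => 1 else F k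
  have hF' : ∀ k, AnalyticAt ℝ (F' k) 0 := fun k => by
    simp only [F']; split_ifs
    exacts [analyticAt_const, hF k]
  have hF0 : ∀ k, ¬ ∀ᶠ x in 𝓝 0, F' k x = 0 := fun k => by
    simp only [F']; split_ifs with h
    exacts [by simp [nhds_neBot.ne], h]
  obtain ⟨π, y, hL, hnc⟩ := hU _ (Finset.analyticAt_fun_prod Finset.univ fun k _ => hF' k)
    (not_eventually_prod_eq_zero Finset.univ hF' hF0) x hx
  refine ⟨π, y, hL, fun k => ?_⟩
  by_cases hk : ∀ᶠ x in 𝓝 0, F k x = 0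
  · exact .inl hk
  · refine .inr ?_
    have := IsNormalCrossing.of_prod (F := fun k t => F' k (π t))
      (fun k _ => hL.analyticAt_comp (hF' k)) hnc (Finset.mem_univ k)
    simpa only [F', if_neg hk] using this

theorem exists_lifts_pow {M : ℕ} (hM : M ≠ 0) {x : ι → τ → ℝ} (hx : Tendsto x l (𝓝 0)) :
    ∃ (s : τ → ℝ) (y : ι → τ → ℝ), (∀ k, s k ≠ 0) ∧ Lifts l x (fun t k => s k * t k ^ M) y := by
  classical
  refine ⟨fun k => if ∀ᶠ i in l, 0 ≤ x i k then 1 else -1,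
    fun i k => |x i k| ^ ((M : ℝ)⁻¹), fun k => ?_, ?_, ?_, ?_, ?_⟩
  · simp only []; split_ifs <;> norm_num
  · exact analyticAt_pi_iff.2 fun k => analyticAt_const.mul ((analyticAt_coord k).pow M)
  · ext k; simp [hM]
  · rw [tendsto_pi_nhds] at hx ⊢
    intro k
    have hc : Continuous fun a : ℝ => |a| ^ ((M : ℝ)⁻¹) :=
      continuous_abs.rpow_const fun _ => .inr (by positivity)
    exact (hc.tendsto' 0 0 (by simp [hM])).comp (hx k)
  · have : ∀ k, ∀ᶠ i in l,
        (if ∀ᶠ i in l, 0 ≤ x i k then (1 : ℝ) else -1) * (|x i k| ^ ((M : ℝ)⁻¹)) ^ M = x i k := by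
      intro k
      simp only [Real.rpow_inv_natCast_pow (abs_nonneg _) hM]
      split_ifs with h
      · filter_upwards [h] with i hi
        rw [one_mul, abs_of_nonneg hi]
      · filter_upwards [Ultrafilter.eventually_not.2 h] with i hi
        rw [abs_of_neg (not_le.1 hi)]
        ring
    filter_upwards [eventually_all.2 this] with i hi
    exact funext hi

end Lifts

section Monomialize

variable {ι σ : Type*} [Fintype σ] {l : Ultrafilter ι}

/-- The coefficients of a depressed polynomial can be made divisible by the appropriate powers of a
common monomial, one of the quotients being a unit. -/
theorem Uniformizable.monomialize (hU : Uniformizable l σ) {d : ℕ} {c : Fin d → (σ → ℝ) → ℝ}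
    (hc : ∀ i, AnalyticAt ℝ (c i) 0) {h : (σ → ℝ) → ℝ} (hh : AnalyticAt ℝ h 0)
    (hh0 : ¬ ∀ᶠ t in 𝓝 0, h t = 0) {x : ι → σ → ℝ} (hx : Tendsto x l (𝓝 0)) :
    ∃ π y, Lifts l x π y ∧ (IsNormalCrossing fun t => h (π t)) ∧
      ((∀ i, ∀ᶠ t in 𝓝 0, c i (π t) = 0) ∨
        ∃ (γ : σ → ℕ) (C : Fin d → (σ → ℝ) → ℝ), (∀ i, AnalyticAt ℝ (C i) 0) ∧
          (∀ i, ∀ᶠ t in 𝓝 0, c i (π t) = (∏ k, t k ^ γ k) ^ (d + 1 - i : ℕ) * C i t) ∧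
          ∃ i, C i 0 ≠ 0) := by
  classical
  obtain ⟨e, he⟩ : ∃ e : Fin d → ℕ, ∀ i, e i * (d + 1 - i) = (d + 1).factorial :=
    ⟨fun i => (d + 1).factorial / (d + 1 - i), fun i =>
      Nat.div_mul_cancel (Nat.dvd_factorial (by omega) (by omega))⟩
  set M := (d + 1).factorial with hM
  have hM0 : M ≠ 0 := Nat.factorial_ne_zero _
  let F : Option (Fin d) ⊕ Fin d × Fin d → (σ → ℝ) → ℝ
    | .inl none => h
    | .inl (some i) => c i
    | .inr (i, j) => fun t => c i t ^ e i - c j t ^ e j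
  have hF : ∀ k, AnalyticAt ℝ (F k) 0 := by
    rintro ((_ | i) | ⟨i, j⟩)
    exacts [hh, hc i, ((hc i).pow _).sub ((hc j).pow _)]
  obtain ⟨π, y, hL, hnc⟩ := hU.family hF hx
  have hh' : IsNormalCrossing fun t => h (π t) := (hnc (.inl none)).resolve_left hh0
  by_cases hall : ∀ i, ∀ᶠ t in 𝓝 0, c i t = 0
  · exact ⟨π, y, hL, hh', .inl fun i => hL.tendsto_map.eventually (hall i)⟩
  have hex : ∀ i, ∃ (α : σ → ℕ) (u : (σ → ℝ) → ℝ), AnalyticAt ℝ u 0 ∧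
      (∀ᶠ t in 𝓝 0, c i (π t) = (∏ k, t k ^ α k) * u t) ∧
        (u 0 ≠ 0 ∨ (∀ᶠ t in 𝓝 0, c i t = 0) ∧ u = 0) := by
    intro i
    by_cases hi : ∀ᶠ t in 𝓝 0, c i t = 0
    · exact ⟨0, 0, analyticAt_const, by simpa using hL.tendsto_map.eventually hi, .inr ⟨hi, rfl⟩⟩
    · obtain ⟨α, u, hu, hu0, hcu⟩ := (hnc (.inl (some i))).resolve_left hi
      exact ⟨α, u, hu, hcu, .inl hu0⟩
  choose α u hu hcu hu0 using hex
  have hpow : ∀ i (t : σ → ℝ), ((∏ k, t k ^ α i k) * u i t) ^ e i =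
      (∏ k, t k ^ (e i • α i) k) * u i t ^ e i := fun i t => by
    simp only [mul_pow, ← Finset.prod_pow, ← pow_mul, Pi.smul_apply, smul_eq_mul, mul_comm (e i)]
  have hcmp : ∀ i j, u i 0 ≠ 0 → u j 0 ≠ 0 → e i • α i ≤ e j • α j ∨ e j • α j ≤ e i • α i := by
    intro i j hi hj
    refine le_or_le_of_sub_eq (u := fun t => u i t ^ e i) (v := fun t => u j t ^ e j)
      ((hu i).pow _).continuousAt ((hu j).pow _).continuousAt
      (pow_ne_zero _ hi) (pow_ne_zero _ hj) (c := fun t => F (.inr (i, j)) (π t)) ?_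
      ((hnc (.inr (i, j))).imp_left fun h => hL.tendsto_map.eventually h)
    filter_upwards [hcu i, hcu j] with t h1 h2
    simp only [F, h1, h2, hpow]
  obtain ⟨i₀, hi₀⟩ : ∃ i, u i 0 ≠ 0 := by
    by_contra! hcon
    exact hall fun i => ((hu0 i).resolve_left (by simp [hcon i])).1
  obtain ⟨i₁, hi₁, hmin⟩ : ∃ i, u i 0 ≠ 0 ∧ ∀ j, u j 0 ≠ 0 → e i • α i ≤ e j • α j := by
    obtain ⟨i, hi, h⟩ := (Finset.univ.filter fun i => u i 0 ≠ 0).exists_minimalFor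
      (fun i => e i • α i) ⟨i₀, by simpa using hi₀⟩
    rw [Finset.mem_filter] at hi
    exact ⟨i, hi.2, fun j hj => (hcmp i j hi.2 hj).elim id fun hle => h (by simpa using hj) hle⟩
  obtain ⟨s, z, hs, hL'⟩ := exists_lifts_pow hM0 hL.tendsto
  set ρ : (σ → ℝ) → σ → ℝ := fun t k => s k * t k ^ M with hρ
  set γ := e i₁ • α i₁ with hγ
  refine ⟨_, z, hL.trans hL', hh'.comp hL'.analyticAt hL'.map_zero fun k =>
      (IsNormalCrossing.of_ne_zero analyticAt_const (hs k)).mul ((IsNormalCrossing.coord k).pow M),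
    .inr ⟨γ, fun i t => (∏ k, t k ^ (M * α i k - (d + 1 - i) * γ k)) *
      ((∏ k, s k ^ α i k) * u i (ρ t)), fun i => ?_, fun i => ?_, i₁, ?_⟩⟩
  · exact (analyticAt_monomial _ _).mul (analyticAt_const.mul (hL'.analyticAt_comp (hu i)))
  · filter_upwards [hL'.tendsto_map.eventually (hcu i)] with t ht
    rw [ht]
    rcases hu0 i with hi | ⟨-, hi⟩
    · have : ∀ k, (d + 1 - i) * γ k + (M * α i k - (d + 1 - i) * γ k) = M * α i k := fun k => by
        refine Nat.add_sub_cancel' ?_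
        rw [← he i, mul_comm (e i), mul_assoc]
        exact Nat.mul_le_mul_left _ (hmin i hi k)
      have h2 : (∏ k, t k ^ γ k) ^ (d + 1 - i : ℕ) *
          ∏ k, t k ^ (M * α i k - (d + 1 - i) * γ k) = ∏ k, (t k ^ M) ^ α i k := by
        rw [← Finset.prod_pow, ← Finset.prod_mul_distrib]
        refine Finset.prod_congr rfl fun k _ => ?_
        rw [← pow_mul, ← pow_mul, ← pow_add, mul_comm (γ k), this]
      simp only [hρ, mul_pow, Finset.prod_mul_distrib]
      rw [← mul_assoc _ _ (_ * _), h2]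
      ring
    · simp [hi]
  · have : ∀ k, M * α i₁ k - (d + 1 - i₁) * γ k = 0 := fun k => by
      rw [hγ, ← he i₁, Pi.smul_apply, smul_eq_mul]
      exact Nat.sub_eq_zero_of_le (by nlinarith)
    simp only [this, pow_zero, Finset.prod_const_one, one_mul, hL'.map_zero]
    exact mul_ne_zero (Finset.prod_ne_zero_iff.2 fun k _ => pow_ne_zero _ (hs k)) hi₁

end Monomialize

section Toric

variable {ι τ : Type*} [Fintype τ] [DecidableEq τ] {l : Ultrafilter ι}

theorem monomial_update {γ : τ → ℕ} {j : τ} (hj : γ j = 0) (x : τ → ℝ) (a : ℝ) :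
    ∏ k, update x j a k ^ γ k = ∏ k, x k ^ γ k := by
  refine Finset.prod_congr rfl fun k _ => ?_
  by_cases h : k = j
  · subst h; simp [hj]
  · simp [h]

/-- If the coordinate `j` dominates a monomial along `x`, then it divides the monomial after
finitely many monomial substitutions lifting `x`. -/
theorem exists_lifts_monomial_dvd {j : τ} {γ : τ → ℕ} (hj : γ j = 0) {x : ι → τ → ℝ}
    (hx : Tendsto x l (𝓝 0)) (ho : ∀ C : ℝ, ∀ᶠ i in l, C * |∏ k, x i k ^ γ k| < |x i j|) :
    ∃ π y w, Lifts l x π y ∧ (∀ k, IsNormalCrossing fun t => π t k) ∧ AnalyticAt ℝ w 0 ∧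
      w 0 = 0 ∧ ∀ᶠ t in 𝓝 0, ∏ k, π t k ^ γ k = π t j * w t := by
  obtain ⟨n, hn⟩ : ∃ n, n = ∑ k, γ k := ⟨_, rfl⟩
  induction n generalizing γ x with
  | zero =>
    have hγ : ∀ k, γ k = 0 := by simpa using hn.symm
    exfalso
    have h1 : ∀ᶠ i in l, 1 < |x i j| := by simpa [hγ] using ho 1
    have h2 : Tendsto (fun i => |x i j|) l (𝓝 0) := by
      simpa using ((tendsto_pi_nhds.1 hx) j).abs
    obtain ⟨i, h3, h4⟩ := (h1.and (h2.eventually_lt_const one_pos)).exists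
    exact lt_asymm h3 h4
  | succ n ih =>
    obtain ⟨k, hk⟩ : ∃ k, γ k ≠ 0 := by
      by_contra! hc
      simp [hc] at hn
    have hkj : k ≠ j := fun h => hk (h ▸ hj)
    obtain ⟨β, rfl, hβ⟩ := exists_eq_add_single hk
    have hβj : β j = 0 := by
      simp only [Pi.add_apply] at hj
      omega
    have hxj : ∀ᶠ i in l, x i j ≠ 0 := by
      filter_upwards [ho 0] with i hi
      simpa using hi
    have hxk := (tendsto_pi_nhds.1 hx) k
    by_cases hP : ∃ C : ℝ, ∀ᶠ i in l, |x i k| ≤ C * |x i j|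
    · obtain ⟨C, hC⟩ := hP
      obtain ⟨a, ha⟩ : ∃ a, Tendsto (fun i => x i k / x i j) l (𝓝 a) :=
        exists_tendsto_of_eventually_abs_le (C := C) (by
          filter_upwards [hC, hxj] with i h1 h2
          rwa [abs_div, div_le_iff₀ (abs_pos.2 h2)])
      have hL : Lifts l x (fun t => update t k (t j * (a + t k)))
          (fun i => update (x i) k (x i k / x i j - a)) := by
        refine ⟨analyticAt_update k ((analyticAt_coord j).mul
          (analyticAt_const.add (analyticAt_coord k))), by simp, ?_, ?_⟩
        · have := hx.update k (ha.sub_const a)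
          simpa using this
        · filter_upwards [hxj] with i hi
          simp [update_of_ne hkj.symm, mul_div_cancel₀ _ hi]
      set π : (τ → ℝ) → τ → ℝ := fun t => update t k (t j * (a + t k)) with hπ
      have hw : AnalyticAt ℝ (fun t : τ → ℝ => (∏ m, π t m ^ β m) * (a + t k)) 0 :=
        (hL.analyticAt_comp (analyticAt_monomial β 0)).mul
          (analyticAt_const.add (analyticAt_coord k))
      have hπw : ∀ t, ∏ m, π t m ^ (β + (Pi.single k 1 : τ → ℕ)) m =
          π t j * ((∏ m, π t m ^ β m) * (a + t k)) := fun t => by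
        rw [monomial_add_single]
        simp only [hπ, update_self, update_of_ne hkj.symm]
        ring
      refine ⟨π, _, _, hL, fun m => ?_, hw, ?_, .of_forall hπw⟩
      · by_cases hm : m = k
        · subst hm
          simp only [hπ, update_self]
          refine (IsNormalCrossing.coord j).mul ?_
          by_cases ha0 : a = 0
          · simpa [ha0] using IsNormalCrossing.coord m
          · exact .of_ne_zero (analyticAt_const.add (analyticAt_coord m)) (by simpa using ha0)
        · simpa [hπ, hm] using IsNormalCrossing.coord m
      · by_contra hw0
        have hlim := (hw.continuousAt.tendsto.comp hL.tendsto).abs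
        obtain ⟨i, h1, h2, h3⟩ := ((hlim.eventually_const_lt (half_lt_self (abs_pos.2 hw0))).and
          (hL.eventually_eq.and (ho (2 / |(∏ m, π 0 m ^ β m) * (a + (0 : τ → ℝ) k)|)))).exists
        rw [← h2, hπw, abs_mul (π _ j)] at h3
        simp only [comp_apply] at h1
        have hpos := abs_pos.2 hw0
        rw [div_mul_eq_mul_div, div_lt_iff₀ hpos] at h3
        nlinarith [abs_nonneg (π (update (x i) k (x i k / x i j - a)) j)]
    · push Not at hP
      have hxk0 : ∀ᶠ i in l, x i k ≠ 0 := by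
        filter_upwards [hP 0] with i hi
        simpa using hi
      have hr : Tendsto (fun i => x i j / x i k) l (𝓝 0) := by
        rw [Metric.tendsto_nhds]
        intro ε hε
        filter_upwards [hP (1 / ε), hxk0] with i h1 h2
        rw [dist_zero_right, Real.norm_eq_abs, abs_div, div_lt_iff₀ (abs_pos.2 h2)]
        rwa [div_mul_eq_mul_div, one_mul, div_lt_iff₀ hε, mul_comm] at h1
      have hL : Lifts l x (fun t => update t j (t k * t j))
          (fun i => update (x i) j (x i j / x i k)) := by
        refine ⟨analyticAt_update j ((analyticAt_coord k).mul (analyticAt_coord j)), by simp,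
          ?_, ?_⟩
        · simpa using hx.update j hr
        · filter_upwards [hxk0] with i hi
          simp [update_of_ne hkj, mul_div_cancel₀ _ hi]
      obtain ⟨π, y, w, hL', hnc, hw, hw0, h⟩ := ih hβj hL.tendsto (fun C => by
        filter_upwards [ho C, hxk0] with i h1 h2
        rw [monomial_add_single, abs_mul, ← mul_assoc] at h1
        rwa [monomial_update hβj, update_self, abs_div, lt_div_iff₀ (abs_pos.2 h2)]) (by omega)
      refine ⟨_, y, w, hL.trans hL', fun m => ?_, hw, hw0, ?_⟩
      · by_cases hm : m = j
        · subst hm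
          simpa using (hnc k).mul (hnc m)
        · simpa [hm] using hnc m
      · filter_upwards [h] with t ht
        rw [monomial_update hj, monomial_add_single, ht, update_self]
        ring

end Toric

section Option

variable {σ : Type*}

/-- The point of `Option σ → ℝ` with distinguished coordinate `s` and remaining coordinates `t`. -/
def cons (s : ℝ) (t : σ → ℝ) : Option σ → ℝ := fun o => o.elim s t

/-- The nondistinguished coordinates of a point of `Option σ → ℝ`. -/
def tail (x : Option σ → ℝ) : σ → ℝ := fun k => x (some k)

@[simp] theorem cons_none (s : ℝ) (t : σ → ℝ) : cons s t none = s := rfl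
@[simp] theorem cons_some (s : ℝ) (t : σ → ℝ) (k : σ) : cons s t (some k) = t k := rfl
@[simp] theorem tail_cons (s : ℝ) (t : σ → ℝ) : tail (cons s t) = t := rfl
@[simp] theorem tail_apply (x : Option σ → ℝ) (k : σ) : tail x k = x (some k) := rfl
@[simp] theorem tail_zero : tail (0 : Option σ → ℝ) = 0 := rfl
@[simp] theorem cons_zero_zero : cons 0 (0 : σ → ℝ) = 0 := by ext (_ | k) <;> rfl
@[simp] theorem cons_self (x : Option σ → ℝ) : cons (x none) (tail x) = x := by
  ext (_ | k) <;> rfl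

theorem update_none [DecidableEq σ] (x : Option σ → ℝ) (s : ℝ) :
    update x none s = cons s (tail x) := by
  ext (_ | k) <;> simp

theorem tendsto_cons {ι : Type*} {l : Filter ι} {a : ι → ℝ} {b : ι → σ → ℝ} {s : ℝ} {t : σ → ℝ}
    (ha : Tendsto a l (𝓝 s)) (hb : Tendsto b l (𝓝 t)) :
    Tendsto (fun i => cons (a i) (b i)) l (𝓝 (cons s t)) := by
  rw [tendsto_pi_nhds] at *
  rintro (_ | k)
  exacts [ha, hb k]

theorem eventually_cons_zero {p : (Option σ → ℝ) → Prop} (h : ∀ᶠ x in 𝓝 0, p x) :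
    ∀ᶠ t : σ → ℝ in 𝓝 0, p (cons 0 t) :=
  (cons_zero_zero (σ := σ) ▸ tendsto_cons tendsto_const_nhds tendsto_id :
    Tendsto (fun t : σ → ℝ => cons 0 t) (𝓝 0) (𝓝 0)).eventually h

theorem eventually_slice {p : (Option σ → ℝ) → Prop} (h : ∀ᶠ x in 𝓝 0, p x) :
    ∀ᶠ t : σ → ℝ in 𝓝 0, ∀ᶠ s in 𝓝 (0 : ℝ), p (cons s t) := by
  filter_upwards [eventually_cons_zero h.eventually_nhds] with t ht
  exact (tendsto_cons (σ := σ) tendsto_id tendsto_const_nhds :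
    Tendsto (fun s => cons s t) (𝓝 (0 : ℝ)) (𝓝 (cons 0 t))).eventually ht

variable [Fintype σ]

theorem analyticAt_cons {E : Type*} [NormedAddCommGroup E] [NormedSpace ℝ E] {a : E → ℝ}
    {b : E → σ → ℝ} {x : E} (ha : AnalyticAt ℝ a x) (hb : AnalyticAt ℝ b x) :
    AnalyticAt ℝ (fun y => cons (a y) (b y)) x := by
  refine analyticAt_pi_iff.2 ?_
  rintro (_ | k)
  exacts [ha, analyticAt_pi_iff.1 hb k]

theorem analyticAt_tail (x : Option σ → ℝ) : AnalyticAt ℝ (tail : _ → σ → ℝ) x :=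
  analyticAt_pi_iff.2 fun k => analyticAt_coord (some k)

theorem tendsto_tail : Tendsto (tail : _ → σ → ℝ) (𝓝 0) (𝓝 0) :=
  (analyticAt_tail (0 : Option σ → ℝ)).continuousAt

theorem analyticAt_zero_of_cons {g : (Option σ → ℝ) → ℝ} (hg : AnalyticAt ℝ g 0) :
    AnalyticAt ℝ g (cons 0 (0 : σ → ℝ)) := by rwa [cons_zero_zero]

theorem AnalyticAt.comp_tail {c : (σ → ℝ) → ℝ} (hc : AnalyticAt ℝ c 0) :
    AnalyticAt ℝ (fun x : Option σ → ℝ => c (tail x)) 0 :=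
  AnalyticAt.fun_comp hc (analyticAt_tail 0)

theorem analyticAt_slice {g : (Option σ → ℝ) → ℝ} {s : ℝ} {t : σ → ℝ}
    (hg : AnalyticAt ℝ g (cons s t)) : AnalyticAt ℝ (fun s => g (cons s t)) s :=
  AnalyticAt.fun_comp hg (analyticAt_cons analyticAt_id analyticAt_const)

/-- The `n`-th partial derivative in the distinguished coordinate. -/
noncomputable def partialDeriv (n : ℕ) (g : (Option σ → ℝ) → ℝ) (x : Option σ → ℝ) : ℝ :=
  iteratedDeriv n (fun s => g (cons s (tail x))) (x none)

theorem deriv_slice {g : (Option σ → ℝ) → ℝ} {x : Option σ → ℝ} (hg : AnalyticAt ℝ g x) :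
    deriv (fun s => g (cons s (tail x))) (x none) = fderiv ℝ g x (cons 1 0) := by
  have h1 : HasDerivAt (fun s => cons s (tail x)) (cons 1 0) (x none) := by
    rw [hasDerivAt_pi]
    rintro (_ | k)
    exacts [hasDerivAt_id _, hasDerivAt_const _ _]
  exact (HasFDerivAt.comp_hasDerivAt (x none)
    (by simpa using hg.differentiableAt.hasFDerivAt) h1).deriv

theorem analyticAt_partialDeriv {g : (Option σ → ℝ) → ℝ} {x : Option σ → ℝ}
    (hg : AnalyticAt ℝ g x) (n : ℕ) : AnalyticAt ℝ (partialDeriv n g) x := by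
  induction n with
  | zero => exact hg.congr (.of_forall fun y => by simp [partialDeriv])
  | succ n ih =>
    have h : AnalyticAt ℝ (fun y => fderiv ℝ (partialDeriv n g) y (cons 1 0)) x :=
      ((ContinuousLinearMap.apply ℝ ℝ (cons 1 (0 : σ → ℝ))).analyticAt _).comp ih.fderiv
    refine h.congr ?_
    filter_upwards [ih.eventually_analyticAt] with y hy
    rw [← deriv_slice hy]
    simp only [partialDeriv, iteratedDeriv_succ]
    rfl

theorem iteratedDeriv_succ_add_mul {f v : ℝ → ℝ} {a : ℝ} (hv : AnalyticAt ℝ v 0)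
    (h : ∀ᶠ s in 𝓝 0, f s = a + s * v s) (n : ℕ) :
    iteratedDeriv (n + 1) f 0 = (n + 1) * iteratedDeriv n v 0 := by
  rw [EventuallyEq.iteratedDeriv_eq (n + 1) h,
    iteratedDeriv_const_add (by omega),
    iteratedDeriv_fun_mul contDiffAt_fun_id hv.contDiffAt, Finset.sum_eq_single 1]
  · simp [iteratedDeriv_fun_id_zero]
  · intro b _ hb
    simp [iteratedDeriv_fun_id_zero, hb]
  · simp

theorem exists_expansion {g : (Option σ → ℝ) → ℝ} (hg : AnalyticAt ℝ g 0) (d : ℕ) :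
    ∃ (c : Fin d → (σ → ℝ) → ℝ) (u : (Option σ → ℝ) → ℝ), (∀ i, AnalyticAt ℝ (c i) 0) ∧
      AnalyticAt ℝ u 0 ∧
      (∀ᶠ x in 𝓝 0, g x = ∑ i, c i (tail x) * x none ^ (i : ℕ) + x none ^ d * u x) ∧
      (∀ i : Fin d, ∀ᶠ t in 𝓝 0, (Nat.factorial i : ℝ) * c i t = partialDeriv i g (cons 0 t)) ∧
      (Nat.factorial d : ℝ) * u 0 = partialDeriv d g 0 := by
  classical
  induction d generalizing g with
  | zero => exact ⟨Fin.elim0, g, by simp, hg, by simp, by simp, by simp [partialDeriv]⟩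
  | succ d ih =>
    obtain ⟨v, hv, hgv⟩ := exists_eventually_eq_add_mul none hg
    simp only [update_none] at hgv
    obtain ⟨c, u, hc, hu, hvu, hcv, hud⟩ := ih hv
    have hD : ∀ᶠ t in 𝓝 0, ∀ n,
        partialDeriv (n + 1) g (cons 0 t) = (n + 1) * partialDeriv n v (cons 0 t) := by
      filter_upwards [eventually_slice hgv, eventually_cons_zero hv.eventually_analyticAt]
        with t h1 h2 n
      exact iteratedDeriv_succ_add_mul (a := g (cons 0 t)) (analyticAt_slice h2)
        (h1.mono fun s hs => by simpa using hs) n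
    refine ⟨Fin.cons (fun t => g (cons 0 t)) c, u, ?_, hu, ?_, ?_, ?_⟩
    · refine Fin.cases ?_ fun i => by simpa using hc i
      simpa using AnalyticAt.fun_comp (f := fun t : σ → ℝ => cons 0 t) (analyticAt_zero_of_cons hg)
        (analyticAt_cons analyticAt_const analyticAt_id)
    · filter_upwards [hgv, hvu] with x h1 h2
      rw [h1, h2, Fin.sum_univ_succ]
      simp only [Fin.cons_zero, Fin.cons_succ, Fin.val_zero, pow_zero, mul_one, Fin.val_succ,
        pow_succ]
      rw [mul_add, Finset.mul_sum, add_assoc]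
      congr 2
      · exact Finset.sum_congr rfl fun i _ => by ring
      · ring
    · refine Fin.cases ?_ fun i => ?_
      · simp [partialDeriv]
      · filter_upwards [hD, hcv i] with t h1 h2
        rw [Fin.val_succ, h1, ← h2, Fin.cons_succ, Nat.factorial_succ]
        push_cast
        ring
    · have := hD.self_of_nhds d
      rw [cons_zero_zero] at this
      rw [this, ← hud, Nat.factorial_succ]
      push_cast
      ring

theorem exists_implicit {f : (Option σ → ℝ) → ℝ} (hf : AnalyticAt ℝ f 0) (h0 : f 0 = 0)
    (h1 : partialDeriv 1 f 0 ≠ 0) :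
    ∃ ζ : (σ → ℝ) → ℝ, AnalyticAt ℝ ζ 0 ∧ ζ 0 = 0 ∧ ∀ᶠ t in 𝓝 0, f (cons (ζ t) t) = 0 := by
  have hc : AnalyticAt ℝ (fun p : (σ → ℝ) × ℝ => cons p.2 p.1) (0, 0) :=
    analyticAt_cons analyticAt_snd analyticAt_fst
  have hF : ContDiffAt ℝ ω (fun p : (σ → ℝ) × ℝ => f (cons p.2 p.1)) (0, 0) :=
    (AnalyticAt.fun_comp (f := fun p : (σ → ℝ) × ℝ => cons p.2 p.1)
      (analyticAt_zero_of_cons hf) hc).contDiffAt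
  have hd : (fderiv ℝ (fun p : (σ → ℝ) × ℝ => f (cons p.2 p.1)) (0, 0) ∘L .inr ℝ (σ → ℝ) ℝ) 1 =
      partialDeriv 1 f 0 := by
    have hi : HasDerivAt (fun s : ℝ => ((0 : σ → ℝ), s)) (0, 1) 0 :=
      (hasDerivAt_const _ _).prodMk (hasDerivAt_id _)
    have := (HasFDerivAt.comp_hasDerivAt (0 : ℝ)
      (hF.differentiableAt (by simp)).hasFDerivAt hi).deriv
    simp only [partialDeriv, iteratedDeriv_one]
    exact this.symm
  have hinv : (fderiv ℝ (fun p : (σ → ℝ) × ℝ => f (cons p.2 p.1)) (0, 0) ∘L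
      .inr ℝ (σ → ℝ) ℝ).IsInvertible := by
    refine ⟨.unitsEquivAut ℝ (.mk0 _ h1), ?_⟩
    ext
    simpa using hd.symm
  refine ⟨hF.implicitFunction (by simp) hinv,
    (hF.contDiffAt_implicitFunction (by simp) hinv).analyticAt,
    hF.implicitFunction_apply_self (by simp) hinv, ?_⟩
  simpa [h0] using hF.eventually_apply_implicitFunction (by simp) hinv

end Option

section Polynomial

theorem exists_iteratedDeriv_ne_zero {d : ℕ} {a : Fin d → ℝ} (ha : ∃ i, a i ≠ 0) {b : ℝ}
    (hb : b ≠ 0) (r : ℝ) : ∃ k ≤ d, iteratedDeriv k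
      (fun s => ∑ i, a i * (r + s) ^ (i : ℕ) + (r + s) ^ (d + 1) * b) 0 ≠ 0 := by
  have key : ∀ k, iteratedDeriv k
      (fun s => ∑ i, a i * (r + s) ^ (i : ℕ) + (r + s) ^ (d + 1) * b) 0 =
      ∑ i, a i * ((Nat.descFactorial i k : ℝ) * r ^ (i - k : ℕ)) +
        (Nat.descFactorial (d + 1) k : ℝ) * r ^ (d + 1 - k) * b := fun k => by
    have h := congrFun (iteratedDeriv_comp_const_add k
      (fun s : ℝ => ∑ i, a i * s ^ (i : ℕ) + s ^ (d + 1) * b) r) 0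
    rw [h, add_zero, iteratedDeriv_fun_add (by fun_prop) (by fun_prop),
      iteratedDeriv_fun_sum fun i _ => by fun_prop]
    simp only [iteratedDeriv_const_mul_field, iteratedDeriv_mul_const_field, iteratedDeriv_pow]
  simp only [key]
  by_cases hr : r = 0
  · obtain ⟨i, hi⟩ := ha
    refine ⟨i, i.2.le, ?_⟩
    subst hr
    have h0 : d + 1 - (i : ℕ) ≠ 0 := by omega
    rw [Finset.sum_eq_single i]
    · simp [hi, h0, Nat.descFactorial_eq_zero_iff_lt]
    · intro j _ hji
      rcases lt_or_gt_of_ne (Fin.val_ne_of_ne hji) with h | h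
      · simp [Nat.descFactorial_eq_zero_iff_lt.2 h]
      · have : (j : ℕ) - i ≠ 0 := by omega
        simp [this]
    · simp
  · refine ⟨d, le_rfl, ?_⟩
    rw [Finset.sum_eq_zero fun i _ => by simp [Nat.descFactorial_eq_zero_iff_lt.2 i.2]]
    simp [hr, hb, Nat.descFactorial_eq_zero_iff_lt]

end Polynomial

section Depressed

variable {σ : Type*}

theorem partialDeriv_shift (g : (Option σ → ℝ) → ℝ) (ζ : (σ → ℝ) → ℝ) (n : ℕ) (x : Option σ → ℝ) :
    partialDeriv n (fun x => g (cons (x none + ζ (tail x)) (tail x))) x =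
      partialDeriv n g (cons (x none + ζ (tail x)) (tail x)) :=
  congrFun (iteratedDeriv_comp_add_const n (fun s => g (cons s (tail x))) (ζ (tail x))) (x none)

variable [Fintype σ]

theorem analyticAt_shift {ζ : (σ → ℝ) → ℝ} (hζ : AnalyticAt ℝ ζ 0) :
    AnalyticAt ℝ (fun x : Option σ → ℝ => cons (x none + ζ (tail x)) (tail x)) 0 :=
  analyticAt_cons ((analyticAt_coord none).add (AnalyticAt.comp_tail hζ)) (analyticAt_tail 0)

/-- Weierstrass-type normal form: after an analytic shift of the distinguished coordinate, the
coefficient of degree `d` vanishes. -/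
theorem exists_depressed {g : (Option σ → ℝ) → ℝ} (hg : AnalyticAt ℝ g 0) {d : ℕ}
    (h : ∀ k ≤ d, partialDeriv k g 0 = 0) (h' : partialDeriv (d + 1) g 0 ≠ 0) :
    ∃ (ζ : (σ → ℝ) → ℝ) (c : Fin d → (σ → ℝ) → ℝ) (u : (Option σ → ℝ) → ℝ),
      AnalyticAt ℝ ζ 0 ∧ ζ 0 = 0 ∧ (∀ i, AnalyticAt ℝ (c i) 0) ∧ (∀ i, c i 0 = 0) ∧
      AnalyticAt ℝ u 0 ∧ u 0 ≠ 0 ∧ ∀ᶠ x in 𝓝 0, g (cons (x none + ζ (tail x)) (tail x)) =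
        ∑ i, c i (tail x) * x none ^ (i : ℕ) + x none ^ (d + 1) * u x := by
  have h1 : partialDeriv 1 (partialDeriv d g) 0 = partialDeriv (d + 1) g 0 := by
    simp only [partialDeriv, iteratedDeriv_succ]
    rfl
  obtain ⟨ζ, hζ, hζ0, hζt⟩ := exists_implicit (analyticAt_partialDeriv hg d) (h d le_rfl)
    (h1 ▸ h')
  obtain ⟨c, u, hc, hu, hgu, hct, hud⟩ := exists_expansion
    (g := fun x => g (cons (x none + ζ (tail x)) (tail x)))
    (AnalyticAt.fun_comp (by simpa [hζ0] using hg) (analyticAt_shift hζ)) (d + 1)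
  have hfac : ∀ n : ℕ, (Nat.factorial n : ℝ) ≠ 0 := fun n => by positivity
  refine ⟨ζ, fun i => c i.castSucc, u, hζ, hζ0, fun i => hc _, fun i => ?_, hu, ?_, ?_⟩
  · have := (hct i.castSucc).self_of_nhds
    rw [partialDeriv_shift] at this
    simpa [hζ0, hfac, h i i.2.le] using this
  · intro h0
    rw [h0, mul_zero, partialDeriv_shift] at hud
    simp [hζ0] at hud
    exact h' hud.symm
  · have hlast : ∀ᶠ t in 𝓝 0, c (Fin.last d) t = 0 := by
      filter_upwards [hct (Fin.last d), hζt] with t h1 h2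
      rw [partialDeriv_shift] at h1
      simpa [h2, hfac] using h1
    filter_upwards [hgu, tendsto_tail.eventually hlast] with x h1 h2
    rw [h1, Fin.sum_univ_castSucc, h2]
    simp

end Depressed

section Step

variable {ι σ : Type*} [Fintype σ] {l : Ultrafilter ι}

theorem IsNormalCrossing.comp_tail {f : (σ → ℝ) → ℝ} (hf : IsNormalCrossing f) :
    IsNormalCrossing fun x : Option σ → ℝ => f (tail x) := by
  obtain ⟨α, u, hu, hu0, h⟩ := hf
  refine ⟨fun o => o.elim 0 α, fun x => u (tail x), AnalyticAt.comp_tail hu, by simpa using hu0, ?_⟩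
  filter_upwards [tendsto_tail.eventually h] with x hx
  simp [hx, Fintype.prod_option]

theorem Lifts.cons {x : ι → Option σ → ℝ} (hx : Tendsto x l (𝓝 0)) {π : (σ → ℝ) → σ → ℝ}
    {y : ι → σ → ℝ} (h : Lifts l (fun i => tail (x i)) π y) :
    Lifts l x (fun z => cons (z none) (π (tail z))) (fun i => cons (x i none) (y i)) where
  analyticAt := analyticAt_cons (analyticAt_coord none)
    (AnalyticAt.fun_comp h.analyticAt (analyticAt_tail 0))
  map_zero := by simp [h.map_zero]
  tendsto := cons_zero_zero (σ := σ) ▸ tendsto_cons (tendsto_pi_nhds.1 hx none) h.tendsto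
  eventually_eq := by
    filter_upwards [h.eventually_eq] with i hi
    simp [hi]

theorem lifts_shift {x : ι → Option σ → ℝ} (hx : Tendsto x l (𝓝 0)) {ζ : (σ → ℝ) → ℝ}
    (hζ : AnalyticAt ℝ ζ 0) (hζ0 : ζ 0 = 0) :
    Lifts l x (fun z => LocalUniformization.cons (z none + ζ (tail z)) (tail z))
      (fun i => LocalUniformization.cons (x i none - ζ (tail (x i))) (tail (x i))) where
  analyticAt := analyticAt_shift hζ
  map_zero := by simp [hζ0]
  tendsto := by
    have h1 := (hζ.continuousAt.tendsto.comp tendsto_tail).comp hx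
    have h2 := (tendsto_pi_nhds.1 hx none).sub h1
    rw [hζ0, Pi.zero_apply, sub_zero] at h2
    exact cons_zero_zero (σ := σ) ▸ tendsto_cons h2 (tendsto_tail.comp hx)
  eventually_eq := .of_forall fun i => by simp

/-- The conclusion of the uniformization step: `g` and `h ∘ tail` become normal crossings after
pulling back along a lift of `x`. -/
def StepConclusion (l : Ultrafilter ι) (g : (Option σ → ℝ) → ℝ) (h : (σ → ℝ) → ℝ)
    (x : ι → Option σ → ℝ) : Prop :=
  ∃ π y, Lifts l x π y ∧ (IsNormalCrossing fun z => g (π z)) ∧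
    IsNormalCrossing fun z => h (tail (π z))

variable {d : ℕ} {C : Fin d → (σ → ℝ) → ℝ} {u : (Option σ → ℝ) → ℝ} {γ : σ → ℕ} {h : (σ → ℝ) → ℝ}
  {x : ι → Option σ → ℝ}

theorem stepConclusion_of_bounded
    (ih : ∀ {g : (Option σ → ℝ) → ℝ}, AnalyticAt ℝ g 0 → (∃ k ≤ d, partialDeriv k g 0 ≠ 0) →
      ∀ {h : (σ → ℝ) → ℝ}, AnalyticAt ℝ h 0 → (¬ ∀ᶠ t in 𝓝 0, h t = 0) →
        ∀ {x : ι → Option σ → ℝ}, Tendsto x l (𝓝 0) → StepConclusion l g h x)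
    (hC : ∀ i, AnalyticAt ℝ (C i) 0) (hC0 : ∃ i, C i 0 ≠ 0) (hu : AnalyticAt ℝ u 0) (hu0 : u 0 ≠ 0)
    (hγ : ∏ k, (0 : σ → ℝ) k ^ γ k = 0) (hh : AnalyticAt ℝ h 0) (hh' : IsNormalCrossing h)
    (hx : Tendsto x l (𝓝 0)) {B : ℝ} (hB : ∀ᶠ i in l, |x i none| ≤ B * |∏ k, x i (some k) ^ γ k|) :
    StepConclusion l (fun z => ∑ i : Fin d, (∏ k, tail z k ^ γ k) ^ (d + 1 - i : ℕ) * C i (tail z) *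
      z none ^ (i : ℕ) + z none ^ (d + 1) * u z) h x := by
  set m : (σ → ℝ) → ℝ := fun t => ∏ k, t k ^ γ k with hm
  have hma : AnalyticAt ℝ m 0 := analyticAt_monomial γ 0
  obtain ⟨r, hr⟩ : ∃ r, Tendsto (fun i => x i none / m (tail (x i))) l (𝓝 r) :=
    exists_tendsto_of_eventually_abs_le (C := |B|) (by
      filter_upwards [hB] with i hi
      rw [abs_div]
      exact div_le_of_le_mul₀ (abs_nonneg _) (abs_nonneg _)
        (hi.trans (mul_le_mul_of_nonneg_right (le_abs_self B) (abs_nonneg _))))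
  have hL : Lifts l x (fun z => cons (m (tail z) * (r + z none)) (tail z))
      (fun i => cons (x i none / m (tail (x i)) - r) (tail (x i))) := by
    refine ⟨analyticAt_cons ((AnalyticAt.comp_tail hma).mul
      (analyticAt_const.add (analyticAt_coord none))) (analyticAt_tail 0), ?_, ?_, ?_⟩
    · simp only [tail_zero, hγ, hm, zero_mul, cons_zero_zero]
    · have := hr.sub_const r
      rw [sub_self] at this
      exact cons_zero_zero (σ := σ) ▸ tendsto_cons this (tendsto_tail.comp hx)
    · filter_upwards [hB] with i hi
      have : m (tail (x i)) * (x i none / m (tail (x i))) = x i none := by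
        by_cases h0 : m (tail (x i)) = 0
        · have : x i none = 0 := by
            change |x i none| ≤ B * |m (tail (x i))| at hi
            simpa [h0] using hi
          rw [this, h0, zero_mul]
        · exact mul_div_cancel₀ _ h0
      simp [this]
  set π : (Option σ → ℝ) → Option σ → ℝ := fun z =>
    cons (m (tail z) * (r + z none)) (tail z) with hπ
  set g : (Option σ → ℝ) → ℝ := fun z => ∑ i, C i (tail z) * (r + z none) ^ (i : ℕ) +
    (r + z none) ^ (d + 1) * u (π z) with hg
  have hrz : AnalyticAt ℝ (fun z : Option σ → ℝ => r + z none) 0 :=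
    analyticAt_const.add (analyticAt_coord none)
  have hga : AnalyticAt ℝ g 0 :=
    (Finset.analyticAt_fun_sum _ fun i _ => (AnalyticAt.comp_tail (hC i)).mul (hrz.pow _)).add
      ((hrz.pow _).mul (hL.analyticAt_comp hu))
  have hord : ∃ k ≤ d, partialDeriv k g 0 ≠ 0 := by
    obtain ⟨k, hk, hne⟩ := exists_iteratedDeriv_ne_zero (a := fun i => C i 0) hC0 hu0 r
    refine ⟨k, hk, ?_⟩
    have : ∀ s, g (cons s 0) = ∑ i, C i 0 * (r + s) ^ (i : ℕ) + (r + s) ^ (d + 1) * u 0 :=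
      fun s => by simp only [hg, hπ, tail_cons, hm, hγ, zero_mul, cons_zero_zero, cons_none]
    simpa only [partialDeriv, tail_zero, Pi.zero_apply, this] using hne
  obtain ⟨ρ, y, hL', hn1, hn2⟩ := ih hga hord (h := fun t => h t * m t ^ (d + 1))
    (hh.mul (hma.pow _))
    (hh'.mul ((IsNormalCrossing.monomial γ).pow _)).not_eventually_eq_zero hL.tendsto
  have hta : AnalyticAt ℝ (fun z => tail (ρ z)) 0 :=
    AnalyticAt.fun_comp (analyticAt_tail _) hL'.analyticAt
  have hcomp : ∀ {f : (σ → ℝ) → ℝ}, AnalyticAt ℝ f 0 → AnalyticAt ℝ (fun z => f (tail (ρ z))) 0 :=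
    fun hf => AnalyticAt.fun_comp (by rwa [hL'.map_zero]) hta
  obtain ⟨hn3, hn4⟩ := IsNormalCrossing.of_mul (g := fun z => m (tail (ρ z)) ^ (d + 1))
    (hcomp hh) ((hcomp hma).pow (d + 1)) hn2
  refine ⟨_, y, hL.trans hL', (hn4.mul hn1).congr (.of_forall fun z => ?_), hn3⟩
  simp only [hg, hπ, tail_cons, cons_none, mul_add, Finset.mul_sum]
  congr 1
  · refine Finset.sum_congr rfl fun i _ => ?_
    have : m (tail (ρ z)) ^ (d + 1) =
        m (tail (ρ z)) ^ (d + 1 - i : ℕ) * m (tail (ρ z)) ^ (i : ℕ) := by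
      rw [← pow_add, Nat.sub_add_cancel (by omega)]
    rw [this, ← mul_add, mul_pow]
    ring
  · rw [← mul_add, mul_pow]
    ring

theorem stepConclusion_of_unbounded
    (hC : ∀ i, AnalyticAt ℝ (C i) 0) (hu : AnalyticAt ℝ u 0) (hu0 : u 0 ≠ 0)
    (hh' : IsNormalCrossing h) (hx : Tendsto x l (𝓝 0))
    (hB : ∀ B : ℝ, ∀ᶠ i in l, B * |∏ k, x i (some k) ^ γ k| < |x i none|) :
    StepConclusion l (fun z => ∑ i : Fin d, (∏ k, tail z k ^ γ k) ^ (d + 1 - i : ℕ) * C i (tail z) *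
      z none ^ (i : ℕ) + z none ^ (d + 1) * u z) h x := by
  classical
  obtain ⟨π, y, w, hL, hnc, hw, hw0, hπw⟩ := exists_lifts_monomial_dvd
    (γ := fun o : Option σ => o.elim 0 γ) (j := none) rfl hx
    (by simpa [Fintype.prod_option] using hB)
  refine ⟨π, y, hL, ?_, hh'.comp_tail.comp hL.analyticAt hL.map_zero hnc⟩
  have hua : AnalyticAt ℝ
      (fun z => ∑ i : Fin d, w z ^ (d + 1 - i : ℕ) * C i (tail (π z)) + u (π z)) 0 :=
    (Finset.analyticAt_fun_sum _ fun i _ => (hw.pow _).mul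
      (hL.analyticAt_comp (AnalyticAt.comp_tail (hC i)))).add (hL.analyticAt_comp hu)
  refine (((hnc none).pow (d + 1)).mul (.of_ne_zero hua ?_)).congr ?_
  · rw [Finset.sum_eq_zero fun i _ => by rw [hw0, zero_pow (by omega), zero_mul], zero_add,
      hL.map_zero]
    exact hu0
  · filter_upwards [hπw] with z hz
    simp only [Fintype.prod_option, Option.elim_none, pow_zero, one_mul, Option.elim_some] at hz
    simp only [tail_apply, hz, mul_add, Finset.mul_sum]
    congr 1
    refine Finset.sum_congr rfl fun i _ => ?_
    have : π z none ^ (d + 1) = π z none ^ (d + 1 - i : ℕ) * π z none ^ (i : ℕ) := by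
      rw [← pow_add, Nat.sub_add_cancel (by omega)]
    rw [this, mul_pow]
    ring

theorem Uniformizable.stepConclusion (hU : Uniformizable l σ) (d : ℕ) {g : (Option σ → ℝ) → ℝ}
    (hg : AnalyticAt ℝ g 0) (hord : ∃ k ≤ d, partialDeriv k g 0 ≠ 0) {h : (σ → ℝ) → ℝ}
    (hh : AnalyticAt ℝ h 0) (hh0 : ¬ ∀ᶠ t in 𝓝 0, h t = 0) {x : ι → Option σ → ℝ}
    (hx : Tendsto x l (𝓝 0)) : StepConclusion l g h x := by
  induction d generalizing g h x with
  | zero =>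
    have hg0 : g 0 ≠ 0 := by simpa [partialDeriv] using hord
    obtain ⟨π, y, hL, hnc⟩ := hU h hh hh0 (fun i => tail (x i)) (tendsto_tail.comp hx)
    have hL' := hL.cons hx
    exact ⟨_, _, hL', .of_ne_zero (hL'.analyticAt_comp hg) (by rwa [hL'.map_zero]),
      by simpa using hnc.comp_tail⟩
  | succ d ih =>
    by_cases hord' : ∃ k ≤ d, partialDeriv k g 0 ≠ 0
    · exact ih hg hord' hh hh0 hx
    push Not at hord'
    have hd : partialDeriv (d + 1) g 0 ≠ 0 := by
      obtain ⟨k, hk, hne⟩ := hord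
      rcases hk.lt_or_eq with h1 | rfl
      exacts [absurd (hord' k (by omega)) hne, hne]
    obtain ⟨ζ, c, u, hζ, hζ0, hc, hc0, hu, hu0, hgu⟩ := exists_depressed hg hord' hd
    have hL := lifts_shift hx hζ hζ0
    obtain ⟨π, y, hLπ, hhπ, hcase⟩ := hU.monomialize hc hh hh0 (tendsto_tail.comp hL.tendsto)
    have hL' := hLπ.cons hL.tendsto
    have hLL := hL.trans hL'
    have hu' := hL'.analyticAt_comp hu
    have hgu' := hL'.tendsto_map.eventually hgu
    simp only [cons_none, tail_cons] at hgu' hLL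
    have hu0' : (fun z => u (cons (z none) (π (tail z)))) 0 ≠ 0 := by
      simpa only [hL'.map_zero] using hu0
    rcases hcase with hz | ⟨γ, C, hC, hcC, i₀, hi₀⟩
    · refine ⟨_, _, hLL, ?_, by simpa using hhπ.comp_tail⟩
      refine (((IsNormalCrossing.coord none).pow (d + 1)).mul (.of_ne_zero hu' hu0')).congr ?_
      filter_upwards [hgu', tendsto_tail.eventually (eventually_all.2 hz)] with z h1 h2
      rw [h1, Finset.sum_eq_zero fun i _ => by rw [h2 i, zero_mul], zero_add]
    · have hγ : ∏ k, (0 : σ → ℝ) k ^ γ k = 0 := by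
        have := (hcC i₀).self_of_nhds
        rw [hLπ.map_zero, hc0] at this
        exact eq_zero_of_pow_eq_zero ((mul_eq_zero.1 this.symm).resolve_right hi₀)
      suffices hS : StepConclusion l
          (fun z => ∑ i : Fin d, (∏ k, tail z k ^ γ k) ^ (d + 1 - i : ℕ) *
          C i (tail z) * z none ^ (i : ℕ) + z none ^ (d + 1) * u (cons (z none) (π (tail z))))
          (fun t => h (π t)) (fun i => cons (x i none - ζ (tail (x i))) (y i)) by
        obtain ⟨ρ, y', hLρ, hn1, hn2⟩ := hS
        refine ⟨_, y', hLL.trans hLρ, hn1.congr ?_, hn2⟩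
        filter_upwards [hLρ.tendsto_map.eventually
          (hgu'.and (tendsto_tail.eventually (eventually_all.2 hcC)))] with z hz
        rw [hz.1]
        simp only [hz.2]
      by_cases hB : ∃ B : ℝ, ∀ᶠ i in l, |cons (x i none - ζ (tail (x i))) (y i) none| ≤
          B * |∏ k, cons (x i none - ζ (tail (x i))) (y i) (some k) ^ γ k|
      · obtain ⟨B, hB⟩ := hB
        exact stepConclusion_of_bounded ih hC ⟨i₀, hi₀⟩ hu' hu0' hγ
          (hLπ.analyticAt_comp hh) hhπ hLL.tendsto hB
      · push Not at hB
        exact stepConclusion_of_unbounded hC hu' hu0' hhπ hLL.tendsto hB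

end Step

section Uniformization

variable {ι : Type*} {l : Ultrafilter ι}

theorem exists_partialDeriv_ne_zero {σ : Type*} [Fintype σ] {g : (Option σ → ℝ) → ℝ}
    (hg : AnalyticAt ℝ g 0) (h : ¬ ∀ᶠ s in 𝓝 0, g (cons s 0) = 0) :
    ∃ k, partialDeriv k g 0 ≠ 0 := by
  by_contra! hc
  have ha : AnalyticAt ℝ (fun s => g (cons s (0 : σ → ℝ))) 0 :=
    analyticAt_slice (analyticAt_zero_of_cons hg)
  refine h (analyticOrderAt_eq_top.1 (ENat.eq_top_iff_forall_ge.2 fun n => ?_))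
  exact (natCast_le_analyticOrderAt_iff_iteratedDeriv_eq_zero ha).2 fun i _ => hc i

theorem Uniformizable.option {σ : Type*} [Fintype σ] (hU : Uniformizable l σ) :
    Uniformizable l (Option σ) := by
  intro f hf hf0 x hx
  by_cases h0 : f 0 = 0
  swap
  · exact ⟨id, x, ⟨analyticAt_id, rfl, hx, by simp⟩, .of_ne_zero hf h0⟩
  obtain ⟨v, hv, hfv⟩ := exists_line_not_eventually_eq_zero hf hf0 h0
  have h1 : cons 1 (0 : σ → ℝ) ≠ 0 := fun h => one_ne_zero (congrFun h none)
  obtain ⟨A, hA⟩ := SeparatingDual.exists_continuousLinearEquiv_apply_eq (R := ℝ) h1 hv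
  have hAa : AnalyticAt ℝ A 0 := A.toContinuousLinearMap.analyticAt 0
  have hg : AnalyticAt ℝ (fun z => f (A z)) 0 := AnalyticAt.fun_comp (by simpa using hf) hAa
  have hline : ∀ s : ℝ, A (cons s 0) = s • v := fun s => by
    have : cons s (0 : σ → ℝ) = s • cons 1 0 := by ext (_ | k) <;> simp
    rw [this, map_smul, hA]
  obtain ⟨k, hk⟩ := exists_partialDeriv_ne_zero hg (by simpa only [hline] using hfv)
  have hL : Lifts l x A (fun i => A.symm (x i)) :=
    ⟨hAa, map_zero A, (A.symm.continuous.tendsto' 0 0 (map_zero _)).comp hx, by simp⟩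
  obtain ⟨π, y, hL', hn, -⟩ := hU.stepConclusion k hg ⟨k, le_rfl, hk⟩ (h := fun _ => 1)
    analyticAt_const (by simp [nhds_neBot.ne]) hL.tendsto
  exact ⟨_, y, hL.trans hL', hn⟩

theorem Uniformizable.of_equiv {α β : Type*} [Fintype α] [Fintype β] (e : α ≃ β)
    (hU : Uniformizable l α) : Uniformizable l β := by
  intro f hf hf0 x hx
  let A : (α → ℝ) ≃L[ℝ] (β → ℝ) := ContinuousLinearEquiv.piCongrLeft ℝ (fun _ => ℝ) e
  have hA : ∀ t k, A t k = t (e.symm k) := fun t k => by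
    obtain ⟨k, rfl⟩ := e.surjective k
    rw [Equiv.symm_apply_apply]
    exact Equiv.piCongrLeft_apply_apply (fun _ => ℝ) e t k
  have hAs : ∀ t k, A.symm t k = t (e k) := fun t k => by
    have := hA (A.symm t) (e k)
    simpa using this.symm
  have hf' : AnalyticAt ℝ (fun z => f (A z)) 0 :=
    AnalyticAt.fun_comp (by simpa using hf) (A.toContinuousLinearMap.analyticAt 0)
  have ht : Tendsto A.symm (𝓝 0) (𝓝 0) := A.symm.continuous.tendsto' 0 0 (map_zero _)
  obtain ⟨π, y, hL, a, u, hu, hu0, hau⟩ := hU _ hf'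
    (fun h => hf0 (by simpa using ht.eventually h)) _ (ht.comp hx)
  refine ⟨fun z => A (π (A.symm z)), fun i => A (y i), ⟨?_, ?_, ?_, ?_⟩,
    a ∘ e.symm, fun z => u (A.symm z), ?_, by simpa using hu0, ?_⟩
  · exact AnalyticAt.fun_comp (A.toContinuousLinearMap.analyticAt _) (AnalyticAt.fun_comp
      (by simpa using hL.analyticAt) (A.symm.toContinuousLinearMap.analyticAt 0))
  · simp [hL.map_zero]
  · exact (A.continuous.tendsto' 0 0 (map_zero _)).comp hL.tendsto
  · filter_upwards [hL.eventually_eq] with i hi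
    simp [hi]
  · exact AnalyticAt.fun_comp (by simpa using hu) (A.symm.toContinuousLinearMap.analyticAt 0)
  · filter_upwards [ht.eventually hau] with z hz
    rw [hz, ← e.prod_comp]
    simp [hAs]

/-- Real analytic germs admit local uniformization along any ultrafilter. -/
theorem uniformizable (l : Ultrafilter ι) (τ : Type*) [Fintype τ] : Uniformizable l τ := by
  refine Fintype.induction_empty_option (P := fun τ _ => Uniformizable l τ) ?_ ?_ ?_ τ
  · intro α β _ e h
    let := Fintype.ofEquiv β e.symm
    exact h.of_equiv e
  · intro f hf hf0 x hx
    refine ⟨id, x, ⟨analyticAt_id, rfl, hx, by simp⟩, .of_ne_zero hf fun h => hf0 ?_⟩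
    exact .of_forall fun x => by rwa [Subsingleton.elim x 0]
  · intro α _ h
    exact h.option

end Uniformization

section Gradient

variable {τ : Type*} [Fintype τ]

theorem mul_fderiv_single [DecidableEq τ] {F u : (τ → ℝ) → ℝ} {α : τ → ℕ} {y : τ → ℝ}
    (hF : DifferentiableAt ℝ F y) (hu : DifferentiableAt ℝ u y)
    (h : ∀ᶠ x in 𝓝 y, F x = (∏ k, x k ^ α k) * u x) (k : τ) :
    y k * fderiv ℝ F y (Pi.single k 1) =
      (∏ k, y k ^ α k) * (α k * u y + y k * fderiv ℝ u y (Pi.single k 1)) := by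
  have hup : HasDerivAt (update y k) (Pi.single k 1) (y k) := hasDerivAt_update y k (y k)
  have hy : update y k (y k) = y := update_eq_self k y
  have hcomp : ∀ {g : (τ → ℝ) → ℝ}, DifferentiableAt ℝ g y →
      HasDerivAt (fun t => g (update y k t)) (fderiv ℝ g y (Pi.single k 1)) (y k) := fun hg =>
    HasFDerivAt.comp_hasDerivAt (y k) (by rw [hy]; exact hg.hasFDerivAt) hup
  have hm : ∀ t, ∏ j, update y k t j ^ α j = t ^ α k * ∏ j ∈ Finset.univ.erase k, y j ^ α j := by
    intro t
    rw [← Finset.mul_prod_erase _ _ (Finset.mem_univ k), update_self]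
    congr 1
    exact Finset.prod_congr rfl fun j hj => by rw [update_of_ne (Finset.ne_of_mem_erase hj)]
  have hev : (fun t => F (update y k t)) =ᶠ[𝓝 (y k)]
      fun t => (t ^ α k * ∏ j ∈ Finset.univ.erase k, y j ^ α j) * u (update y k t) := by
    have hc : Tendsto (update y k) (𝓝 (y k)) (𝓝 y) := by
      simpa only [hy] using hup.continuousAt.tendsto
    filter_upwards [hc.eventually h] with t ht
    rw [ht, hm]
  have h1 := (hcomp hF).unique
    ((((hasDerivAt_pow (α k) (y k)).mul_const _).mul (hcomp hu)).congr_of_eventuallyEq hev)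
  have h2 := hm (y k)
  rw [hy] at h1 h2
  rw [h1, h2]
  have h3 : y k * (α k * y k ^ (α k - 1)) = α k * y k ^ α k := by
    rcases Nat.eq_zero_or_pos (α k) with h | h
    · simp [h]
    · rw [mul_left_comm, mul_pow_sub_one h.ne']
  linear_combination (∏ j ∈ Finset.univ.erase k, y j ^ α j) * u y * h3

theorem exists_abs_pow_le_of_monomial {F u : (τ → ℝ) → ℝ} {α : τ → ℕ} (hF : AnalyticAt ℝ F 0)
    (hu : AnalyticAt ℝ u 0) (hu0 : u 0 ≠ 0) (hα : α ≠ 0)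
    (h : ∀ᶠ x in 𝓝 0, F x = (∏ k, x k ^ α k) * u x) :
    ∃ C, 0 ≤ C ∧ ∀ᶠ y in 𝓝 0, |F y| ^ (∑ k, α k) ≤ C * |F y| * ‖fderiv ℝ F y‖ ^ (∑ k, α k) := by
  classical
  have hpos := abs_pos.2 hu0
  have hsmall : ∀ᶠ y in 𝓝 0, ∀ k, |y k * fderiv ℝ u y (Pi.single k 1)| < |u 0| / 4 := by
    refine eventually_all.2 fun k => ?_
    have hc : ContinuousAt (fun y : τ → ℝ => |y k * fderiv ℝ u y (Pi.single k 1)|) 0 :=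
      ((continuous_apply k).continuousAt.mul (hu.fderiv.continuousAt.clm_apply
        continuousAt_const)).abs
    exact hc.eventually_lt_const (by simpa using hpos)
  refine ⟨2 ^ (∑ k, α k) * (2 / |u 0|), by positivity, ?_⟩
  filter_upwards [hsmall, h.eventually_nhds, hF.eventually_analyticAt, hu.eventually_analyticAt,
    hu.continuousAt.abs.eventually_const_lt (half_lt_self hpos)] with y h1 h2 h3 h4 h5
  obtain ⟨k, hk, hmin⟩ : ∃ k, α k ≠ 0 ∧ ∀ j, α j ≠ 0 → |y k| ≤ |y j| := by
    obtain ⟨k₀, hk₀⟩ := Function.ne_iff.1 hα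
    obtain ⟨k, hk, h⟩ := (Finset.univ.filter fun k => α k ≠ 0).exists_min_image (fun k => |y k|)
      ⟨k₀, by simpa using hk₀⟩
    exact ⟨k, by simpa using hk, fun j hj => h j (by simpa using hj)⟩
  have hFy := h2.self_of_nhds
  have hle : |F y| ≤ 2 * (|y k| * ‖fderiv ℝ F y‖) := by
    have e := congrArg abs (mul_fderiv_single h3.differentiableAt h4.differentiableAt h2 k)
    have hop : |fderiv ℝ F y (Pi.single k 1)| ≤ ‖fderiv ℝ F y‖ := by
      simpa [Pi.norm_single] using (fderiv ℝ F y).le_opNorm (Pi.single k 1)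
    have hα1 : (1 : ℝ) ≤ α k := by exact_mod_cast Nat.one_le_iff_ne_zero.2 hk
    have hb : |u y| / 2 ≤ |α k * u y + y k * fderiv ℝ u y (Pi.single k 1)| := by
      have t1 := abs_sub_abs_le_abs_add (α k * u y) (y k * fderiv ℝ u y (Pi.single k 1))
      rw [abs_mul (α k : ℝ), Nat.abs_cast] at t1
      nlinarith [h1 k, abs_nonneg (u y)]
    rw [abs_mul, abs_mul] at e
    rw [hFy, abs_mul]
    nlinarith [mul_le_mul_of_nonneg_left hb (abs_nonneg (∏ k, y k ^ α k)),
      mul_le_mul_of_nonneg_left hop (abs_nonneg (y k))]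
  have hyk : |y k| ^ (∑ k, α k) ≤ 2 / |u 0| * |F y| := by
    have t1 : |y k| ^ (∑ k, α k) ≤ |∏ k, y k ^ α k| := by
      rw [← Finset.prod_pow_eq_pow_sum, Finset.abs_prod]
      refine Finset.prod_le_prod (fun _ _ => by positivity) fun j _ => ?_
      rw [abs_pow]
      by_cases hj : α j = 0
      · simp [hj]
      · exact pow_le_pow_left₀ (abs_nonneg _) (hmin j hj) _
    refine t1.trans ?_
    rw [hFy, abs_mul, div_mul_eq_mul_div, le_div_iff₀ hpos]
    nlinarith [abs_nonneg (∏ k, y k ^ α k)]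
  calc |F y| ^ (∑ k, α k) ≤ (2 * (|y k| * ‖fderiv ℝ F y‖)) ^ (∑ k, α k) :=
        pow_le_pow_left₀ (abs_nonneg _) hle _
    _ = 2 ^ (∑ k, α k) * ‖fderiv ℝ F y‖ ^ (∑ k, α k) * |y k| ^ (∑ k, α k) := by
        rw [mul_pow, mul_pow]; ring
    _ ≤ 2 ^ (∑ k, α k) * ‖fderiv ℝ F y‖ ^ (∑ k, α k) * (2 / |u 0| * |F y|) := by gcongr
    _ = _ := by ring

theorem exists_abs_pow_le_norm_fderiv {ι : Type*} {l : Ultrafilter ι} {f : (τ → ℝ) → ℝ}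
    (hf : AnalyticAt ℝ f 0) (h0 : f 0 = 0) {x : ι → τ → ℝ} (hx : Tendsto x l (𝓝 0))
    (hne : ∀ᶠ i in l, f (x i) ≠ 0) :
    ∃ (s : ℕ) (C : ℝ), 0 < C ∧
      ∀ᶠ i in l, |f (x i)| ^ s ≤ C * ‖fderiv ℝ f (x i)‖ ^ (s + 1) := by
  have hf0 : ¬ ∀ᶠ x in 𝓝 0, f x = 0 := fun h => by
    obtain ⟨i, h1, h2⟩ := (hne.and (hx.eventually h)).exists
    exact h1 h2
  obtain ⟨π, y, hL, α, u, hu, hu0, hfu⟩ := uniformizable l τ f hf hf0 x hx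
  have hα : α ≠ 0 := by
    rintro rfl
    have := hfu.self_of_nhds
    simp [hL.map_zero, h0, hu0.symm] at this
  obtain ⟨s, hs⟩ : ∃ s, ∑ k, α k = s + 1 := Nat.exists_eq_succ_of_ne_zero fun h =>
    hα (funext fun k => Finset.sum_eq_zero_iff.1 h k (Finset.mem_univ k))
  obtain ⟨C, hC, hle⟩ := exists_abs_pow_le_of_monomial (hL.analyticAt_comp hf) hu hu0 hα hfu
  rw [hs] at hle
  set M := ‖fderiv ℝ π 0‖ + 1 with hM
  have hb : ∀ᶠ z in 𝓝 0, ‖fderiv ℝ π z‖ < M :=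
    hL.analyticAt.fderiv.continuousAt.norm.eventually_lt_const (lt_add_one _)
  refine ⟨s, C * M ^ (s + 1) + 1, by positivity, ?_⟩
  filter_upwards [hL.tendsto.eventually (hle.and (hb.and (hL.analyticAt.eventually_analyticAt.and
    (hL.tendsto_map.eventually hf.eventually_analyticAt)))), hL.eventually_eq, hne]
    with i ⟨h1, h2, h3, h4⟩ h5 h6
  have hchain : ‖fderiv ℝ (fun t => f (π t)) (y i)‖ ≤ ‖fderiv ℝ f (x i)‖ * M := by
    rw [← h5]
    have : fderiv ℝ (fun t => f (π t)) (y i) = _ :=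
      fderiv_comp (y i) h4.differentiableAt h3.differentiableAt
    rw [this]
    exact (ContinuousLinearMap.opNorm_comp_le _ _).trans (by gcongr)
  rw [h5] at h1
  have hpos := abs_pos.2 h6
  refine le_of_mul_le_mul_right ?_ hpos
  rw [← pow_succ]
  calc |f (x i)| ^ (s + 1) ≤ C * |f (x i)| * (‖fderiv ℝ f (x i)‖ * M) ^ (s + 1) :=
        h1.trans (by gcongr)
    _ = C * M ^ (s + 1) * ‖fderiv ℝ f (x i)‖ ^ (s + 1) * |f (x i)| := by rw [mul_pow]; ring
    _ ≤ _ := by gcongr; linarith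

end Gradient

theorem exists_rpow_abs_le_norm_fderiv_pi {τ : Type*} [Fintype τ] {f : (τ → ℝ) → ℝ}
    (hf : AnalyticAt ℝ f 0) (h0 : f 0 = 0) : ∃ θ ∈ Set.Ico (1 / 2 : ℝ) 1, ∃ C > 0,
      ∀ᶠ x in 𝓝 0, |f x| ^ θ ≤ C * ‖fderiv ℝ f x‖ := by
  suffices ∃ n : ℕ, ∀ᶠ x in 𝓝 0,
      |f x| ^ (1 - 1 / ((n : ℝ) + 2)) ≤ ((n : ℝ) + 1) * ‖fderiv ℝ f x‖ by
    obtain ⟨n, hn⟩ := this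
    have h2 : 1 / ((n : ℝ) + 2) ≤ 1 / 2 :=
      one_div_le_one_div_of_le two_pos (by linarith [n.cast_nonneg (α := ℝ)])
    have h3 : 0 < 1 / ((n : ℝ) + 2) := by positivity
    exact ⟨_, ⟨by linarith, by linarith⟩, _, by positivity, hn⟩
  by_contra! hcon
  have hex : ∀ n : ℕ, ∃ x ∈ Metric.ball (0 : τ → ℝ) (1 / ((n : ℝ) + 1)),
      ((n : ℝ) + 1) * ‖fderiv ℝ f x‖ < |f x| ^ (1 - 1 / ((n : ℝ) + 2)) := fun n => by
    obtain ⟨x, h1, h2⟩ := ((hcon n).and_eventually (Metric.ball_mem_nhds 0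
      (Nat.one_div_pos_of_nat (α := ℝ) (n := n)))).exists
    exact ⟨x, h2, h1⟩
  choose x hx hbad using hex
  have hxt : Tendsto x (hyperfilter ℕ : Filter ℕ) (𝓝 0) := by
    refine Tendsto.mono_left ?_ Nat.hyperfilter_le_atTop
    refine squeeze_zero_norm (fun n => ?_) tendsto_one_div_add_atTop_nhds_zero_nat
    exact (mem_ball_zero_iff.1 (hx n)).le
  have hθ : ∀ n : ℕ, 0 < 1 - 1 / ((n : ℝ) + 2) := fun n => by
    rw [sub_pos, div_lt_one (by positivity)]
    linarith [n.cast_nonneg (α := ℝ)]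
  have hne : ∀ n, f (x n) ≠ 0 := fun n hn => by
    have := hbad n
    rw [hn, abs_zero, Real.zero_rpow (hθ n).ne'] at this
    exact absurd this (not_lt.2 (by positivity))
  obtain ⟨s, C, hC, hs⟩ := exists_abs_pow_le_norm_fderiv hf h0 hxt (.of_forall hne)
  have hsmall : ∀ᶠ n in (hyperfilter ℕ : Filter ℕ), |f (x n)| < 1 :=
    (hf.continuousAt.tendsto.comp hxt).abs.eventually_lt_const (by simp [h0])
  have hlarge : ∀ᶠ n : ℕ in (hyperfilter ℕ : Filter ℕ), s ≤ n ∧ C ^ ((s + 1 : ℝ)⁻¹) ≤ n :=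
    Nat.hyperfilter_le_atTop ((eventually_ge_atTop s).and
      (tendsto_natCast_atTop_atTop.eventually_ge_atTop _))
  obtain ⟨n, h1, h2, h3, h4⟩ := (hs.and (hsmall.and hlarge)).exists
  have hpos := abs_pos.2 (hne n)
  have hle : |f (x n)| ^ (1 - 1 / ((s : ℝ) + 1)) ≤ C ^ ((s + 1 : ℝ)⁻¹) * ‖fderiv ℝ f (x n)‖ := by
    have := Real.rpow_le_rpow (by positivity) h1 (z := ((s + 1 : ℕ) : ℝ)⁻¹) (by positivity)
    rw [Real.mul_rpow hC.le (by positivity), Real.pow_rpow_inv_natCast (norm_nonneg _) (by omega),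
      ← Real.rpow_natCast, ← Real.rpow_mul hpos.le] at this
    push_cast at this
    convert this using 2
    field_simp
    ring
  refine absurd (hbad n) (not_lt.2 ?_)
  calc |f (x n)| ^ (1 - 1 / ((n : ℝ) + 2)) ≤ |f (x n)| ^ (1 - 1 / ((s : ℝ) + 1)) := by
        refine Real.rpow_le_rpow_of_exponent_ge hpos h2.le (sub_le_sub_left ?_ 1)
        exact one_div_le_one_div_of_le (by positivity) (by
          have : (s : ℝ) ≤ n := by exact_mod_cast h3
          linarith)
    _ ≤ _ := hle.trans (by gcongr; linarith)

/-- The **Łojasiewicz gradient inequality**. -/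
theorem exists_rpow_abs_sub_le_norm_fderiv {E : Type*} [NormedAddCommGroup E] [NormedSpace ℝ E]
    [FiniteDimensional ℝ E] {f : E → ℝ} {a : E} (hf : AnalyticAt ℝ f a) :
    ∃ θ ∈ Set.Ico (1 / 2 : ℝ) 1, ∃ C > 0, ∀ᶠ x in 𝓝 a, |f x - f a| ^ θ ≤ C * ‖fderiv ℝ f x‖ := by
  let A : E ≃L[ℝ] (Fin (Module.finrank ℝ E) → ℝ) := .ofFinrankEq (by simp)
  have hg : AnalyticAt ℝ (fun v => f (a + A.symm v) - f a) 0 :=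
    (AnalyticAt.fun_comp (by simpa using hf)
      (analyticAt_const.add (A.symm.toContinuousLinearMap.analyticAt 0))).sub analyticAt_const
  obtain ⟨θ, hθ, C, hC, h⟩ := exists_rpow_abs_le_norm_fderiv_pi hg (by simp)
  refine ⟨θ, hθ, C * (‖A.symm.toContinuousLinearMap‖ + 1), by positivity, ?_⟩
  have ht : Tendsto (fun x => A (x - a)) (𝓝 a) (𝓝 0) :=
    (A.continuous.comp (continuous_sub_right a)).tendsto' a 0 (by simp)
  filter_upwards [ht.eventually h, hf.eventually_analyticAt] with x hx hxa
  have hd : HasFDerivAt (fun v => f (a + A.symm v) - f a)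
      ((fderiv ℝ f x).comp A.symm.toContinuousLinearMap) (A (x - a)) := by
    refine HasFDerivAt.sub_const _ (HasFDerivAt.comp _ ?_ (A.symm.hasFDerivAt.const_add a))
    simpa using hxa.differentiableAt.hasFDerivAt
  rw [hd.fderiv] at hx
  simp only [A.symm_apply_apply, add_sub_cancel] at hx
  refine hx.trans ?_
  rw [mul_assoc, mul_comm (_ + 1)]
  gcongr
  exact (ContinuousLinearMap.opNorm_comp_le _ _).trans (by gcongr; linarith)

/-- Analytic functions satisfy the **Kurdyka–Łojasiewicz inequality** with a power
desingularizing function. -/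
theorem exists_kurdyka {E : Type*} [NormedAddCommGroup E] [InnerProductSpace ℝ E]
    [FiniteDimensional ℝ E] {f : E → ℝ} {a : E} (hf : AnalyticAt ℝ f a) :
    ∃ θ ∈ Set.Ico (1 / 2 : ℝ) 1, ∀ᶠ x in 𝓝 a, f a < f x →
      1 ≤ (1 - θ) * (f x - f a) ^ (-θ) * ‖gradient f x‖ := by
  obtain ⟨θ, hθ, C, hC, h⟩ := exists_rpow_abs_sub_le_norm_fderiv hf
  obtain ⟨h1, h2⟩ := hθ
  refine ⟨(θ + 1) / 2, ⟨by linarith, by linarith⟩, ?_⟩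
  have hpos : 0 < (1 - θ) / 2 := by linarith
  have ht : Tendsto (fun x => |f x - f a| ^ ((1 - θ) / 2)) (𝓝 a) (𝓝 0) := by
    have hc : ContinuousAt (fun x => |f x - f a| ^ ((1 - θ) / 2)) a :=
      (hf.continuousAt.sub continuousAt_const).abs.rpow_const (.inr hpos.le)
    simpa [hpos.ne'] using hc.tendsto
  filter_upwards [h, ht.eventually_lt_const (div_pos hpos hC)] with x hx hsm hlt
  have hs : 0 < f x - f a := sub_pos.2 hlt
  rw [abs_of_pos hs] at hx hsm
  have hgrad : ‖gradient f x‖ = ‖fderiv ℝ f x‖ := by simp [gradient]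
  rw [lt_div_iff₀ hC] at hsm
  have hsplit : (f x - f a) ^ ((θ + 1) / 2) = (f x - f a) ^ ((1 - θ) / 2) * (f x - f a) ^ θ := by
    rw [← Real.rpow_add hs]
    congr 1
    ring
  rw [hgrad, Real.rpow_neg hs.le, mul_assoc, inv_mul_eq_div, ← mul_div_assoc,
    one_le_div (Real.rpow_pos_of_pos hs _), hsplit]
  have hp := Real.rpow_nonneg hs.le ((1 - θ) / 2)
  calc (f x - f a) ^ ((1 - θ) / 2) * (f x - f a) ^ θ
      ≤ (f x - f a) ^ ((1 - θ) / 2) * (C * ‖fderiv ℝ f x‖) := by gcongr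
    _ = (f x - f a) ^ ((1 - θ) / 2) * C * ‖fderiv ℝ f x‖ := by ring
    _ ≤ (1 - θ) / 2 * ‖fderiv ℝ f x‖ := by gcongr
    _ = _ := by ring

end LocalUniformization

/-- The mean-field KL objective
`G(q) = Σ_x Ψ(x) Π_j q_j^{x_j}(1−q_j)^{1−x_j} + Σ_i f_i(q_i)` is real analytic
on `(0,1)^N` and satisfies the Kurdyka–Łojasiewicz property at every critical
point `q̄ ∈ (0,1)^N` with `φ(s) = s^{1−θ}` for some `θ ∈ [1/2, 1)`:
`(1−θ)·(G(q) − G(q̄))^{−θ}·‖∇G(q)‖ ≥ 1` for `q` near `q̄` with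
`G(q̄) < G(q) < G(q̄) + η`. -/
theorem meanfield_objective_KL_property
    (N : ℕ) (hN : 1 ≤ N) (Ψ : (Fin N → Bool) → ℝ)
    (p0 : Fin N → ℝ) (hp0 : ∀ i, p0 i ∈ Set.Ioo (0 : ℝ) 1)
    (G : EuclideanSpace ℝ (Fin N) → ℝ)
    (hG : ∀ q : EuclideanSpace ℝ (Fin N), G q =
      (∑ x : Fin N → Bool, Ψ x * ∏ j, (if x j then q j else 1 - q j)) +
      ∑ i, ((1 - q i) * Real.log ((1 - q i) / (1 - p0 i)) +
        q i * Real.log (q i / p0 i))) :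
    AnalyticOnNhd ℝ G {q : EuclideanSpace ℝ (Fin N) | ∀ i, q i ∈ Set.Ioo (0 : ℝ) 1} ∧
    ∀ qbar : EuclideanSpace ℝ (Fin N), (∀ i, qbar i ∈ Set.Ioo (0 : ℝ) 1) →
      gradient G qbar = 0 →
      ∃ θ ∈ Set.Ico (1 / 2 : ℝ) 1, ∃ η > (0 : ℝ), ∃ U ∈ nhds qbar,
        ∀ q ∈ U, G qbar < G q → G q < G qbar + η →
          1 ≤ (1 - θ) * (G q - G qbar) ^ (-θ) * ‖gradient G q‖ := by
  have hana : AnalyticOnNhd ℝ G {q : EuclideanSpace ℝ (Fin N) | ∀ i, q i ∈ Set.Ioo (0 : ℝ) 1} := by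
    intro q hq
    have hc : ∀ i, AnalyticAt ℝ (fun q : EuclideanSpace ℝ (Fin N) => q i) q := fun i =>
      (EuclideanSpace.proj (𝕜 := ℝ) i).analyticAt q
    have hc' : ∀ i, AnalyticAt ℝ (fun q : EuclideanSpace ℝ (Fin N) => 1 - q i) q := fun i =>
      analyticAt_const.sub (hc i)
    have hlog : ∀ {φ : EuclideanSpace ℝ (Fin N) → ℝ}, AnalyticAt ℝ φ q → 0 < φ q →
        AnalyticAt ℝ (fun q => Real.log (φ q)) q := fun hφ h => (analyticAt_log h).fun_comp hφ
    rw [funext hG]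
    refine (Finset.analyticAt_fun_sum _ fun x _ => analyticAt_const.mul
      (Finset.analyticAt_fun_prod _ fun j _ => ?_)).add
      (Finset.analyticAt_fun_sum _ fun i _ => ?_)
    · cases x j
      exacts [by simpa using hc' j, by simpa using hc j]
    · obtain ⟨h1, h2⟩ := hq i
      obtain ⟨h3, h4⟩ := hp0 i
      exact ((hc' i).mul (hlog (hc' i).div_const (div_pos (sub_pos.2 h2) (sub_pos.2 h4)))).add
        ((hc i).mul (hlog (hc i).div_const (div_pos h1 h3)))
  refine ⟨hana, fun qbar hq _ => ?_⟩
  obtain ⟨θ, hθ, h⟩ := LocalUniformization.exists_kurdyka (hana qbar hq)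
  exact ⟨θ, hθ, 1, one_pos, _, h, fun q hq h1 _ => hq h1⟩
end

section
/- Let N ≥ 1, λ > 0, let Ψ : {0,1}^N → ℝ be bounded, let p_i⁰ ∈ (0,1), and let G : (0,1)^N → ℝ be the mean-field Kullback–Leibler objective G(q) = Σ_{x ∈ {0,1}^N} Ψ(x) Π_j q_j^{x_j}(1−q_j)^{1−x_j} + Σ_i [ (1−q_i)log((1−q_i)/(1−p_i⁰)) + q_i·log(q_i/p_i⁰) ]. Let (Q^t)_{t≥0} be the sequence generated by the proximal alternate minimization: Q⁰ = (p_1⁰,…,p_N⁰) and, for each t and each i in increasing order, q_i^{t+1} is the unique minimizer over q ∈ (0,1) of q ↦ G(q_1^{t+1},…,q_{i−1}^{t+1}, q, q_{i+1}^t,…,q_N^t) + λ·l(q, q_i^t), where l(q,q₀) = q·log(q/q₀) + (1−q)·log((1−q)/(1−q₀)). Then the sequence (Q^t) converges to a single point Q̄ ∈ (0,1)^N which is a critical point of G (∇G(Q̄) = 0). -/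
section DifferentialAlgebra

open Polynomial
open scoped IntermediateField.algebraAdjoinAdjoin

theorem Derivation.exists_extension_of_formallyEtale {R S T : Type*} [CommRing R] [CommRing S]
    [CommRing T] [Algebra R S] [Algebra R T] [Algebra S T] [IsScalarTower R S T]
    [Algebra.FormallyEtale S T] {M : Type*} [AddCommGroup M] [Module R M] [Module S M] [Module T M]
    [IsScalarTower S T M] [IsScalarTower R S M] [IsScalarTower R T M] (d : Derivation R S M) :
    ∃ d' : Derivation R T M, ∀ s, d' (algebraMap S T s) = d s := by
  have h := KaehlerDifferential.isBaseChange_of_formallyEtale R S T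
  refine ⟨(h.lift d.liftKaehlerDifferential).compDer (KaehlerDifferential.D R T), fun s => ?_⟩
  have := h.lift_eq d.liftKaehlerDifferential (KaehlerDifferential.D R S s)
  simpa using this

theorem Derivation.ext_of_formallyEtale {R S T : Type*} [CommRing R] [CommRing S]
    [CommRing T] [Algebra R S] [Algebra R T] [Algebra S T] [IsScalarTower R S T]
    [Algebra.FormallyUnramified S T] {M : Type*} [AddCommGroup M] [Module R M] [Module S M]
    [Module T M] [IsScalarTower S T M] [IsScalarTower R S M] [IsScalarTower R T M]
    (d d' : Derivation R T M) (h : ∀ s, d (algebraMap S T s) = d' (algebraMap S T s)) :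
    d = d' := by
  let e : Derivation S T M := Derivation.mk'
    { toFun := fun t => d t - d' t
      map_add' := fun a b => by simp; abel
      map_smul' := fun s a => by
        simp [Algebra.smul_def s a, h, smul_sub] }
    (fun a b => by simp [smul_sub]; abel)
  have he : e = 0 := by
    have : e.liftKaehlerDifferential = 0 := by
      refine LinearMap.ext fun x => ?_
      rw [Subsingleton.elim x 0, map_zero, map_zero]
    rw [← e.liftKaehlerDifferential_comp, this]
    ext; simp
  ext t
  exact sub_eq_zero.1 (DFunLike.congr_fun he t)

/-- `f` is regular at `0`: a quotient of polynomials whose denominator does not vanish at `0`. -/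
def RegularAtZero {B : Type*} (F : Type*) [Field B] [Field F] [Algebra B[X] F] (f : F) : Prop :=
  ∃ a b : B[X], b.coeff 0 ≠ 0 ∧ f * algebraMap B[X] F b = algebraMap B[X] F a

namespace RegularAtZero

variable {B F : Type*} [Field B] [Field F] [Algebra B F] [Algebra B[X] F] [IsScalarTower B B[X] F]

theorem of_polynomial (p : B[X]) : RegularAtZero (B := B) F (algebraMap B[X] F p) :=
  ⟨p, 1, by simp, by simp⟩

theorem of_const (c : B) : RegularAtZero (B := B) F (algebraMap B F c) := by
  rw [IsScalarTower.algebraMap_apply B B[X] F]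
  exact of_polynomial _

theorem add {f g : F} (hf : RegularAtZero (B := B) F f) (hg : RegularAtZero (B := B) F g) :
    RegularAtZero (B := B) F (f + g) := by
  obtain ⟨a, b, hb, h⟩ := hf
  obtain ⟨a', b', hb', h'⟩ := hg
  refine ⟨a * b' + a' * b, b * b', by simp [hb, hb', mul_coeff_zero], ?_⟩
  simp only [map_add, map_mul, ← h, ← h']
  ring

theorem mul {f g : F} (hf : RegularAtZero (B := B) F f) (hg : RegularAtZero (B := B) F g) :
    RegularAtZero (B := B) F (f * g) := by
  obtain ⟨a, b, hb, h⟩ := hf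
  obtain ⟨a', b', hb', h'⟩ := hg
  refine ⟨a * a', b * b', by simp [hb, hb', mul_coeff_zero], ?_⟩
  simp only [map_mul, ← h, ← h']
  ring

theorem neg {f : F} (hf : RegularAtZero (B := B) F f) : RegularAtZero (B := B) F (-f) := by
  obtain ⟨a, b, hb, h⟩ := hf
  exact ⟨-a, b, hb, by simp [← h]⟩

theorem pow {f : F} (hf : RegularAtZero (B := B) F f) (n : ℕ) :
    RegularAtZero (B := B) F (f ^ n) := by
  induction n with
  | zero => simpa using of_polynomial (B := B) (F := F) 1
  | succ n ih => rw [pow_succ]; exact ih.mul hf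

theorem sum {ι : Type*} (s : Finset ι) {f : ι → F} (hf : ∀ i ∈ s, RegularAtZero (B := B) F (f i)) :
    RegularAtZero (B := B) F (∑ i ∈ s, f i) := by
  classical
  induction s using Finset.induction_on with
  | empty => simpa using of_polynomial (B := B) (F := F) 0
  | insert a s ha ih =>
    rw [Finset.sum_insert ha]
    exact (hf _ (by simp)).add (ih fun i hi => hf i (by simp [hi]))

variable [IsFractionRing B[X] F]

theorem derivation {f : F} (hf : RegularAtZero (B := B) F f) (δ : Derivation B F F)
    (hδ : δ (algebraMap B[X] F X) = 1) : RegularAtZero (B := B) F (δ f) := by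
  have hpoly : ∀ p : B[X], δ (algebraMap B[X] F p) = algebraMap B[X] F (derivative p) := by
    intro p
    have haeval : ∀ p : B[X], algebraMap B[X] F p = aeval (algebraMap B[X] F X) p := fun p => by
      rw [aeval_algebraMap_apply, aeval_X_left_apply]
    rw [haeval p, Derivation.map_aeval, hδ, smul_eq_mul, mul_one, ← haeval]
  obtain ⟨a, b, hb, h⟩ := hf
  have hb0 : algebraMap B[X] F b ≠ 0 := by
    rw [Ne, FaithfulSMul.algebraMap_eq_zero_iff]
    rintro rfl
    simp at hb
  have h1 := congrArg δ h
  rw [Derivation.leibniz, hpoly, hpoly, smul_eq_mul, smul_eq_mul] at h1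
  refine ⟨derivative a * b - a * derivative b, b * b, by simp [hb, mul_coeff_zero], ?_⟩
  simp only [map_mul, map_sub, ← h, ← h1]
  ring

theorem not_inv_X : ¬ RegularAtZero (B := B) F (algebraMap B[X] F X)⁻¹ := by
  rintro ⟨a, b, hb, h⟩
  have hX : algebraMap B[X] F X ≠ 0 := by simp
  have : algebraMap B[X] F b = algebraMap B[X] F (X * a) := by
    rw [map_mul, ← h]; field_simp
  have := IsFractionRing.injective B[X] F this
  simp [this] at hb

theorem exists_eq_zpow_mul {f : F} (hf : f ≠ 0) : ∃ (n : ℤ) (u : F),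
    RegularAtZero (B := B) F u ∧ RegularAtZero (B := B) F u⁻¹ ∧ u ≠ 0 ∧
      f = algebraMap B[X] F X ^ n * u := by
  have hX : algebraMap B[X] F X ≠ 0 := by simp
  have key : ∀ p : B[X], p ≠ 0 → ∃ (n : ℕ) (r : B[X]), r.coeff 0 ≠ 0 ∧ p = X ^ n * r := by
    intro p hp
    obtain ⟨r, hr, h⟩ := Polynomial.exists_eq_pow_rootMultiplicity_mul_and_not_dvd p hp 0
    refine ⟨_, r, ?_, by simpa using hr⟩
    simpa [Polynomial.X_dvd_iff] using h
  obtain ⟨a, b, hb, rfl⟩ := IsFractionRing.div_surjective (A := B[X]) f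
  have hb0 : b ≠ 0 := nonZeroDivisors.ne_zero hb
  have ha0 : a ≠ 0 := by rintro rfl; simp at hf
  obtain ⟨n, r, hr, rfl⟩ := key a ha0
  obtain ⟨m, s, hs, rfl⟩ := key b hb0
  have nz : ∀ p : B[X], p.coeff 0 ≠ 0 → algebraMap B[X] F p ≠ 0 := by
    intro p hp
    rw [Ne, FaithfulSMul.algebraMap_eq_zero_iff]
    rintro rfl
    simp at hp
  have hr' := nz r hr
  have hs' := nz s hs
  refine ⟨n - m, algebraMap B[X] F r / algebraMap B[X] F s, ⟨r, s, hs, by field_simp⟩,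
    ⟨s, r, hr, by field_simp⟩, by positivity, ?_⟩
  rw [zpow_sub₀ hX]
  simp
  field_simp

end RegularAtZero

/-- A sum of logarithmic derivatives which is an exact derivative has residue zero at `0`. -/
theorem residue_sum_logDeriv_eq_zero {B F : Type*} [Field B] [CharZero B] [Field F] [Algebra B F]
    [Algebra B[X] F] [IsScalarTower B B[X] F] [IsFractionRing B[X] F]
    (δ : Derivation B F F) (hδ : δ (algebraMap B[X] F X) = 1)
    {κ : Type*} [Fintype κ] (e : κ → B) (n : κ → ℤ) (u : κ → F)
    (hu : ∀ j, RegularAtZero (B := B) F (u j)) (hu' : ∀ j, RegularAtZero (B := B) F (u j)⁻¹)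
    (hu0 : ∀ j, u j ≠ 0) (g : F)
    (h : ∑ j, algebraMap B F (e j) * (δ (algebraMap B[X] F X ^ n j * u j) /
      (algebraMap B[X] F X ^ n j * u j)) = δ g) :
    ∑ j, e j * n j = 0 := by
  set x := algebraMap B[X] F X with hx
  have hX : x ≠ 0 := by simp [hx]
  have hxr : RegularAtZero (B := B) F x := .of_polynomial X
  have hnx : ¬ RegularAtZero (B := B) F x⁻¹ := RegularAtZero.not_inv_X
  set s := ∑ j, e j * n j with hs
  set r := ∑ j, algebraMap B F (e j) * (δ (u j) * (u j)⁻¹) with hr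
  have hrr : RegularAtZero (B := B) F r :=
    .sum _ fun j _ => (RegularAtZero.of_const _).mul (((hu j).derivation δ hδ).mul (hu' j))
  have hg : δ g = algebraMap B F s * x⁻¹ + r := by
    rw [← h, hs, hr, map_sum, Finset.sum_mul, ← Finset.sum_add_distrib]
    refine Finset.sum_congr rfl fun j _ => ?_
    have := hu0 j
    have h1 : x ^ n j ≠ 0 := zpow_ne_zero _ hX
    rw [Derivation.leibniz, Derivation.leibniz_zpow, hδ, zpow_sub_one₀ hX]
    simp only [smul_eq_mul, zsmul_eq_mul, map_mul, map_intCast]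
    field_simp
    ring
  have notunit : ∀ c : B, RegularAtZero (B := B) F (algebraMap B F c * x⁻¹) → c = 0 := by
    intro c hc
    by_contra hc0
    apply hnx
    have := (RegularAtZero.of_const (F := F) c⁻¹).mul hc
    rwa [← mul_assoc, ← map_mul, inv_mul_cancel₀ hc0, map_one, one_mul] at this
  have regcase : RegularAtZero (B := B) F g → s = 0 := by
    intro hgr
    apply notunit
    have := (hgr.derivation δ hδ).add hrr.neg
    rwa [hg, add_neg_cancel_right] at this
  by_cases hg0 : g = 0
  · exact regcase (hg0 ▸ by simpa using RegularAtZero.of_polynomial (B := B) (F := F) 0)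
  obtain ⟨k, v, hv, hv', hv0, hgv⟩ := RegularAtZero.exists_eq_zpow_mul (B := B) hg0
  rw [← hx] at hgv
  rcases le_or_gt 0 k with hk | hk
  · apply regcase
    lift k to ℕ using hk
    rw [hgv, zpow_natCast]
    exact (hxr.pow k).mul hv
  · exfalso
    obtain ⟨m, rfl⟩ : ∃ m : ℕ, k = -((m : ℤ) + 1) := ⟨(-k - 1).toNat, by omega⟩
    have h1 : δ g = x ^ (-((m : ℤ) + 1)) * x⁻¹ * ((-((m : F) + 1)) * v + x * δ v) := by
      rw [hgv, Derivation.leibniz, Derivation.leibniz_zpow, hδ, zpow_sub_one₀ hX]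
      simp only [smul_eq_mul, zsmul_eq_mul]
      push_cast
      field_simp
      ring
    have hxm : x ^ (-((m : ℤ) + 1)) = (x ^ m)⁻¹ * x⁻¹ := by
      rw [zpow_neg, zpow_add₀ hX]; simp [mul_comm]
    have hxm0 : x ^ m ≠ 0 := pow_ne_zero _ hX
    have h2 : algebraMap B F ((m : B) + 1) * x⁻¹ =
        (δ v + -(x ^ m * (algebraMap B F s + x * r))) * v⁻¹ := by
      rw [hg, hxm] at h1
      simp only [map_add, map_natCast, map_one]
      field_simp at h1 ⊢
      linear_combination h1
    have h3 : ((m : B) + 1) = 0 := by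
      apply notunit
      rw [h2]
      exact ((hv.derivation δ hδ).add (((hxr.pow m).mul
        ((RegularAtZero.of_const s).add (hxr.mul hrr))).neg)).mul hv'
    exact (Nat.cast_add_one_ne_zero m) h3

theorem sum_logDeriv_ne_derivation_of_isGalois {B F E : Type*} [Field B] [CharZero B] [Field F]
    [Algebra B F] [Algebra B[X] F] [IsScalarTower B B[X] F] [IsFractionRing B[X] F]
    [Field E] [Algebra F E] [Algebra B E] [IsScalarTower B F E] [FiniteDimensional F E]
    [IsGalois F E] (δ : Derivation B F F) (hδ : δ (algebraMap B[X] F X) = 1)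
    (d : Derivation B E E) (hd : ∀ f, d (algebraMap F E f) = algebraMap F E (δ f))
    {κ : Type*} [Fintype κ] (e : κ → B) (he : ∀ n : κ → ℤ, ∑ j, e j * n j = 0 → n = 0)
    (w : κ → E) (hw : ∀ j, w j ≠ 0) (v : E) (j₀ : κ)
    (hj₀ : w j₀ = algebraMap F E (algebraMap B[X] F X)) :
    ∑ j, algebraMap B E (e j) * (d (w j) / w j) ≠ d v := by
  intro h
  have := Algebra.FormallyEtale.of_isSeparable F E
  have comm : ∀ (σ : E ≃ₐ[F] E) (a : E), d (σ a) = σ (d a) := by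
    intro σ a
    let d' : Derivation B E E := Derivation.mk'
      { toFun := fun t => σ.symm (d (σ t))
        map_add' := by simp
        map_smul' := fun b a => by
          have hb : σ (algebraMap B E b) = algebraMap B E b := by
            rw [IsScalarTower.algebraMap_apply B F E, AlgEquiv.commutes]
          have hb' : σ.symm (algebraMap B E b) = algebraMap B E b := by
            rw [IsScalarTower.algebraMap_apply B F E, AlgEquiv.commutes]
          simp [Algebra.smul_def, hb, hb'] }
      (fun a b => by simp)
    have : d' = d := Derivation.ext_of_formallyEtale (S := F) _ _ fun s => by
      simp [d', hd]
    have := DFunLike.congr_fun this a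
    rw [← this]
    simp [d']
  have logprod : ∀ (s : Finset (E ≃ₐ[F] E)) (a : E), a ≠ 0 →
      d (∏ σ ∈ s, σ a) / (∏ σ ∈ s, σ a) = ∑ σ ∈ s, σ (d a / a) := by
    classical
    intro s a ha
    induction s using Finset.induction_on with
    | empty => simp
    | insert σ s hσ ih =>
      have h1 : σ a ≠ 0 := by simpa using ha
      have h2 : ∏ σ ∈ s, σ a ≠ 0 := Finset.prod_ne_zero_iff.2 fun τ _ => by simpa using ha
      rw [Finset.prod_insert hσ, Finset.sum_insert hσ, ← ih, Derivation.leibniz, comm, map_div₀]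
      simp only [smul_eq_mul]
      field_simp
      ring
  have hN : ∀ a, a ≠ 0 → algebraMap F E (δ (Algebra.norm F a) / Algebra.norm F a) =
      ∑ σ : E ≃ₐ[F] E, σ (d a / a) := by
    intro a ha
    rw [map_div₀, ← hd, Algebra.norm_eq_prod_automorphisms, logprod _ _ ha]
  have hT : algebraMap F E (δ (Algebra.trace F E v)) = ∑ σ : E ≃ₐ[F] E, σ (d v) := by
    rw [← hd, trace_eq_sum_automorphisms, map_sum]
    exact Finset.sum_congr rfl fun σ _ => comm σ v
  have hF : ∑ j, algebraMap B F (e j) * (δ (Algebra.norm F (w j)) / Algebra.norm F (w j)) =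
      δ (Algebra.trace F E v) := by
    apply FaithfulSMul.algebraMap_injective F E
    rw [hT, map_sum, ← h]
    simp only [map_mul, map_sum, hN _ (hw _), Finset.mul_sum]
    rw [Finset.sum_comm]
    refine Finset.sum_congr rfl fun σ _ => Finset.sum_congr rfl fun j _ => ?_
    rw [IsScalarTower.algebraMap_apply B F E, AlgEquiv.commutes]
  have hfac := fun j => RegularAtZero.exists_eq_zpow_mul (B := B)
    (Algebra.norm_ne_zero_iff.2 (hw j) : Algebra.norm F (w j) ≠ 0)
  have hX : algebraMap B[X] F X ≠ 0 := by simp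
  choose n u hu hu' hu0 hnu using hfac
  simp only [hnu] at hF
  have hn := he n (residue_sum_logDeriv_eq_zero δ hδ e n u hu hu' hu0 _ hF)
  have h0 := hnu j₀
  rw [hn, Pi.zero_apply, zpow_zero, one_mul, hj₀, Algebra.norm_algebraMap] at h0
  have hr := hu' j₀
  rw [← h0] at hr
  refine RegularAtZero.not_inv_X (B := B) (F := F) ?_
  have hpos : 0 < Module.finrank F E := Module.finrank_pos
  obtain ⟨m, hm⟩ := Nat.exists_eq_succ_of_ne_zero hpos.ne'
  have := hr.mul ((RegularAtZero.of_polynomial (B := B) (F := F) X).pow m)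
  rwa [hm, pow_succ, mul_inv_rev, mul_assoc, inv_mul_cancel₀ (pow_ne_zero _ hX), mul_one] at this

theorem exists_derivation_sum_logDeriv_ne {B F K : Type*} [Field B] [CharZero B] [Field F]
    [Algebra B F] [Algebra B[X] F] [IsScalarTower B B[X] F] [IsFractionRing B[X] F]
    [Field K] [Algebra F K] [Algebra B K] [IsScalarTower B F K] [FiniteDimensional F K]
    {κ : Type*} [Fintype κ] (e : κ → B) (he : ∀ n : κ → ℤ, ∑ j, e j * n j = 0 → n = 0)
    (w : κ → K) (hw : ∀ j, w j ≠ 0) (v : K) (j₀ : κ)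
    (hj₀ : w j₀ = algebraMap F K (algebraMap B[X] F X)) :
    ∃ d : Derivation B K K, ∑ j, algebraMap B K (e j) * (d (w j) / w j) ≠ d v := by
  have : CharZero F := charZero_of_injective_algebraMap (algebraMap B F).injective
  have : CharZero K := charZero_of_injective_algebraMap (algebraMap F K).injective
  have := Algebra.FormallyEtale.of_isLocalization (Rₘ := F) (nonZeroDivisors B[X])
  obtain ⟨δ, hδ⟩ := Derivation.exists_extension_of_formallyEtale (R := B) (T := F)
    ((Algebra.linearMap B[X] F).compDer derivative')
  have hδX : δ (algebraMap B[X] F X) = 1 := by simp [hδ]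
  have := Algebra.FormallyEtale.of_isSeparable F K
  obtain ⟨d, hd⟩ := Derivation.exists_extension_of_formallyEtale (R := B) (T := K)
    ((Algebra.linearMap F K).compDer δ)
  refine ⟨d, fun h => ?_⟩
  let E := IntermediateField.normalClosure F K (AlgebraicClosure K)
  have : IsGalois F E := {}
  have : IsScalarTower B K E := IsScalarTower.of_algebraMap_eq fun b => Subtype.ext <|
    IsScalarTower.algebraMap_apply B K (AlgebraicClosure K) b
  have : IsScalarTower B F E := IsScalarTower.of_algebraMap_eq fun b => by
    rw [IsScalarTower.algebraMap_apply F K E, ← IsScalarTower.algebraMap_apply B F K,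
      ← IsScalarTower.algebraMap_apply B K E]
  have : FiniteDimensional K E := FiniteDimensional.right F K E
  have : CharZero E := charZero_of_injective_algebraMap (algebraMap F E).injective
  have := Algebra.FormallyEtale.of_isSeparable K E
  obtain ⟨D, hD⟩ := Derivation.exists_extension_of_formallyEtale (R := B) (T := E)
    ((Algebra.linearMap K E).compDer d)
  refine sum_logDeriv_ne_derivation_of_isGalois δ hδX D (fun f => ?_) e he
    (fun j => algebraMap K E (w j)) (fun j => by simpa using hw j) (algebraMap K E v) j₀ ?_ ?_
  · rw [IsScalarTower.algebraMap_apply F K E, hD]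
    simp [hd, IsScalarTower.algebraMap_apply F K E]
  · simp [hj₀, IsScalarTower.algebraMap_apply F K E]
  · simp only [hD]
    simp [← h, map_sum, IsScalarTower.algebraMap_apply B K E]

theorem isFractionRing_polynomial_adjoin_of_transcendental {B L : Type*} [Field B] [Field L]
    [Algebra B L] {x : L} (hx : Transcendental B x) :
    letI := (aeval (R := B) (IntermediateField.AdjoinSimple.gen B x)).toRingHom.toAlgebra
    IsFractionRing B[X] (IntermediateField.adjoin B {x}) := by
  let := (aeval (R := B) (IntermediateField.AdjoinSimple.gen B x)).toRingHom.toAlgebra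
  have hmap : ∀ p : B[X], (algebraMap B[X] (IntermediateField.adjoin B {x}) p : L) = aeval x p := by
    intro p
    change (IntermediateField.adjoin B {x}).val (aeval (IntermediateField.AdjoinSimple.gen B x) p) = _
    rw [← aeval_algHom_apply]
    simp
  have hinj : Function.Injective (algebraMap B[X] (IntermediateField.adjoin B {x})) := by
    rw [injective_iff_map_eq_zero]
    intro p hp
    rw [transcendental_iff] at hx
    apply hx
    rw [← hmap, hp]; rfl
  have : FaithfulSMul B[X] (IntermediateField.adjoin B {x}) :=
    (faithfulSMul_iff_algebraMap_injective _ _).2 hinj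
  refine IsFractionRing.of_field _ _ fun y => ?_
  obtain ⟨r, s, h⟩ := (IntermediateField.mem_adjoin_simple_iff B (y : L)).1 y.2
  exact ⟨r, s, Subtype.ext (by simp [hmap, h])⟩

theorem isAlgebraic_of_sum_logDeriv_eq {C L : Type*} [Field C] [CharZero C] [Field L] [Algebra C L]
    {ι : Type*} [Finite ι] (z : ι → L) (hz : IntermediateField.adjoin C (Set.range z) = ⊤)
    {κ : Type*} [Fintype κ] (e : κ → C) (he : ∀ n : κ → ℤ, ∑ j, e j * n j = 0 → n = 0)
    (w : κ → L) (hw : ∀ j, w j ≠ 0) (v : L)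
    (h : ∀ d : Derivation C L L, ∑ j, algebraMap C L (e j) * (d (w j) / w j) = d v) (j₀ : κ) :
    IsAlgebraic C (w j₀) := by
  by_contra htr
  set x := w j₀ with hx
  have hind : AlgebraicIndepOn C id ({x} : Set L) := by
    rw [AlgebraicIndepOn, algebraicIndependent_unique_type_iff]
    exact htr
  obtain ⟨t, hxt, ht⟩ := exists_isTranscendenceBasis_superset hind
  have hxt' : x ∈ t := hxt rfl
  let s : Set L := t \ {x}
  let B := IntermediateField.adjoin C s
  have hxs : Transcendental (Algebra.adjoin C s) x := by
    have := ht.1.transcendental_adjoin (s := (Subtype.val : t → L) ⁻¹' s) (i := ⟨x, hxt'⟩)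
      (by simp [s])
    have hs : (Subtype.val : t → L) '' ((Subtype.val : t → L) ⁻¹' s) = s := by
      rw [Subtype.image_preimage_coe]
      exact Set.inter_eq_right.2 Set.sdiff_subset
    rwa [hs] at this
  have hxB : Transcendental B x := fun hB =>
    hxs ((IsFractionRing.isAlgebraic_iff (Algebra.adjoin C s) B L).2 hB)
  let F := IntermediateField.adjoin B {x}
  let : Algebra B[X] F := (aeval (R := B) (IntermediateField.AdjoinSimple.gen B x)).toRingHom.toAlgebra
  have hfrac : IsFractionRing B[X] F := isFractionRing_polynomial_adjoin_of_transcendental hxB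
  have : IsScalarTower B B[X] F := IsScalarTower.of_algebraMap_eq fun b => by
    change _ = aeval _ _
    rw [Polynomial.algebraMap_eq, aeval_C]
  have hX : algebraMap B[X] F X = IntermediateField.AdjoinSimple.gen B x := aeval_X _
  have htF : ∀ a ∈ Algebra.adjoin C (Set.range (Subtype.val : t → L)), a ∈ F := by
    intro a ha
    have : Algebra.adjoin C (Set.range (Subtype.val : t → L)) ≤
        (F.restrictScalars C).toSubalgebra := by
      apply Algebra.adjoin_le
      rintro _ ⟨⟨y, hy⟩, rfl⟩
      change y ∈ F
      by_cases hyx : y = x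
      · rw [hyx]
        exact IntermediateField.mem_adjoin_simple_self B x
      · exact F.algebraMap_mem (⟨y, IntermediateField.subset_adjoin C s ⟨hy, hyx⟩⟩ : B)
    exact this ha
  have hfin : FiniteDimensional F L := by
    have halg : Algebra.IsAlgebraic F L := by
      have h1 := ht.isAlgebraic
      let A := Algebra.adjoin C (Set.range (Subtype.val : t → L))
      let φ : A →+* F := A.subtype.codRestrict F fun a => htF a a.2
      let : Algebra A F := φ.toAlgebra
      have : IsScalarTower A F L := IsScalarTower.of_algebraMap_eq fun _ => rfl
      have hφ : Function.Injective (algebraMap A F) := fun a b hab =>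
        Subtype.ext (congrArg (fun y : F => (y : L)) hab)
      exact Algebra.IsAlgebraic.extendScalars hφ
    have h1 : FiniteDimensional F (IntermediateField.adjoin F (Set.range z)) :=
      IntermediateField.finiteDimensional_adjoin fun y _ => (halg.isAlgebraic y).isIntegral
    have h2 : IntermediateField.adjoin F (Set.range z) = ⊤ := by
      rw [eq_top_iff]
      intro y _
      have h3 : IntermediateField.adjoin C (Set.range z) ≤
          ((IntermediateField.adjoin F (Set.range z)).restrictScalars B).restrictScalars C :=
        IntermediateField.adjoin_le_iff.2 (IntermediateField.subset_adjoin F (Set.range z))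
      exact h3 (hz ▸ IntermediateField.mem_top)
    rw [h2] at h1
    exact IntermediateField.topEquiv.toLinearEquiv.finiteDimensional
  have hCB : Function.Injective (algebraMap C B) := (algebraMap C B).injective
  have : CharZero B := charZero_of_injective_algebraMap hCB
  obtain ⟨d, hd⟩ := exists_derivation_sum_logDeriv_ne (B := B) (F := F) (K := L)
    (fun j => algebraMap C B (e j)) (fun n hn => he n (hCB (by simpa using hn))) w hw v j₀
    (by rw [hX]; rfl)
  exact hd (h (d.restrictScalars C))

theorem Derivation.eq_zero_of_isAlgebraic {C L : Type*} [Field C] [CharZero C] [Field L]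
    [Algebra C L] (d : Derivation C L L) {x : L} (hx : IsAlgebraic C x) : d x = 0 := by
  have h1 : d (aeval x (minpoly C x)) = 0 := by rw [minpoly.aeval, map_zero]
  rw [Derivation.map_aeval] at h1
  refine (smul_eq_zero.1 h1).resolve_left ?_
  exact (minpoly.irreducible hx.isIntegral).separable.aeval_derivative_ne_zero (minpoly.aeval _ _)

/-- The field of constants of a derivation. -/
def Derivation.constants {k L : Type*} [Field k] [Field L] [Algebra k L] (d : Derivation k L L) :
    IntermediateField k L where
  carrier := {a | d a = 0}
  mul_mem' {a b} ha hb := by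
    have ha : d a = 0 := ha
    have hb : d b = 0 := hb
    simp [ha, hb]
  add_mem' {a b} ha hb := by
    have ha : d a = 0 := ha
    have hb : d b = 0 := hb
    simp [ha, hb]
  algebraMap_mem' r := by simp
  inv_mem' a ha := by
    have ha : d a = 0 := ha
    simp [Derivation.leibniz_inv, ha]

theorem Derivation.eq_zero_of_adjoin_eq_top {k L : Type*} [Field k] [Field L] [Algebra k L]
    (d : Derivation k L L) {s : Set L} (hs : IntermediateField.adjoin k s = ⊤)
    (h : ∀ a ∈ s, d a = 0) : d = 0 := by
  have h1 : IntermediateField.adjoin k s ≤ d.constants := IntermediateField.adjoin_le_iff.2 h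
  ext a
  exact h1 (hs ▸ IntermediateField.mem_top)

/-- The logarithmic derivative attached to a derivation, as a homomorphism. -/
def Derivation.logDerivHom {k L : Type*} [Field k] [Field L] [Algebra k L] (d : Derivation k L L) :
    Additive Lˣ →+ L where
  toFun u := d (u.toMul : Lˣ) / (u.toMul : Lˣ)
  map_zero' := by simp
  map_add' u v := by
    simp only [toMul_add, Units.val_mul, Derivation.leibniz, smul_eq_mul]
    field_simp
    ring

theorem Derivation.logDeriv_prod_zpow {k L : Type*} [Field k] [Field L] [Algebra k L]
    (d : Derivation k L L) {ι : Type*} [Fintype ι] (z : ι → L) (hz : ∀ i, z i ≠ 0) (n : ι → ℤ) :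
    d (∏ i, z i ^ n i) / (∏ i, z i ^ n i) = ∑ i, n i * (d (z i) / z i) := by
  have h := map_sum d.logDerivHom (fun i => n i • Additive.ofMul (Units.mk0 (z i) (hz i)))
    Finset.univ
  simp only [map_zsmul] at h
  have h1 : d.logDerivHom (∑ i, n i • Additive.ofMul (Units.mk0 (z i) (hz i))) =
      d (∏ i, z i ^ n i) / (∏ i, z i ^ n i) := by
    simp only [Derivation.logDerivHom, AddMonoidHom.coe_mk, ZeroHom.coe_mk, toMul_sum, toMul_zsmul,
      toMul_ofMul, Units.coe_prod, Units.val_zpow_eq_zpow_val, Units.val_mk0]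
  rw [← h1, h]
  simp [Derivation.logDerivHom]

theorem sum_const_logDeriv_eq_zero {C L : Type*} [Field C] [CharZero C] [Field L] [Algebra C L]
    {ι : Type*} [Fintype ι] (z y : ι → L) (hz : ∀ i, z i ≠ 0)
    (htop : IntermediateField.adjoin C (Set.range z) = ⊤) (c : ι → C)
    (h : ∀ d : Derivation C L L, ∑ i, algebraMap C L (c i) * (d (z i) / z i - d (y i)) = 0)
    (d : Derivation C L L) : ∑ i, algebraMap C L (c i) * (d (z i) / z i) = 0 := by
  let M := Submodule.span ℤ (Set.range c)
  have : Module.Finite ℤ M := Module.Finite.span_of_finite ℤ (Set.finite_range c)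
  let b := Module.Free.chooseBasis ℤ M
  let r : ι → _ → ℤ := fun i => b.repr ⟨c i, Submodule.subset_span ⟨i, rfl⟩⟩
  have hc : ∀ i, c i = ∑ j, (b j : C) * r i j := by
    intro i
    have := congrArg (M.subtype) (b.sum_repr ⟨c i, Submodule.subset_span ⟨i, rfl⟩⟩)
    rw [map_sum] at this
    simpa [mul_comm] using this.symm
  let w := fun j => ∏ i, z i ^ r i j
  have hw : ∀ j, w j ≠ 0 := fun j => Finset.prod_ne_zero_iff.2 fun i _ => zpow_ne_zero _ (hz i)
  have hsum : ∀ d : Derivation C L L, ∑ j, algebraMap C L (b j) * (d (w j) / w j) =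
      ∑ i, algebraMap C L (c i) * (d (z i) / z i) := by
    intro d
    simp only [w, d.logDeriv_prod_zpow z hz, hc, map_sum, map_mul, Finset.mul_sum, Finset.sum_mul,
      map_intCast]
    rw [Finset.sum_comm]
    exact Finset.sum_congr rfl fun _ _ => Finset.sum_congr rfl fun _ _ => by ring
  have halg : ∀ j, IsAlgebraic C (w j) := by
    refine isAlgebraic_of_sum_logDeriv_eq z htop (fun j => (b j : C)) ?_ w hw
      (∑ i, c i • y i) ?_
    · intro n hn
      have := Fintype.linearIndependent_iff.1 b.linearIndependent n (Subtype.ext (by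
        simpa [mul_comm] using hn))
      exact funext this
    · intro d
      rw [hsum, map_sum, ← sub_eq_zero, ← h d, ← Finset.sum_sub_distrib]
      refine Finset.sum_congr rfl fun i _ => ?_
      rw [d.map_smul, Algebra.smul_def, mul_sub]
  rw [← hsum]
  exact Finset.sum_eq_zero fun j _ => by rw [d.eq_zero_of_isAlgebraic (halg j)]; simp

section AxSchanuel

variable {C L : Type*} [Field C] [CharZero C] [Field L] [Algebra C L]
    {ι : Type*} [Fintype ι]

/-- The conormal relations among the forms `dzᵢ/zᵢ - dyᵢ` are relations among the `dzᵢ/zᵢ`. -/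
theorem sum_logDeriv_eq_zero_of_sum_eq_zero (z y : ι → L) (hz : ∀ i, z i ≠ 0)
    (htop : IntermediateField.adjoin C (Set.range z) = ⊤)
    (D : Derivation C L L) (hD : ∀ i, D (z i) = z i * D (y i))
    (hC : ∀ a, D a = 0 → ∃ c, algebraMap C L c = a) (n : ℕ) :
    ∀ a : ι → L, Set.ncard {i | a i ≠ 0} = n →
    (∀ d : Derivation C L L, ∑ i, a i * (d (z i) / z i - d (y i)) = 0) →
    ∀ d : Derivation C L L, ∑ i, a i * (d (z i) / z i) = 0 := by
  induction n using Nat.strong_induction_on with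
  | _ n ih =>
  have ih' : ∀ a b : ι → L, Set.ncard {i | a i ≠ 0} = n → (∀ i, a i = 0 → b i = 0) →
      (∃ k, a k ≠ 0 ∧ b k = 0) →
      (∀ d : Derivation C L L, ∑ i, b i * (d (z i) / z i - d (y i)) = 0) →
      ∀ d : Derivation C L L, ∑ i, b i * (d (z i) / z i) = 0 := by
    rintro a b hn hab ⟨k, hk, hbk⟩ hb
    refine ih _ ?_ b rfl hb
    rw [← hn]
    refine Set.ncard_lt_ncard ⟨fun i hi hai => hi (hab i hai), fun h => h (a := k) hk hbk⟩
      (Set.toFinite _)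
  intro a hn ha
  by_cases h0 : ∀ k, a k = 0
  · intro d
    simp [h0]
  push Not at h0
  obtain ⟨k, hk⟩ := h0
  let a' : ι → L := fun i => a i / a k
  have ha' : ∀ d : Derivation C L L, ∑ i, a' i * (d (z i) / z i - d (y i)) = 0 := by
    intro d
    simp only [a', div_mul_eq_mul_div, ← Finset.sum_div, ha d, zero_div]
  suffices hs : ∀ d : Derivation C L L, ∑ i, a' i * (d (z i) / z i) = 0 by
    intro d
    have := hs d
    simp only [a', div_mul_eq_mul_div, ← Finset.sum_div] at this
    exact (div_eq_zero_iff.1 this).resolve_right hk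
  have hDa : ∀ d : Derivation C L L, ∑ i, D (a' i) * (d (z i) / z i - d (y i)) = 0 := by
    intro d
    have h1 := congrArg D (ha' d)
    have h2 := ha' ⁅D, d⁆
    rw [map_sum, map_zero] at h1
    rw [← add_zero (∑ i, _ * _)]
    nth_rw 1 [← h2]
    rw [← h1, ← Finset.sum_add_distrib]
    refine Finset.sum_congr rfl fun i _ => ?_
    have := hz i
    simp only [Derivation.commutator_apply, hD, Derivation.leibniz, Derivation.leibniz_div, map_sub,
      smul_eq_mul]
    field_simp
    ring
  have hDa' := ih' a (fun i => D (a' i)) hn (fun i hi => by simp [a', hi])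
    ⟨k, hk, by simp [a', div_self hk]⟩ hDa
  by_cases h1 : ∀ l, D (a' l) = 0
  · choose c hc using fun l => hC _ (h1 l)
    simp only [← hc] at ha' ⊢
    exact sum_const_logDeriv_eq_zero z y hz htop c ha'
  push Not at h1
  obtain ⟨l, hl⟩ := h1
  have hal : a l ≠ 0 := fun h => hl (by simp [a', h])
  have h2 := ih' a (fun i => a' i - a' l / D (a' l) * D (a' i)) hn (fun i hi => by simp [a', hi])
    ⟨l, hal, by field_simp; simp⟩ (fun d => by
      simp only [sub_mul, Finset.sum_sub_distrib, mul_assoc, ← Finset.mul_sum, ha', hDa]; simp)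
  intro d
  have h3 := h2 d
  simp only [sub_mul, Finset.sum_sub_distrib, mul_assoc, ← Finset.mul_sum, hDa'] at h3
  simpa using h3

end AxSchanuel

/-- A form of the Ax–Schanuel theorem: if `L` is generated over `k` by elements `z i` whose
logarithmic derivatives under `D` are derivatives of elements of `L`, then `D` vanishes. -/
theorem Derivation.eq_zero_of_exponential {k L : Type*} [Field k] [CharZero k] [Field L]
    [Algebra k L] {ι : Type*} [Fintype ι] (z y : ι → L) (hz : ∀ i, z i ≠ 0)
    (htop : IntermediateField.adjoin k (Set.range z) = ⊤)
    (D : Derivation k L L) (hD : ∀ i, D (z i) = z i * D (y i)) : D = 0 := by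
  let C := D.constants
  have htop' : IntermediateField.adjoin C (Set.range z) = ⊤ := by
    rw [eq_top_iff]
    intro y _
    have h3 : IntermediateField.adjoin k (Set.range z) ≤
        (IntermediateField.adjoin C (Set.range z)).restrictScalars k :=
      IntermediateField.adjoin_le_iff.2 (IntermediateField.subset_adjoin C (Set.range z))
    exact h3 (htop ▸ IntermediateField.mem_top)
  have : CharZero C := charZero_of_injective_algebraMap (algebraMap k C).injective
  let D' : Derivation C L L := Derivation.mk'
    { toFun := D
      map_add' := map_add D
      map_smul' := fun c x => by
        have hc : D (c : L) = 0 := c.2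
        simp [Algebra.smul_def, hc] }
    (fun a b => by simp)
  let Φ : Derivation C L L →ₗ[L] (ι → L) :=
    { toFun := fun d i => d (z i) / z i
      map_add' := fun d d' => by ext; simp [add_div]
      map_smul' := fun a d => by ext; simp [mul_div_assoc] }
  let ω : Derivation C L L →ₗ[L] (ι → L) :=
    { toFun := fun d i => d (z i) / z i - d (y i)
      map_add' := fun d d' => by ext; simp [add_div]; ring
      map_smul' := fun a d => by ext; simp [mul_div_assoc, mul_sub] }
  have hΦ : Function.Injective Φ := by
    rw [injective_iff_map_eq_zero]
    intro d hd
    refine d.eq_zero_of_adjoin_eq_top htop' ?_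
    rintro _ ⟨i, rfl⟩
    have : d (z i) / z i = 0 := congrFun hd i
    exact (div_eq_zero_iff.1 this).resolve_right (hz i)
  have hle : LinearMap.range Φ ≤ LinearMap.range ω := by
    intro v hv
    by_contra hvω
    obtain ⟨f, hfv, hf⟩ := Submodule.exists_le_ker_of_notMem hvω
    classical
    have hfs : ∀ u : ι → L, f u = ∑ i, f (fun j => if i = j then 1 else 0) * u i := by
      intro u
      rw [LinearMap.pi_apply_eq_sum_univ f u]
      simp [mul_comm]
    obtain ⟨d, rfl⟩ := hv
    refine hfv ?_
    rw [hfs]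
    refine sum_logDeriv_eq_zero_of_sum_eq_zero z y hz htop' D' hD (fun a ha => ⟨⟨a, ha⟩, rfl⟩)
      _ _ rfl (fun d => ?_) d
    have := hf ⟨d, rfl⟩
    rwa [LinearMap.mem_ker, hfs] at this
  have : Module.Finite L (Derivation C L L) := Module.Finite.of_injective Φ hΦ
  have hω : LinearMap.ker ω = ⊥ := by
    have h1 := LinearMap.finrank_range_add_finrank_ker ω
    have h2 := LinearMap.finrank_range_of_inj hΦ
    have h3 := Submodule.finrank_mono hle
    exact Submodule.finrank_eq_zero.1 (by omega)
  have h0 : D' = 0 := by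
    refine LinearMap.ker_eq_bot'.1 hω D' (funext fun i => ?_)
    change D (z i) / z i - D (y i) = 0
    rw [hD, mul_div_cancel_left₀ _ (hz i), sub_self]
  ext a
  exact DFunLike.congr_fun h0 a

end DifferentialAlgebra

section ZariskiClosure

open Topology

theorem MvPolynomial.hasFDerivAt_eval {ι : Type*} [Fintype ι] (f : MvPolynomial ι ℝ) (x : ι → ℝ) :
    HasFDerivAt (fun x => eval x f)
      (∑ j, eval x (pderiv j f) • ContinuousLinearMap.proj (R := ℝ) (φ := fun _ : ι => ℝ) j) x := by
  classical
  induction f using MvPolynomial.induction_on with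
  | C a =>
    simp only [eval_C, pderiv_C, map_zero, zero_smul, Finset.sum_const_zero]
    exact hasFDerivAt_const a x
  | add p q hp hq =>
    simp only [map_add, add_smul, Finset.sum_add_distrib]
    exact hp.add hq
  | mul_X p i hp =>
    simp only [map_mul, eval_X]
    refine (hp.mul (hasFDerivAt_apply i x)).congr_fderiv ?_
    ext v
    simp only [Derivation.leibniz, pderiv_X, smul_eq_mul, map_add, map_mul, eval_X,
      FunLike.coe_add, Pi.add_apply, FunLike.coe_smul, Pi.smul_apply, sum_apply,
      ContinuousLinearMap.proj_apply, Finset.mul_sum, add_mul, Finset.sum_add_distrib]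
    congr 1
    · simp [Pi.single_apply, apply_ite (eval x), mul_comm]
    · exact Finset.sum_congr rfl fun _ _ => by ring

theorem MvPolynomial.mkDerivation_eq_sum {R ι A : Type*} [Fintype ι] [CommRing R] [AddCommGroup A]
    [Module R A] [Module (MvPolynomial ι R) A] [IsScalarTower R (MvPolynomial ι R) A] (d : ι → A)
    (f : MvPolynomial ι R) : mkDerivation R d f = ∑ j, pderiv j f • d j := by
  classical
  let D : Derivation R (MvPolynomial ι R) A :=
    ∑ j, (LinearMap.toSpanSingleton (MvPolynomial ι R) A (d j)).compDer (pderiv j)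
  have hD : ∀ f, D f = ∑ j, pderiv j f • d j := by
    intro f
    have h := map_sum (Derivation.coeFnAddMonoidHom (R := R) (A := MvPolynomial ι R) (M := A))
      (fun j => (LinearMap.toSpanSingleton (MvPolynomial ι R) A (d j)).compDer (pderiv j))
      Finset.univ
    exact (congrFun h f).trans (Finset.sum_apply _ _ _)
  rw [← hD]
  congr 1
  refine derivation_ext fun i => ?_
  simp [hD, mkDerivation_X, pderiv_X, Pi.single_apply]

theorem Derivation.exists_lift_of_surjective {R S T M : Type*} [CommRing R] [CommRing S]
    [CommRing T] [Algebra R S] [Algebra R T] [Algebra S T] [IsScalarTower R S T]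
    [AddCommGroup M] [Module R M] [Module S M] [Module T M] [IsScalarTower S T M]
    [IsScalarTower R S M] [IsScalarTower R T M] (hsurj : Function.Surjective (algebraMap S T))
    (d : Derivation R S M) (h : ∀ s, algebraMap S T s = 0 → d s = 0) :
    ∃ d' : Derivation R T M, ∀ s, d' (algebraMap S T s) = d s := by
  have hd : ∀ s s', algebraMap S T s = algebraMap S T s' → d s = d s' := by
    intro s s' hs
    rw [← sub_eq_zero, ← map_sub]
    exact h _ (by rw [map_sub, hs, sub_self])
  have hg := Function.surjInv_eq hsurj
  refine ⟨Derivation.mk' ⟨⟨fun t => d (Function.surjInv hsurj t), ?_⟩, ?_⟩ ?_,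
    fun s => hd _ _ (hg _)⟩
  · intro a b
    rw [← map_add]
    exact hd _ _ (by rw [map_add, hg, hg, hg])
  · intro r a
    rw [RingHom.id_apply, ← map_smul]
    exact hd _ _ (by rw [Algebra.smul_def r (Function.surjInv hsurj a), map_mul, hg, hg,
      Algebra.smul_def, IsScalarTower.algebraMap_apply R S T])
  · intro a b
    change d _ = a • d _ + b • d _
    conv_rhs => rw [← hg a, ← hg b]
    rw [algebraMap_smul, algebraMap_smul, hg, hg, ← Derivation.leibniz]
    exact hd _ _ (by rw [map_mul, hg, hg, hg])

theorem exists_ne_zero_sum_mul_eq_zero {ι R L : Type*} [Fintype ι] [CommRing R] [Field L]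
    (φ : R →+* L) (ρ : Set (ι → R))
    (h : ∀ Δ : R, φ Δ ≠ 0 → ∃ ψ : R →+* ℝ, ψ Δ ≠ 0 ∧ ∃ v : ι → ℝ, v ≠ 0 ∧
      ∀ r ∈ ρ, ∑ j, v j * ψ (r j) = 0) :
    ∃ d : ι → L, d ≠ 0 ∧ ∀ r ∈ ρ, ∑ j, φ (r j) * d j = 0 := by
  classical
  by_cases hs : Submodule.span L (Set.range fun r : ρ => φ ∘ r.1) = ⊤
  · exfalso
    obtain ⟨κ, a, -, hspan, hli⟩ := exists_linearIndependent' L (fun r : ρ => φ ∘ r.1)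
    rw [hs] at hspan
    let b := Module.Basis.mk hli hspan.ge
    let e := b.indexEquiv (Pi.basisFun L ι)
    let A : Matrix ι ι R := fun i j => (a (e.symm i)).1 j
    have hA : IsUnit (φ.mapMatrix A) :=
      Matrix.linearIndependent_rows_iff_isUnit.1 (hli.comp _ e.symm.injective)
    have hdet : φ A.det ≠ 0 := by
      rw [RingHom.map_det]
      exact ((Matrix.isUnit_iff_isUnit_det _).1 hA).ne_zero
    obtain ⟨ψ, hψ, v, hv, hρ⟩ := h _ hdet
    rw [RingHom.map_det] at hψ
    refine hv (Matrix.eq_zero_of_mulVec_eq_zero hψ (funext fun i => ?_))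
    rw [Pi.zero_apply, ← hρ _ (a (e.symm i)).2]
    exact Finset.sum_congr rfl fun j _ => mul_comm _ _
  · obtain ⟨f, hf, hle⟩ := Submodule.exists_le_ker_of_lt_top _ (lt_top_iff_ne_top.2 hs)
    have hfs : ∀ u : ι → L, f u = ∑ i, u i * f (fun j => if i = j then 1 else 0) := fun u => by
      rw [LinearMap.pi_apply_eq_sum_univ f u]
      simp
    refine ⟨fun i => f (fun j => if i = j then 1 else 0), fun h0 => hf ?_, fun r hr => ?_⟩
    · ext u
      rw [LinearMap.comp_apply, hfs]
      have := fun i => congrFun h0 i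
      simp at this
      simp [this]
    · have := hle (Submodule.subset_span ⟨⟨r, hr⟩, rfl⟩)
      rw [LinearMap.mem_ker, hfs] at this
      exact this

theorem exists_tangent_vector {ι : Type*} [Fintype ι] (P : ι → MvPolynomial ι ℝ)
    {S : Set (ι → ℝ)} (hS : ∀ x ∈ S, ∀ i, x i ∈ Set.Ioo (0 : ℝ) 1)
    (hlog : ∀ x ∈ S, ∀ i, Real.log (x i / (1 - x i)) = MvPolynomial.eval x (P i))
    {p : ι → ℝ} (hp : p ∈ S) (hacc : AccPt p (Filter.principal S)) :
    ∃ v : ι → ℝ, v ≠ 0 ∧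
      (∀ f : MvPolynomial ι ℝ, (∀ x ∈ S, MvPolynomial.eval x f = 0) →
        ∑ j, v j * MvPolynomial.eval p (MvPolynomial.pderiv j f) = 0) ∧
      ∀ i, v i = p i * (1 - p i) * ∑ j, v j * MvPolynomial.eval p (MvPolynomial.pderiv j (P i)) := by
  obtain ⟨v, hv, hv0⟩ := tangentConeAt_nonempty_of_properSpace (𝕜 := ℝ) hacc
  refine ⟨v, hv0, fun f hf => ?_, fun i => ?_⟩
  · have h1 := (MvPolynomial.hasFDerivAt_eval f p).hasFDerivWithinAt (s := S)
    have h2 : HasFDerivWithinAt (fun x => MvPolynomial.eval x f) (0 : (ι → ℝ) →L[ℝ] ℝ) S p :=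
      (hasFDerivWithinAt_const (0 : ℝ) p S).congr hf (hf p hp)
    have h3 := h1.unique_on h2 hv
    simpa [mul_comm] using h3
  · have h1 := (MvPolynomial.hasFDerivAt_eval (P i) p).hasFDerivWithinAt (s := S)
    obtain ⟨h0, h0'⟩ := hS p hp i
    have h3 : 1 - p i ≠ 0 := by linarith
    have h2 : HasFDerivAt (fun x : ι → ℝ => Real.log (x i / (1 - x i)))
        ((p i * (1 - p i))⁻¹ • ContinuousLinearMap.proj (R := ℝ) (φ := fun _ : ι => ℝ) i) p := by
      have ha : HasDerivAt (fun s : ℝ => Real.log (s / (1 - s))) (p i * (1 - p i))⁻¹ (p i) := by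
        have hb : HasDerivAt (fun s : ℝ => s / (1 - s))
            ((1 * (1 - p i) - p i * (-1)) / (1 - p i) ^ 2) (p i) :=
          (hasDerivAt_id (p i)).div ((hasDerivAt_id (p i)).const_sub 1) h3
        refine (hb.log (div_ne_zero h0.ne' h3)).congr_deriv ?_
        have := h0.ne'
        field_simp
        ring
      have hproj : HasFDerivAt (fun x : ι → ℝ => x i)
        (ContinuousLinearMap.proj (R := ℝ) (φ := fun _ : ι => ℝ) i) p := hasFDerivAt_apply i p
      exact ha.comp_hasFDerivAt p hproj
    have h4 := h1.unique_on (h2.hasFDerivWithinAt.congr (fun x hx => (hlog x hx i).symm)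
      (hlog p hp i).symm) hv
    have h5 : ∑ j, v j * MvPolynomial.eval p (MvPolynomial.pderiv j (P i)) =
        (p i * (1 - p i))⁻¹ * v i := by
      simpa [mul_comm] using h4
    rw [h5, mul_inv_cancel_left₀ (mul_ne_zero h0.ne' h3)]

theorem exists_open_isPrime_vanishingIdeal {ι : Type*} [Finite ι] {S : Set (ι → ℝ)}
    (hS : S.Nonempty) : ∃ U : Set (ι → ℝ), IsOpen U ∧ (S ∩ U).Nonempty ∧
      (MvPolynomial.vanishingIdeal ℝ (S ∩ U)).IsPrime := by
  obtain ⟨_, ⟨U, ⟨hU, hne⟩, rfl⟩, hmax⟩ := set_has_maximal_iff_noetherian.2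
    (inferInstance : IsNoetherian (MvPolynomial ι ℝ) (MvPolynomial ι ℝ))
    ((fun U => MvPolynomial.vanishingIdeal ℝ (S ∩ U)) '' {U | IsOpen U ∧ (S ∩ U).Nonempty})
    ⟨_, Set.univ, ⟨isOpen_univ, by simpa using hS⟩, rfl⟩
  refine ⟨U, hU, hne, ⟨?_, ?_⟩⟩
  · rw [Ne, Ideal.eq_top_iff_one, MvPolynomial.mem_vanishingIdeal_iff]
    obtain ⟨x, hx⟩ := hne
    intro h
    simpa using h x hx
  · intro f g hfg
    by_contra! hcon
    obtain ⟨hf, hg⟩ := hcon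
    rw [MvPolynomial.mem_vanishingIdeal_iff] at hf hg hfg
    push Not at hf
    obtain ⟨x, hx, hfx⟩ := hf
    have hopen : IsOpen {y : ι → ℝ | MvPolynomial.aeval y f ≠ 0} := by
      have : Continuous fun y : ι → ℝ => MvPolynomial.aeval y f := MvPolynomial.continuous_eval f
      exact isOpen_ne.preimage this
    let U' := U ∩ {y | MvPolynomial.aeval y f ≠ 0}
    refine hmax _ ⟨U', ⟨hU.inter hopen, x, hx.1, hx.2, hfx⟩, rfl⟩ (lt_of_le_of_ne ?_ ?_)
    · exact MvPolynomial.vanishingIdeal_anti_mono (by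
        rintro y ⟨h1, h2, -⟩
        exact ⟨h1, h2⟩)
    · intro heq
      refine hg (MvPolynomial.mem_vanishingIdeal_iff.1 (?_ : g ∈ MvPolynomial.vanishingIdeal ℝ (S ∩ U)))
      refine (show MvPolynomial.vanishingIdeal ℝ (S ∩ U) =
        MvPolynomial.vanishingIdeal ℝ (S ∩ U') from heq) ▸ ?_
      rw [MvPolynomial.mem_vanishingIdeal_iff]
      rintro y ⟨h1, h2, h3⟩
      have := hfg y ⟨h1, h2⟩
      rw [map_mul] at this
      exact (mul_eq_zero.1 this).resolve_left h3

theorem eq_zero_of_sum_pderiv_eq_zero {k ι A L : Type*} [Field k] [CharZero k] [Fintype ι]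
    [CommRing A] [Algebra (MvPolynomial ι k) A] [Algebra k A]
    [IsScalarTower k (MvPolynomial ι k) A] [Field L] [Algebra A L] [IsFractionRing A L]
    [Algebra (MvPolynomial ι k) L] [IsScalarTower (MvPolynomial ι k) A L] [Algebra k L]
    [IsScalarTower k A L] [IsScalarTower k (MvPolynomial ι k) L]
    (hsurj : Function.Surjective (algebraMap (MvPolynomial ι k) A)) (P : ι → MvPolynomial ι k)
    (φ : MvPolynomial ι k →+* L) (hφ : φ = algebraMap (MvPolynomial ι k) L)
    (q : ι → L) (hq : ∀ i, q i = φ (MvPolynomial.X i)) (d : ι → L)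
    (hd : ∀ f, φ f = 0 → ∑ j, φ (MvPolynomial.pderiv j f) * d j = 0)
    (hdP : ∀ i, d i = q i * (1 - q i) * ∑ j, φ (MvPolynomial.pderiv j (P i)) * d j)
    (hq0 : ∀ i, q i ≠ 0) (hq1 : ∀ i, 1 - q i ≠ 0) : d = 0 := by
  classical
  let δ := MvPolynomial.mkDerivation k d
  have hδ : ∀ f, δ f = ∑ j, φ (MvPolynomial.pderiv j f) * d j := by
    intro f
    simp only [δ, MvPolynomial.mkDerivation_eq_sum, Algebra.smul_def, hφ]
  obtain ⟨δ', hδ'⟩ := Derivation.exists_lift_of_surjective (T := A) hsurj δ (by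
    intro f hf
    rw [hδ]
    refine hd f ?_
    rw [hφ, IsScalarTower.algebraMap_apply _ A L, hf, map_zero])
  have : Algebra.FormallyEtale A L := Algebra.FormallyEtale.of_isLocalization (nonZeroDivisors A)
  obtain ⟨D, hD⟩ := Derivation.exists_extension_of_formallyEtale (T := L) δ'
  have hDφ : ∀ f, D (φ f) = ∑ j, φ (MvPolynomial.pderiv j f) * d j := by
    intro f
    rw [← hδ, ← hδ', ← hD, hφ, ← IsScalarTower.algebraMap_apply]
  have hDq : ∀ i, D (q i) = d i := by
    intro i
    simp [hq, hDφ, MvPolynomial.pderiv_X, Pi.single_apply, apply_ite φ]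
  have hDP : ∀ i, d i = q i * (1 - q i) * D (φ (P i)) := by
    intro i
    rw [hDφ]
    exact hdP i
  let z : ι → L := fun i => q i / (1 - q i)
  have htop : IntermediateField.adjoin k (Set.range z) = ⊤ := by
    have hzm : ∀ i, z i ∈ IntermediateField.adjoin k (Set.range z) := fun i =>
      IntermediateField.subset_adjoin _ _ ⟨i, rfl⟩
    have hqz : ∀ i, q i = z i / (1 + z i) := by
      intro i
      have h1 := hq1 i
      have h2 : 1 + z i = (1 - q i)⁻¹ := by
        simp only [z]
        field_simp
        ring
      rw [h2]
      simp only [z]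
      field_simp
    have hqm : ∀ i, q i ∈ IntermediateField.adjoin k (Set.range z) := fun i => by
      rw [hqz]
      exact div_mem (hzm i) (add_mem (one_mem _) (hzm i))
    have hφm : ∀ f, φ f ∈ IntermediateField.adjoin k (Set.range z) := by
      intro f
      induction f using MvPolynomial.induction_on with
      | C a =>
        have : φ (MvPolynomial.C a) = algebraMap k L a :=
          by
          rw [hφ, IsScalarTower.algebraMap_apply k (MvPolynomial ι k) L a]; rfl
        rw [this]
        exact IntermediateField.algebraMap_mem _ a
      | add f g hf hg => rw [map_add]; exact add_mem hf hg
      | mul_X f i hf => rw [map_mul]; exact mul_mem hf (hq i ▸ hqm i)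
    rw [eq_top_iff]
    intro a _
    obtain ⟨b, c, -, rfl⟩ := IsFractionRing.div_surjective (A := A) a
    obtain ⟨b, rfl⟩ := hsurj b
    obtain ⟨c, rfl⟩ := hsurj c
    rw [← IsScalarTower.algebraMap_apply, ← IsScalarTower.algebraMap_apply, ← hφ]
    exact div_mem (hφm b) (hφm c)
  have hDz : ∀ i, D (z i) = z i * D (φ (P i)) := by
    intro i
    have h1 := hq1 i
    have h2 := hq0 i
    simp only [z, Derivation.leibniz_div, map_sub, Derivation.map_one_eq_zero, hDq, smul_eq_mul]
    rw [hDP i]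
    field_simp
    ring
  have hzero : D = 0 := D.eq_zero_of_exponential z (fun i => φ (P i))
    (fun i => div_ne_zero (hq0 i) (hq1 i)) htop hDz
  ext i
  rw [← hDq, hzero]
  rfl

/-- A set of points of the open cube at which every logit agrees with a polynomial cannot be
nonempty and dense in itself. -/
theorem eq_empty_of_logit_eq_eval {ι : Type*} [Fintype ι] (P : ι → MvPolynomial ι ℝ)
    {S : Set (ι → ℝ)} (hS : ∀ x ∈ S, ∀ i, x i ∈ Set.Ioo (0 : ℝ) 1)
    (hlog : ∀ x ∈ S, ∀ i, Real.log (x i / (1 - x i)) = MvPolynomial.eval x (P i))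
    (hacc : ∀ x ∈ S, AccPt x (Filter.principal S)) : S = ∅ := by
  classical
  by_contra hne
  obtain ⟨U, hU, ⟨x₀, hx₀⟩, hprime⟩ :=
    exists_open_isPrime_vanishingIdeal (Set.nonempty_iff_ne_empty.2 hne)
  let T := S ∩ U
  have haccT : ∀ x ∈ T, AccPt x (Filter.principal T) := by
    intro x hx
    rw [accPt_iff_nhds]
    intro V hV
    obtain ⟨y, hy, hyx⟩ := accPt_iff_nhds.1 (hacc x hx.1) (V ∩ U)
      (Filter.inter_mem hV (hU.mem_nhds hx.2))
    exact ⟨y, ⟨hy.1.1, hy.2, hy.1.2⟩, hyx⟩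
  let I := MvPolynomial.vanishingIdeal ℝ T
  have hprime : I.IsPrime := hprime
  let A := MvPolynomial ι ℝ ⧸ I
  let L := FractionRing A
  let φ := algebraMap (MvPolynomial ι ℝ) L
  have hφ : ∀ f, φ f = 0 ↔ ∀ x ∈ T, MvPolynomial.eval x f = 0 := by
    intro f
    have : φ f = algebraMap A L (algebraMap _ A f) := IsScalarTower.algebraMap_apply _ _ _ _
    rw [this, map_eq_zero_iff _ (IsFractionRing.injective A L)]
    change Ideal.Quotient.mk I f = 0 ↔ _
    rw [Ideal.Quotient.eq_zero_iff_mem, MvPolynomial.mem_vanishingIdeal_iff]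
    rfl
  let ρ : Set (ι → MvPolynomial ι ℝ) := {r | ∃ f, φ f = 0 ∧ r = fun j => MvPolynomial.pderiv j f} ∪
    Set.range fun i j => (if i = j then 1 else 0) -
      MvPolynomial.X i * (1 - MvPolynomial.X i) * MvPolynomial.pderiv j (P i)
  obtain ⟨d, hd0, hd⟩ := exists_ne_zero_sum_mul_eq_zero φ ρ (by
    intro Δ hΔ
    rw [Ne, hφ] at hΔ
    push Not at hΔ
    obtain ⟨p, hp, hpΔ⟩ := hΔ
    obtain ⟨v, hv, h1, h2⟩ := exists_tangent_vector P (fun x hx => hS x hx.1)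
      (fun x hx => hlog x hx.1) hp (haccT p hp)
    refine ⟨MvPolynomial.eval p, hpΔ, v, hv, ?_⟩
    rintro r (⟨f, hf, rfl⟩ | ⟨i, rfl⟩)
    · exact h1 f ((hφ f).1 hf)
    · simp only [map_sub, map_mul, MvPolynomial.eval_X, map_one, apply_ite (MvPolynomial.eval p),
        map_zero, mul_sub, Finset.sum_sub_distrib, mul_ite, mul_one, mul_zero, Finset.sum_ite_eq,
        Finset.mem_univ, if_true]
      rw [sub_eq_zero]
      conv_lhs => rw [h2 i]
      rw [Finset.mul_sum]
      exact Finset.sum_congr rfl fun _ _ => by ring)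
  let q : ι → L := fun i => φ (MvPolynomial.X i)
  have hq0 : ∀ i, q i ≠ 0 := by
    intro i h
    have := (hφ _).1 h x₀ hx₀
    rw [MvPolynomial.eval_X] at this
    exact (hS x₀ hx₀.1 i).1.ne' this
  have hq1 : ∀ i, 1 - q i ≠ 0 := by
    intro i h
    have := (hφ (1 - MvPolynomial.X i)).1 (by rw [map_sub, map_one]; exact h) x₀ hx₀
    rw [map_sub, map_one, MvPolynomial.eval_X, sub_eq_zero] at this
    exact (hS x₀ hx₀.1 i).2.ne' this
  refine hd0 (eq_zero_of_sum_pderiv_eq_zero (A := A) Ideal.Quotient.mk_surjective P φ rfl q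
    (fun _ => rfl) d (fun f hf => hd _ (Or.inl ⟨f, hf, rfl⟩)) (fun i => ?_) hq0 hq1)
  have := hd _ (Or.inr ⟨i, rfl⟩)
  simp only [map_sub, map_mul, map_one, apply_ite φ, map_zero, sub_mul, Finset.sum_sub_distrib,
    ite_mul, one_mul, zero_mul, Finset.sum_ite_eq, Finset.mem_univ, if_true] at this
  rw [sub_eq_zero.1 this, Finset.mul_sum]
  exact Finset.sum_congr rfl fun _ _ => mul_assoc _ _ _

end ZariskiClosure

section MeanFieldConvergence

open Topology Filter

theorem accPt_mapClusterPt_of_ne {X : Type*} [MetricSpace X] {K : Set X} (hK : IsCompact K)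
    {u : ℕ → X} (hu : ∀ n, u n ∈ K)
    (hstep : Tendsto (fun n => dist (u (n + 1)) (u n)) atTop (𝓝 0)) {a b : X}
    (ha : MapClusterPt a atTop u) (hb : MapClusterPt b atTop u) (hab : a ≠ b) :
    AccPt a (𝓟 {x | MapClusterPt x atTop u}) := by
  rw [accPt_iff_nhds]
  intro U hU
  obtain ⟨δ, hδ, hδU⟩ := Metric.nhds_basis_closedBall.mem_iff.1 hU
  have hd := dist_pos.2 hab
  obtain ⟨ε, hε, hεδ, hεd⟩ : ∃ ε > 0, ε ≤ δ ∧ ε < dist a b :=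
    ⟨min δ (dist a b / 2), by positivity, min_le_left _ _,
      (min_le_right _ _).trans_lt (by linarith)⟩
  let T : Set X := {x | ε / 2 ≤ dist x a ∧ dist x a ≤ ε}
  have hT : IsClosed T := (isClosed_le continuous_const (continuous_id.dist continuous_const)).inter
    (isClosed_le (continuous_id.dist continuous_const) continuous_const)
  have hfreq : ∃ᶠ n in atTop, u n ∈ K ∩ T := by
    intro hnot
    obtain ⟨n₀, hn₀⟩ := eventually_atTop.1 (hnot.and (hstep.eventually_lt_const (half_pos hε)))
    obtain ⟨n₁, hn₁, hn₁a⟩ := frequently_atTop.1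
      (ha.frequently (Metric.ball_mem_nhds a (half_pos hε))) n₀
    have hall : ∀ n ≥ n₁, dist (u n) a < ε / 2 := by
      intro n hn
      induction n, hn using Nat.le_induction with
      | base => exact hn₁a
      | succ n hn ih =>
        have h1 := (hn₀ n (hn₁.trans hn)).2
        have h2 := (hn₀ (n + 1) (hn₁.trans (hn.trans n.le_succ))).1
        by_contra! h3
        exact h2 ⟨hu _, h3, by linarith [dist_triangle (u (n + 1)) (u n) a]⟩
    obtain ⟨n, hn, hnb⟩ := frequently_atTop.1
      (hb.frequently (Metric.ball_mem_nhds b (half_pos hε))) n₁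
    have h1 := hall n hn
    have h2 : dist (u n) b < ε / 2 := hnb
    linarith [dist_triangle_left a b (u n)]
  obtain ⟨y, hy, hyc⟩ := (hK.inter_right hT).exists_mapClusterPt_of_frequently hfreq
  refine ⟨y, ⟨hδU (hy.2.2.trans hεδ), hyc⟩, ?_⟩
  rintro rfl
  have := hy.2.1
  rw [dist_self] at this
  linarith

/-- The Kullback–Leibler divergence between Bernoulli distributions. -/
noncomputable def bernoulliKL (q q₀ : ℝ) : ℝ :=
  q * Real.log (q / q₀) + (1 - q) * Real.log ((1 - q) / (1 - q₀))

/-- The logit function. -/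
noncomputable def logit (q : ℝ) : ℝ := Real.log (q / (1 - q))

theorem logit_eq_sub {q : ℝ} (hq : q ∈ Set.Ioo (0 : ℝ) 1) :
    logit q = Real.log q - Real.log (1 - q) :=
  Real.log_div hq.1.ne' (sub_pos.2 hq.2).ne'

theorem bernoulliKL_eq {q q₀ : ℝ} (hq : q ∈ Set.Ioo (0 : ℝ) 1) (hq₀ : q₀ ∈ Set.Ioo (0 : ℝ) 1) :
    bernoulliKL q q₀ = q * (Real.log q - Real.log q₀) +
      (1 - q) * (Real.log (1 - q) - Real.log (1 - q₀)) := by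
  rw [bernoulliKL, Real.log_div hq.1.ne' hq₀.1.ne',
    Real.log_div (sub_pos.2 hq.2).ne' (sub_pos.2 hq₀.2).ne']

theorem bernoulliKL_self {q : ℝ} (hq : q ∈ Set.Ioo (0 : ℝ) 1) : bernoulliKL q q = 0 := by
  simp [bernoulliKL_eq hq hq]

theorem hasDerivAt_bernoulliKL {q q₀ : ℝ} (hq : q ∈ Set.Ioo (0 : ℝ) 1)
    (hq₀ : q₀ ∈ Set.Ioo (0 : ℝ) 1) :
    HasDerivAt (fun s => bernoulliKL s q₀) (logit q - logit q₀) q := by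
  have h1 := hq.1.ne'
  have h2 : 1 - q ≠ 0 := (sub_pos.2 hq.2).ne'
  have h3 : HasDerivAt (fun s : ℝ => 1 - s) (-1) q := (hasDerivAt_id q).const_sub 1
  have h : HasDerivAt (fun s => s * (Real.log s - Real.log q₀) +
      (1 - s) * (Real.log (1 - s) - Real.log (1 - q₀)))
      ((1 * (Real.log q - Real.log q₀) + q * q⁻¹) +
        ((-1) * (Real.log (1 - q) - Real.log (1 - q₀)) + (1 - q) * ((-1) / (1 - q)))) q :=
    ((hasDerivAt_id q).mul ((Real.hasDerivAt_log h1).sub_const _)).add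
      (h3.mul ((h3.log h2).sub_const _))
  refine (h.congr_of_eventuallyEq ?_).congr_deriv ?_
  · filter_upwards [Ioo_mem_nhds hq.1 hq.2] with s hs using bernoulliKL_eq hs hq₀
  · rw [logit_eq_sub hq, logit_eq_sub hq₀]
    field_simp
    ring

theorem sub_sqrt_le_mul_log {q q₀ : ℝ} (hq : 0 < q) (hq₀ : 0 < q₀) :
    2 * (q - √q * √q₀) ≤ q * Real.log (q / q₀) := by
  have h1 : 0 < √q := Real.sqrt_pos.2 hq
  have h2 : 0 < √q₀ := Real.sqrt_pos.2 hq₀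
  have h3 := Real.one_sub_inv_le_log_of_pos (div_pos h1 h2)
  have h4 : Real.log (q / q₀) = 2 * Real.log (√q / √q₀) := by
    rw [← Real.sqrt_div hq.le, Real.log_sqrt (div_pos hq hq₀).le]
    ring
  rw [h4]
  have h5 : q * (√q / √q₀)⁻¹ = √q * √q₀ := by
    rw [inv_div]
    field_simp
    rw [Real.sq_sqrt hq.le]
  nlinarith [mul_le_mul_of_nonneg_left h3 hq.le]

theorem sq_sub_le_bernoulliKL {q q₀ : ℝ} (hq : q ∈ Set.Ioo (0 : ℝ) 1)
    (hq₀ : q₀ ∈ Set.Ioo (0 : ℝ) 1) : (q - q₀) ^ 2 ≤ 4 * bernoulliKL q q₀ := by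
  have h1 := sub_sqrt_le_mul_log hq.1 hq₀.1
  have h2 := sub_sqrt_le_mul_log (sub_pos.2 hq.2) (sub_pos.2 hq₀.2)
  have e1 := Real.sq_sqrt hq.1.le
  have e2 := Real.sq_sqrt hq₀.1.le
  have e3 := Real.sq_sqrt (sub_pos.2 hq.2).le
  have e4 := Real.sq_sqrt (sub_pos.2 hq₀.2).le
  have l1 : √q ≤ 1 := Real.sqrt_le_one.2 hq.2.le
  have l2 : √q₀ ≤ 1 := Real.sqrt_le_one.2 hq₀.2.le
  have p1 := Real.sqrt_nonneg q
  have p2 := Real.sqrt_nonneg q₀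
  have h3 : (√q - √q₀) ^ 2 ≤ bernoulliKL q q₀ := by
    rw [bernoulliKL]
    nlinarith [sq_nonneg (√(1 - q) - √(1 - q₀))]
  have h4 : (q - q₀) ^ 2 = (√q - √q₀) ^ 2 * (√q + √q₀) ^ 2 := by
    rw [← mul_pow]
    congr 1
    nlinarith
  rw [h4]
  have h5 : (√q + √q₀) ^ 2 ≤ 4 := by nlinarith
  nlinarith [sq_nonneg (√q - √q₀)]

theorem bernoulliKL_nonneg {q q₀ : ℝ} (hq : q ∈ Set.Ioo (0 : ℝ) 1)
    (hq₀ : q₀ ∈ Set.Ioo (0 : ℝ) 1) : 0 ≤ bernoulliKL q q₀ := by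
  nlinarith [sq_sub_le_bernoulliKL hq hq₀, sq_nonneg (q - q₀)]

theorem exp_logit {q : ℝ} (hq : q ∈ Set.Ioo (0 : ℝ) 1) : Real.exp (logit q) = q / (1 - q) :=
  Real.exp_log (div_pos hq.1 (sub_pos.2 hq.2))

theorem mem_Icc_of_logit_mem_Icc {q m M : ℝ} (hq : q ∈ Set.Ioo (0 : ℝ) 1)
    (h : logit q ∈ Set.Icc m M) :
    q ∈ Set.Icc (Real.exp m / (1 + Real.exp m)) (Real.exp M / (1 + Real.exp M)) := by
  have h1 := Real.exp_le_exp.2 h.1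
  have h2 := Real.exp_le_exp.2 h.2
  have h3 := Real.exp_pos m
  have h4 := Real.exp_pos M
  have h5 := sub_pos.2 hq.2
  rw [exp_logit hq, le_div_iff₀ h5] at h1
  rw [exp_logit hq, div_le_iff₀ h5] at h2
  constructor
  · rw [div_le_iff₀ (by positivity)]
    linarith
  · rw [le_div_iff₀ (by positivity)]
    linarith

theorem continuousAt_logit {q : ℝ} (hq : q ∈ Set.Ioo (0 : ℝ) 1) : ContinuousAt logit q :=
  ContinuousAt.log (continuousAt_id.div (continuousAt_const.sub continuousAt_id)
    (sub_pos.2 hq.2).ne') (div_ne_zero hq.1.ne' (sub_pos.2 hq.2).ne')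

section MeanField

variable {ι : Type*} [Fintype ι] [DecidableEq ι]

/-- The expectation of `Ψ` under the product Bernoulli distribution with parameters `q`. -/
noncomputable def meanEnergy (Ψ : (ι → Bool) → ℝ) (q : ι → ℝ) : ℝ :=
  ∑ x : ι → Bool, Ψ x * ∏ j, (if x j then q j else 1 - q j)

/-- The partial derivatives of `meanEnergy`. -/
noncomputable def meanEnergyDeriv (Ψ : (ι → Bool) → ℝ) (i : ι) (q : ι → ℝ) : ℝ :=
  meanEnergy Ψ (Function.update q i 1) - meanEnergy Ψ (Function.update q i 0)

theorem meanEnergy_update (Ψ : (ι → Bool) → ℝ) (i : ι) (q : ι → ℝ) (s : ℝ) :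
    meanEnergy Ψ (Function.update q i s) =
      meanEnergy Ψ (Function.update q i 0) + s * meanEnergyDeriv Ψ i q := by
  have h : ∀ (x : ι → Bool) (s : ℝ), ∏ j, (if x j then Function.update q i s j
      else 1 - Function.update q i s j) =
      (if x i then s else 1 - s) * ∏ j ∈ Finset.univ.erase i, (if x j then q j else 1 - q j) := by
    intro x s
    rw [← Finset.mul_prod_erase _ _ (Finset.mem_univ i), Function.update_self]
    congr 1
    refine Finset.prod_congr rfl fun j hj => ?_
    rw [Function.update_of_ne (Finset.ne_of_mem_erase hj)]
  simp only [meanEnergyDeriv, meanEnergy, h, ← Finset.sum_sub_distrib, Finset.mul_sum,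
    ← Finset.sum_add_distrib]
  refine Finset.sum_congr rfl fun x _ => ?_
  split_ifs <;> ring

theorem abs_meanEnergy_le (Ψ : (ι → Bool) → ℝ) {q : ι → ℝ} (hq : ∀ i, q i ∈ Set.Icc (0 : ℝ) 1) :
    |meanEnergy Ψ q| ≤ ∑ x, |Ψ x| := by
  refine (Finset.abs_sum_le_sum_abs _ _).trans (Finset.sum_le_sum fun x _ => ?_)
  rw [abs_mul, Finset.abs_prod]
  refine mul_le_of_le_one_right (abs_nonneg _) (Finset.prod_le_one (fun _ _ => abs_nonneg _) ?_)
  intro j _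
  have := hq j
  split_ifs <;> rw [abs_le] <;> constructor <;> linarith [this.1, this.2]

theorem abs_meanEnergyDeriv_le (Ψ : (ι → Bool) → ℝ) (i : ι) {q : ι → ℝ}
    (hq : ∀ i, q i ∈ Set.Icc (0 : ℝ) 1) : |meanEnergyDeriv Ψ i q| ≤ 2 * ∑ x, |Ψ x| := by
  have h : ∀ s ∈ Set.Icc (0 : ℝ) 1, |meanEnergy Ψ (Function.update q i s)| ≤ ∑ x, |Ψ x| := by
    intro s hs
    refine abs_meanEnergy_le Ψ fun j => ?_
    by_cases hj : j = i
    · subst hj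
      simpa using hs
    · rw [Function.update_of_ne hj]
      exact hq j
  calc |meanEnergyDeriv Ψ i q| ≤ _ := abs_sub _ _
    _ ≤ _ := by linarith [h 1 (by simp), h 0 (by simp)]

theorem exists_eval_eq_meanEnergyDeriv (Ψ : (ι → Bool) → ℝ) (i : ι) :
    ∃ P : MvPolynomial ι ℝ, ∀ q, MvPolynomial.eval q P = meanEnergyDeriv Ψ i q := by
  have h : ∀ s : ℝ, ∃ P : MvPolynomial ι ℝ,
      ∀ q, MvPolynomial.eval q P = meanEnergy Ψ (Function.update q i s) := by
    intro s
    let X' : ι → MvPolynomial ι ℝ := Function.update MvPolynomial.X i (MvPolynomial.C s)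
    refine ⟨∑ x : ι → Bool, MvPolynomial.C (Ψ x) * ∏ j, (if x j then X' j else 1 - X' j),
      fun q => ?_⟩
    have hX : ∀ j, MvPolynomial.eval q (X' j) = Function.update q i s j := by
      intro j
      by_cases hj : j = i
      · subst hj
        simp [X']
      · simp [X', Function.update_of_ne hj]
    simp [meanEnergy, map_sum, map_prod, apply_ite (MvPolynomial.eval q), hX]
  obtain ⟨P₁, h₁⟩ := h 1
  obtain ⟨P₀, h₀⟩ := h 0
  exact ⟨P₁ - P₀, fun q => by rw [map_sub, h₁, h₀, meanEnergyDeriv]⟩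

/-- The mean-field Kullback–Leibler objective. -/
noncomputable def meanFieldObjective (Ψ : (ι → Bool) → ℝ) (p q : ι → ℝ) : ℝ :=
  meanEnergy Ψ q + ∑ i, bernoulliKL (q i) (p i)

theorem hasDerivAt_meanFieldObjective (Ψ : (ι → Bool) → ℝ) {p : ι → ℝ}
    (hp : ∀ i, p i ∈ Set.Ioo (0 : ℝ) 1) (q : ι → ℝ) (i : ι) {s : ℝ}
    (hs : s ∈ Set.Ioo (0 : ℝ) 1) :
    HasDerivAt (fun s => meanFieldObjective Ψ p (Function.update q i s))
      (meanEnergyDeriv Ψ i q + (logit s - logit (p i))) s := by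
  have h : ∀ s, meanFieldObjective Ψ p (Function.update q i s) =
      (meanEnergy Ψ (Function.update q i 0) + s * meanEnergyDeriv Ψ i q) +
        (bernoulliKL s (p i) + ∑ j ∈ Finset.univ.erase i, bernoulliKL (q j) (p j)) := by
    intro s
    rw [meanFieldObjective, meanEnergy_update,
      ← Finset.add_sum_erase _ _ (Finset.mem_univ i), Function.update_self]
    congr 2
    refine Finset.sum_congr rfl fun j hj => ?_
    rw [Function.update_of_ne (Finset.ne_of_mem_erase hj)]
  simp only [h]
  refine HasDerivAt.add ?_ ((hasDerivAt_bernoulliKL hs (hp i)).add_const _)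
  simpa using ((hasDerivAt_id s).mul_const (meanEnergyDeriv Ψ i q)).const_add
    (meanEnergy Ψ (Function.update q i 0))

theorem neg_sum_le_meanFieldObjective (Ψ : (ι → Bool) → ℝ) {p q : ι → ℝ}
    (hp : ∀ i, p i ∈ Set.Ioo (0 : ℝ) 1) (hq : ∀ i, q i ∈ Set.Ioo (0 : ℝ) 1) :
    -∑ x, |Ψ x| ≤ meanFieldObjective Ψ p q := by
  have h1 := (abs_le.1 (abs_meanEnergy_le Ψ fun i => Set.Ioo_subset_Icc_self (hq i))).1
  have h2 : 0 ≤ ∑ i, bernoulliKL (q i) (p i) :=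
    Finset.sum_nonneg fun i _ => bernoulliKL_nonneg (hq i) (hp i)
  rw [meanFieldObjective]
  linarith

end MeanField

section ProximalSweep

variable {N : ℕ}

/-- The state reached during sweep `t` once the coordinates below `k` have been updated. -/
def sweepState (Q : ℕ → Fin N → ℝ) (t k : ℕ) : Fin N → ℝ :=
  fun j => if (j : ℕ) < k then Q (t + 1) j else Q t j

/-- `Q` is obtained by cyclic proximal minimization of the mean-field objective. -/
structure IsProximalSequence (Ψ : (Fin N → Bool) → ℝ) (p : Fin N → ℝ) (lam : ℝ)
    (Q : ℕ → Fin N → ℝ) : Prop where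
  lam_pos : 0 < lam
  prior_mem : ∀ i, p i ∈ Set.Ioo (0 : ℝ) 1
  mem : ∀ t i, Q t i ∈ Set.Ioo (0 : ℝ) 1
  init : Q 0 = p
  step : ∀ (t : ℕ) (i : Fin N), ∀ q ∈ Set.Ioo (0 : ℝ) 1,
    meanFieldObjective Ψ p (Function.update (sweepState Q t i) i (Q (t + 1) i)) +
        lam * bernoulliKL (Q (t + 1) i) (Q t i) ≤
      meanFieldObjective Ψ p (Function.update (sweepState Q t i) i q) + lam * bernoulliKL q (Q t i)

theorem update_sweepState (Q : ℕ → Fin N → ℝ) (t : ℕ) (i : Fin N) :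
    Function.update (sweepState Q t i) i (Q (t + 1) i) = sweepState Q t (i + 1) := by
  ext j
  rcases lt_trichotomy j i with h | rfl | h
  · have h' : (j : ℕ) < i := h
    simp [sweepState, Function.update_of_ne h.ne, h', Nat.lt_succ_of_lt h']
  · simp [sweepState]
  · have h' : ¬ (j : ℕ) < i := not_lt.2 h.le
    have h'' : ¬ (j : ℕ) < i + 1 := not_lt.2 h
    simp [sweepState, Function.update_of_ne h.ne', h', h'']

theorem update_sweepState_eq_self (Q : ℕ → Fin N → ℝ) (t : ℕ) (i : Fin N) :
    Function.update (sweepState Q t i) i (Q t i) = sweepState Q t i := by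
  rw [Function.update_eq_self_iff]
  simp [sweepState]

namespace IsProximalSequence

variable {Ψ : (Fin N → Bool) → ℝ} {p : Fin N → ℝ} {lam : ℝ} {Q : ℕ → Fin N → ℝ}

theorem sweepState_mem (hQ : IsProximalSequence Ψ p lam Q) (t k : ℕ) (j : Fin N) :
    sweepState Q t k j ∈ Set.Ioo (0 : ℝ) 1 := by
  rw [sweepState]
  split_ifs <;> exact hQ.mem _ _

theorem first_order (hQ : IsProximalSequence Ψ p lam Q) (t : ℕ) (i : Fin N) :
    meanEnergyDeriv Ψ i (sweepState Q t i) + (logit (Q (t + 1) i) - logit (p i)) +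
      lam * (logit (Q (t + 1) i) - logit (Q t i)) = 0 := by
  have h1 := (hasDerivAt_meanFieldObjective Ψ hQ.prior_mem (sweepState Q t i) i
    (hQ.mem (t + 1) i)).add ((hasDerivAt_bernoulliKL (hQ.mem (t + 1) i) (hQ.mem t i)).const_mul lam)
  refine IsLocalMin.hasDerivAt_eq_zero ?_ h1
  filter_upwards [Ioo_mem_nhds (hQ.mem (t + 1) i).1 (hQ.mem (t + 1) i).2] with q hq
  exact hQ.step t i q hq

theorem abs_logit_sub_le (hQ : IsProximalSequence Ψ p lam Q) (t : ℕ) (i : Fin N) :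
    |logit (Q t i) - logit (p i)| ≤ 2 * ∑ x, |Ψ x| := by
  induction t with
  | zero =>
    rw [hQ.init, sub_self, abs_zero]
    positivity
  | succ t ih =>
    have h1 := hQ.first_order t i
    have h2 := abs_le.1 (abs_meanEnergyDeriv_le Ψ i fun j =>
      Set.Ioo_subset_Icc_self (hQ.sweepState_mem t i j))
    have hl := hQ.lam_pos
    rw [abs_le] at ih ⊢
    have h3 := mul_le_mul_of_nonneg_left ih.1 hl.le
    have h4 := mul_le_mul_of_nonneg_left ih.2 hl.le
    have h5 : 0 < 1 + lam := by linarith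
    constructor
    · refine le_of_mul_le_mul_left ?_ h5
      linarith
    · refine le_of_mul_le_mul_left ?_ h5
      linarith

theorem exists_isCompact (hQ : IsProximalSequence Ψ p lam Q) :
    ∃ K : Set (Fin N → ℝ), IsCompact K ∧ (∀ t, Q t ∈ K) ∧
      ∀ q ∈ K, ∀ i, q i ∈ Set.Ioo (0 : ℝ) 1 := by
  let B := 2 * ∑ x, |Ψ x|
  let σ : ℝ → ℝ := fun m => Real.exp m / (1 + Real.exp m)
  have hσ : ∀ m, σ m ∈ Set.Ioo (0 : ℝ) 1 := fun m => by
    have := Real.exp_pos m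
    exact ⟨by positivity, (div_lt_one (by positivity)).2 (by linarith)⟩
  refine ⟨Set.Icc (fun i => σ (logit (p i) - B)) (fun i => σ (logit (p i) + B)), isCompact_Icc,
    fun t => ?_, fun q hq i => ⟨(hσ _).1.trans_le (hq.1 i), (hq.2 i).trans_lt (hσ _).2⟩⟩
  have h : ∀ i, Q t i ∈ Set.Icc (σ (logit (p i) - B)) (σ (logit (p i) + B)) := fun i => by
    have := abs_le.1 (hQ.abs_logit_sub_le t i)
    exact mem_Icc_of_logit_mem_Icc (hQ.mem t i) ⟨by linarith [this.1], by linarith [this.2]⟩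
  exact ⟨fun i => (h i).1, fun i => (h i).2⟩

theorem objective_add_le (hQ : IsProximalSequence Ψ p lam Q) (t : ℕ) :
    meanFieldObjective Ψ p (Q (t + 1)) + lam * ∑ i, bernoulliKL (Q (t + 1) i) (Q t i) ≤
      meanFieldObjective Ψ p (Q t) := by
  have h : ∀ i : Fin N, lam * bernoulliKL (Q (t + 1) i) (Q t i) ≤
      meanFieldObjective Ψ p (sweepState Q t i) -
        meanFieldObjective Ψ p (sweepState Q t (i + 1)) := by
    intro i
    have := hQ.step t i (Q t i) (hQ.mem t i)
    rw [update_sweepState, update_sweepState_eq_self, bernoulliKL_self (hQ.mem t i)] at this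
    linarith
  have h0 : sweepState Q t 0 = Q t := by ext; simp [sweepState]
  have hN : sweepState Q t N = Q (t + 1) := by ext; simp [sweepState]
  have hs := Finset.sum_le_sum fun i (_ : i ∈ Finset.univ) => h i
  rw [Fin.sum_univ_eq_sum_range (fun k => meanFieldObjective Ψ p (sweepState Q t k) -
    meanFieldObjective Ψ p (sweepState Q t (k + 1))), Finset.sum_range_sub', h0, hN,
    ← Finset.mul_sum] at hs
  linarith

theorem tendsto_sub (hQ : IsProximalSequence Ψ p lam Q) (i : Fin N) :
    Tendsto (fun t => Q (t + 1) i - Q t i) atTop (𝓝 0) := by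
  let g := fun t => meanFieldObjective Ψ p (Q t)
  have hl := hQ.lam_pos
  have hKL : ∀ t i, 0 ≤ bernoulliKL (Q (t + 1) i) (Q t i) := fun t i =>
    bernoulliKL_nonneg (hQ.mem _ _) (hQ.mem _ _)
  have hanti : Antitone g := antitone_nat_of_succ_le fun t => by
    have := hQ.objective_add_le t
    have := mul_nonneg hl.le (Finset.sum_nonneg fun i (_ : i ∈ Finset.univ) => hKL t i)
    simp only [g]
    linarith
  have hbdd : BddBelow (Set.range g) := ⟨-∑ x, |Ψ x|, by
    rintro _ ⟨t, rfl⟩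
    exact neg_sum_le_meanFieldObjective Ψ hQ.prior_mem (hQ.mem t)⟩
  have hlim := tendsto_atTop_ciInf hanti hbdd
  have hdiff : Tendsto (fun t => 4 / lam * (g t - g (t + 1))) atTop (𝓝 0) := by
    simpa using (hlim.sub (hlim.comp (tendsto_add_atTop_nat 1))).const_mul (4 / lam)
  have hsq : Tendsto (fun t => (Q (t + 1) i - Q t i) ^ 2) atTop (𝓝 0) := by
    refine squeeze_zero (fun t => sq_nonneg _) (fun t => ?_) hdiff
    have h1 := sq_sub_le_bernoulliKL (hQ.mem (t + 1) i) (hQ.mem t i)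
    have h2 := Finset.single_le_sum (fun i _ => hKL t i) (Finset.mem_univ i)
    have h3 := hQ.objective_add_le t
    rw [div_mul_eq_mul_div, le_div_iff₀ hl]
    have h4 := mul_le_mul_of_nonneg_left h2 hl.le
    have h5 := mul_le_mul_of_nonneg_left h1 hl.le
    simp only [g]
    linarith
  have := hsq.sqrt
  simp only [Real.sqrt_sq_eq_abs, Real.sqrt_zero] at this
  exact (tendsto_zero_iff_abs_tendsto_zero _).2 this

theorem tendsto_dist (hQ : IsProximalSequence Ψ p lam Q) :
    Tendsto (fun t => dist (Q (t + 1)) (Q t)) atTop (𝓝 0) := by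
  simp only [dist_eq_norm]
  refine tendsto_zero_iff_norm_tendsto_zero.1 (tendsto_pi_nhds.2 fun i => ?_)
  exact hQ.tendsto_sub i

theorem mapClusterPt_critical (hQ : IsProximalSequence Ψ p lam Q) {a : Fin N → ℝ}
    (ha : MapClusterPt a atTop Q) (hmem : ∀ i, a i ∈ Set.Ioo (0 : ℝ) 1) (i : Fin N) :
    meanEnergyDeriv Ψ i a + (logit (a i) - logit (p i)) = 0 := by
  obtain ⟨U, hU, hlim⟩ := mapClusterPt_iff_ultrafilter.1 ha
  have h0 : ∀ j, Tendsto (fun t => Q t j) U (𝓝 (a j)) := tendsto_pi_nhds.1 hlim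
  have h1 : ∀ j, Tendsto (fun t => Q (t + 1) j) U (𝓝 (a j)) := fun j => by
    simpa using ((hQ.tendsto_sub j).mono_left hU).add (h0 j)
  have h2 : Tendsto (fun t => sweepState Q t i) U (𝓝 a) := by
    refine tendsto_pi_nhds.2 fun j => ?_
    by_cases hj : (j : ℕ) < i
    · simpa [sweepState, hj] using h1 j
    · simpa [sweepState, hj] using h0 j
  have hcont : Continuous (meanEnergyDeriv Ψ i) := by
    obtain ⟨P, hP⟩ := exists_eval_eq_meanEnergyDeriv Ψ i
    exact (funext hP : (fun q => MvPolynomial.eval q P) = _) ▸ MvPolynomial.continuous_eval P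
  have hc := continuousAt_logit (hmem i)
  have l0 := hc.tendsto.comp (h0 i)
  have l1 := hc.tendsto.comp (h1 i)
  have h3 := ((hcont.tendsto a).comp h2).add (l1.sub_const (logit (p i)))
    |>.add ((l1.sub l0).const_mul lam)
  have h4 := tendsto_nhds_unique h3
    ((tendsto_const_nhds (x := (0 : ℝ))).congr fun t => (hQ.first_order t i).symm)
  simpa using h4

theorem exists_tendsto (hQ : IsProximalSequence Ψ p lam Q) :
    ∃ a : Fin N → ℝ, (∀ i, a i ∈ Set.Ioo (0 : ℝ) 1) ∧ Tendsto Q atTop (𝓝 a) ∧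
      ∀ i, meanEnergyDeriv Ψ i a + (logit (a i) - logit (p i)) = 0 := by
  obtain ⟨K, hK, hQK, hKmem⟩ := hQ.exists_isCompact
  have hmem : ∀ a, MapClusterPt a atTop Q → ∀ i, a i ∈ Set.Ioo (0 : ℝ) 1 := fun a ha =>
    hKmem a (hK.isClosed.mem_of_mapClusterPt ha (Eventually.of_forall hQK))
  obtain ⟨a, haK, ha⟩ := hK.exists_mapClusterPt (f := atTop) (u := Q)
    (tendsto_principal.2 (Eventually.of_forall hQK))
  refine ⟨a, hmem a ha, ?_, hQ.mapClusterPt_critical ha (hmem a ha)⟩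
  refine hK.tendsto_nhds_of_unique_mapClusterPt (Eventually.of_forall hQK) fun b _ hb => ?_
  by_contra hab
  choose P hP using exists_eval_eq_meanEnergyDeriv Ψ
  have hempty : {x | MapClusterPt x atTop Q} = ∅ := by
    refine eq_empty_of_logit_eq_eval (fun i => MvPolynomial.C (logit (p i)) - P i) hmem
      (fun x hx i => ?_) fun x hx => ?_
    · have := hQ.mapClusterPt_critical hx (hmem x hx) i
      rw [map_sub, MvPolynomial.eval_C, hP]
      change logit (x i) = _
      linarith
    · by_cases hxb : x = b
      · exact accPt_mapClusterPt_of_ne hK hQK hQ.tendsto_dist hx ha (hxb ▸ hab)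
      · exact accPt_mapClusterPt_of_ne hK hQK hQ.tendsto_dist hx hb hxb
  exact (Set.eq_empty_iff_forall_notMem.1 hempty a) ha

end IsProximalSequence

end ProximalSweep

end MeanFieldConvergence

/-- Convergence of the proximal alternate minimization for the
mean-field KL objective `G` with bounded energy `Ψ` and priors
`p_i⁰ ∈ (0,1)`. The sequence `(Q^t)` starts at the prior and each coordinate
`q_i^{t+1}` is the unique minimizer over `q ∈ (0,1)` of
`q ↦ G(q_1^{t+1},…,q_{i−1}^{t+1}, q, q_{i+1}^t,…,q_N^t) + λ·l(q, q_i^t)`,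
with `l` the Bernoulli KL penalty. Then `(Q^t)` converges to a single point
`Q̄ ∈ (0,1)^N` which is a critical point of `G` (all partial derivatives of
`G` vanish at `Q̄`). -/
theorem proximal_alternate_minimization_converges
    (N : ℕ) (hN : 1 ≤ N) (lam : ℝ) (hlam : 0 < lam)
    (Ψ : (Fin N → Bool) → ℝ) (hΨbdd : ∃ M : ℝ, ∀ x, |Ψ x| ≤ M)
    (p0 : Fin N → ℝ) (hp0 : ∀ i, p0 i ∈ Set.Ioo (0 : ℝ) 1)
    (G : (Fin N → ℝ) → ℝ)
    (hG : ∀ q : Fin N → ℝ, G q =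
      (∑ x : Fin N → Bool, Ψ x * ∏ j, (if x j then q j else 1 - q j)) +
      ∑ i, ((1 - q i) * Real.log ((1 - q i) / (1 - p0 i)) +
        q i * Real.log (q i / p0 i)))
    (l : ℝ → ℝ → ℝ)
    (hl : ∀ q q0 : ℝ, l q q0 =
      q * Real.log (q / q0) + (1 - q) * Real.log ((1 - q) / (1 - q0)))
    (Q : ℕ → Fin N → ℝ)
    (hQ0 : Q 0 = p0)
    (hQmem : ∀ t i, Q t i ∈ Set.Ioo (0 : ℝ) 1)
    (hstep : ∀ t : ℕ, ∀ i : Fin N, ∀ q ∈ Set.Ioo (0 : ℝ) 1, q ≠ Q (t + 1) i →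
      G (fun j => if j < i then Q (t + 1) j else if j = i then Q (t + 1) i else Q t j) +
          lam * l (Q (t + 1) i) (Q t i)
        < G (fun j => if j < i then Q (t + 1) j else if j = i then q else Q t j) +
          lam * l q (Q t i)) :
    ∃ Qbar : Fin N → ℝ, (∀ i, Qbar i ∈ Set.Ioo (0 : ℝ) 1) ∧
      Filter.Tendsto Q Filter.atTop (nhds Qbar) ∧
      ∀ i, deriv (fun s => G (Function.update Qbar i s)) (Qbar i) = 0 := by
  have hG' : G = meanFieldObjective Ψ p0 := by
    ext q
    rw [hG, meanFieldObjective, meanEnergy]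
    congr 1
    exact Finset.sum_congr rfl fun i _ => add_comm _ _
  have hl' : l = bernoulliKL := by
    ext q q₀
    exact hl q q₀
  have hstate : ∀ t (i : Fin N) (q : ℝ),
      (fun j => if j < i then Q (t + 1) j else if j = i then q else Q t j) =
        Function.update (sweepState Q t i) i q := by
    intro t i q
    ext j
    by_cases h : j = i
    · subst h
      simp
    · simp [sweepState, h]
  have hQ : IsProximalSequence Ψ p0 lam Q :=
    { lam_pos := hlam
      prior_mem := hp0
      mem := hQmem
      init := hQ0
      step := fun t i q hq => by
        by_cases h : q = Q (t + 1) i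
        · rw [h]
        · have := hstep t i q hq h
          rw [hstate, hstate, hG', hl'] at this
          exact this.le }
  obtain ⟨a, ha, hlim, hcrit⟩ := hQ.exists_tendsto
  refine ⟨a, ha, hlim, fun i => ?_⟩
  rw [hG', ← hcrit i]
  exact (hasDerivAt_meanFieldObjective Ψ hp0 a i (ha i)).deriv
end
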